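/- There exists a constant c > 0 such that for every X there exists x ≥ X with π(x) − li(x) > c · x^{1/2} · log log log x / log x, and for every X there exists x ≥ X with π(x) − li(x) < −c · x^{1/2} · log log log x / log x. That is, π(x) − li(x) = Ω±(x^{1/2} log log log x / log x) as x → ∞ (Littlewood's oscillation theorem). -/

import Mathlib

open Finset Filter Real

/-- The prime counting function `π(x)`, the number of primes `p ≤ x`, as a real number. -/
noncomputable def primePi (x : ℝ) : ℝ :=
  (((Finset.Iic ⌊x⌋₊).filter Nat.Prime).card : ℝ)

/-- The logarithmic integral `li(x) = ∫_2^x dt / log t`. -/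
noncomputable def li (x : ℝ) : ℝ := ∫ t in (2:ℝ)..x, 1 / Real.log t


namespace LW

/-- multiplicity -/
noncomputable def mu (f : ℂ → ℂ) (z : ℂ) : ℕ := analyticOrderNatAt f z

lemma order_ne_top {f : ℂ → ℂ} (hf : Differentiable ℂ f) (h0 : f 0 ≠ 0) (z : ℂ) :
    analyticOrderAt f z ≠ ⊤ := by
  have hA : AnalyticOnNhd ℂ f Set.univ := fun x _ => hf.analyticAt x
  refine hA.analyticOrderAt_ne_top_of_isPreconnected isPreconnected_univ
    (Set.mem_univ 0) (Set.mem_univ z) ?_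
  rw [(hf.analyticAt 0).analyticOrderAt_eq_zero.2 h0]
  exact ENat.zero_ne_top

lemma zeros_finite {f : ℂ → ℂ} (hf : Differentiable ℂ f) (h0 : f 0 ≠ 0) (R : ℝ) :
    {z : ℂ | f z = 0 ∧ ‖z‖ ≤ R}.Finite := by
  have hA : AnalyticOnNhd ℂ f Set.univ := fun x _ => hf.analyticAt x
  have h := hA.preimage_zero_mem_codiscreteWithin (x := 0) h0 (Set.mem_univ _) isConnected_univ
  have h2 := mem_codiscrete'.mp h
  have h3 : (Metric.closedBall (0:ℂ) R ∩ (f ⁻¹' {0}ᶜ)ᶜ).Finite := by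
    apply ((isCompact_closedBall (0:ℂ) R).inter_right (isClosed_compl_iff.2 h2.1)).finite
    exact h2.2.mono Set.inter_subset_right
  refine h3.subset ?_
  rintro z ⟨h1, h2⟩
  simp [h1, h2]

lemma factor_one {f : ℂ → ℂ} (hf : Differentiable ℂ f) {ρ : ℂ} {n : ℕ}
    (hn : analyticOrderAt f ρ = n) :
    ∃ g : ℂ → ℂ, Differentiable ℂ g ∧ g ρ ≠ 0 ∧ ∀ z, f z = (z - ρ) ^ n * g z := by
  obtain ⟨g0, hg0, hne, hev⟩ := (hf.analyticAt ρ).analyticOrderAt_eq_natCast.1 hn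
  classical
  set g : ℂ → ℂ := fun z => if z = ρ then g0 ρ else f z / (z - ρ) ^ n with hg
  refine ⟨g, ?_, by simp [hg, hne], ?_⟩
  · intro z
    by_cases hz : z = ρ
    · subst hz
      have : g =ᶠ[nhds z] g0 := by
        filter_upwards [hev] with w hw
        by_cases h : w = z
        · simp [hg, h]
        · have : w - z ≠ 0 := sub_ne_zero.2 h
          simp only [hg, h, if_false, hw, smul_eq_mul]
          field_simp
      exact (hg0.congr this.symm).differentiableAt
    · have : g =ᶠ[nhds z] fun w => f w / (w - ρ) ^ n := by
        filter_upwards [isOpen_ne.mem_nhds hz] with w hw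
        simp only [hg]
        rw [if_neg hw]
      refine DifferentiableAt.congr_of_eventuallyEq ?_ this
      refine (hf z).div (by fun_prop) (pow_ne_zero _ (sub_ne_zero.2 hz))
  · intro z
    by_cases hz : z = ρ
    · subst hz
      simp only [hg, if_true]
      simpa using hev.self_of_nhds
    · have : z - ρ ≠ 0 := sub_ne_zero.2 hz
      simp only [hg, hz, if_false]
      field_simp

lemma factor_finset {f : ℂ → ℂ} (hf : Differentiable ℂ f) (h0 : f 0 ≠ 0) (S : Finset ℂ) :
    ∃ g : ℂ → ℂ, Differentiable ℂ g ∧ (∀ ρ ∈ S, g ρ ≠ 0) ∧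
      ∀ z, f z = (∏ ρ ∈ S, (z - ρ) ^ mu f ρ) * g z := by
  classical
  induction S using Finset.induction_on with
  | empty => exact ⟨f, hf, by simp, by simp⟩
  | insert a S ha ih =>
    obtain ⟨g, hg, hgne, hfg⟩ := ih
    have hP : Differentiable ℂ (fun z : ℂ => ∏ ρ ∈ S, (z - ρ) ^ mu f ρ) := by fun_prop
    have hPa : (∏ ρ ∈ S, (a - ρ) ^ mu f ρ) ≠ 0 := by
      refine Finset.prod_ne_zero_iff.2 fun ρ hρ => pow_ne_zero _ (sub_ne_zero.2 ?_)
      rintro rfl; exact ha hρ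
    have hord : analyticOrderAt g a = (mu f a : ℕ) := by
      have h1 : f = (fun z : ℂ => ∏ ρ ∈ S, (z - ρ) ^ mu f ρ) * g := by
        funext z; exact hfg z
      have h2 := analyticOrderAt_mul (hP.analyticAt a) (hg.analyticAt a)
      rw [← h1, (hP.analyticAt a).analyticOrderAt_eq_zero.2 hPa, zero_add] at h2
      rw [← h2, mu, analyticOrderNatAt, ENat.natCast_toNat (order_ne_top hf h0 a)]
    obtain ⟨k, hk, hka, hgk⟩ := factor_one hg hord
    refine ⟨k, hk, ?_, ?_⟩
    · intro ρ hρ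
      rcases Finset.mem_insert.1 hρ with rfl | h
      · exact hka
      · intro hc
        apply hgne ρ h
        rw [hgk, hc, mul_zero]
    · intro z
      rw [Finset.prod_insert ha, hfg z, hgk z]; ring

/-- zeros in the ball -/
noncomputable def zs {f : ℂ → ℂ} (hf : Differentiable ℂ f) (h0 : f 0 ≠ 0) (R : ℝ) : Finset ℂ :=
  (zeros_finite hf h0 R).toFinset

lemma mem_zs {f : ℂ → ℂ} (hf : Differentiable ℂ f) (h0 : f 0 ≠ 0) (R : ℝ) (z : ℂ) :
    z ∈ zs hf h0 R ↔ f z = 0 ∧ ‖z‖ ≤ R := by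
  simp [zs]

lemma factor_ball {f : ℂ → ℂ} (hf : Differentiable ℂ f) (h0 : f 0 = 1) (h0' : f 0 ≠ 0)
    {R M : ℝ} (hR : 0 < R)
    (hM : ∀ z, ‖z‖ = 3 * R → ‖f z‖ ≤ M) :
    ∃ G : ℂ → ℂ, Differentiable ℂ G ∧ G 0 = 1 ∧ (∀ z, ‖z‖ ≤ R → G z ≠ 0) ∧
      (∀ z, ‖z‖ ≤ 3 * R → ‖G z‖ ≤ M) ∧ (2:ℝ) ^ (∑ ρ ∈ zs hf h0' R, mu f ρ) ≤ M ∧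
      ∀ z, f z = (∏ ρ ∈ zs hf h0' R, (1 - z / ρ) ^ mu f ρ) * G z := by
  obtain ⟨g, hg, hgne, hfg⟩ := factor_finset hf h0' (zs hf h0' R)
  set S := zs hf h0' R with hS
  have hρ0 : ∀ ρ ∈ S, ρ ≠ 0 := by
    rintro ρ hρ rfl
    exact h0' ((mem_zs hf h0' R 0).1 hρ).1
  set c : ℂ := ∏ ρ ∈ S, (-ρ) ^ mu f ρ with hc
  have hcne : c ≠ 0 := Finset.prod_ne_zero_iff.2 fun ρ hρ => pow_ne_zero _ (neg_ne_zero.2 (hρ0 ρ hρ))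
  have hfac : ∀ z, f z = (∏ ρ ∈ S, (1 - z / ρ) ^ mu f ρ) * (c * g z) := by
    intro z
    rw [hfg z, ← mul_assoc, hc, ← Finset.prod_mul_distrib]
    congr 1
    refine Finset.prod_congr rfl fun ρ hρ => ?_
    rw [← mul_pow]
    congr 1
    have := hρ0 ρ hρ
    field_simp
    ring
  have hGd : Differentiable ℂ (fun z => c * g z) := by fun_prop
  have hG0 : c * g 0 = 1 := by
    have := hfac 0
    simp only [zero_div, sub_zero, one_pow, Finset.prod_const_one, one_mul] at this
    rw [← this, h0]
  -- bound on the sphere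
  have hsph : ∀ z : ℂ, ‖z‖ = 3 * R → (2:ℝ) ^ (∑ ρ ∈ S, mu f ρ) * ‖c * g z‖ ≤ M := by
    intro z hz
    refine le_trans ?_ (hM z hz)
    rw [hfac z, norm_mul (∏ ρ ∈ S, (1 - z / ρ) ^ mu f ρ) (c * g z)]
    refine mul_le_mul_of_nonneg_right ?_ (norm_nonneg (c * g z))
    rw [← Finset.prod_pow_eq_pow_sum, Complex.norm_prod]
    refine Finset.prod_le_prod (fun _ _ => by positivity) fun ρ hρ => ?_
    rw [norm_pow]
    refine pow_le_pow_left₀ (by norm_num) ?_ _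
    have h1 : ‖ρ‖ ≤ R := ((mem_zs hf h0' R ρ).1 hρ).2
    have h2 : 0 < ‖ρ‖ := norm_pos_iff.2 (hρ0 ρ hρ)
    have h3 : 3 ≤ ‖z / ρ‖ := by
      rw [norm_div, hz, le_div_iff₀ h2]; linarith
    have h4 := norm_sub_norm_le (z / ρ) (1:ℂ)
    rw [norm_sub_rev] at h4
    simp only [norm_one] at h4
    linarith
  have hmax : ∀ z : ℂ, ‖z‖ ≤ 3 * R → ‖c * g z‖ ≤ M / (2:ℝ) ^ (∑ ρ ∈ S, mu f ρ) := by
    intro z hz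
    refine Complex.norm_le_of_forall_mem_frontier_norm_le (U := Metric.ball (0:ℂ) (3 * R))
      (f := fun z => c * g z) Metric.isBounded_ball hGd.diffContOnCl ?_ ?_
    · intro w hw
      rw [frontier_ball _ (by positivity)] at hw
      have hw' : ‖w‖ = 3 * R := by simpa using hw
      rw [le_div_iff₀ (by positivity), mul_comm]
      exact hsph w hw'
    · rw [closure_ball _ (by positivity)]
      simpa using hz
  have hM1 : (2:ℝ) ^ (∑ ρ ∈ S, mu f ρ) ≤ M := by
    have := hmax 0 (by simp; positivity)
    rw [hG0, norm_one, le_div_iff₀ (by positivity), one_mul] at this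
    exact this
  refine ⟨fun z => c * g z, hGd, hG0, ?_, ?_, hM1, hfac⟩
  · intro z hz hcz0
    have hcz : c * g z = 0 := hcz0
    have h1 : g z = 0 := by
      rcases mul_eq_zero.1 hcz with h | h
      · exact absurd h hcne
      · exact h
    have hz0 : f z = 0 := by rw [hfac z, hcz, mul_zero]
    exact hgne z ((mem_zs hf h0' R z).2 ⟨hz0, hz⟩) h1
  · intro z hz
    refine (hmax z hz).trans ?_
    refine div_le_self ?_ ?_
    · exact le_trans (by positivity) hM1
    · exact one_le_pow₀ (by norm_num)

lemma logDeriv_diff_bound {G : ℂ → ℂ} (hG : Differentiable ℂ G) (h0 : G 0 = 1) {R M : ℝ}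
    (hR : 0 < R) (hM : 0 < M) (hne : ∀ z, ‖z‖ ≤ R → G z ≠ 0)
    (hb : ∀ z, ‖z‖ ≤ R → ‖G z‖ ≤ Real.exp M) {s : ℂ} (hs : ‖s‖ < R / 4) :
    ‖logDeriv G s - logDeriv G 0‖ ≤ 64 * M * ‖s‖ / R ^ 2 := by
  have hdl : DifferentiableOn ℂ (logDeriv G) (Metric.ball 0 R) := by
    intro z hz
    have hz' : ‖z‖ ≤ R := by simpa using (Metric.mem_ball.1 hz).le
    have : DifferentiableAt ℂ (fun w => deriv G w / G w) z :=
      (hG.deriv z).div (hG z) (hne z hz')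
    exact this.differentiableWithinAt
  obtain ⟨L0, hL0⟩ := hdl.isExactOn_ball
  set L : ℂ → ℂ := fun z => L0 z - L0 0 with hL
  have hLd : ∀ z ∈ Metric.ball (0:ℂ) R, HasDerivAt L (logDeriv G z) z :=
    fun z hz => (hL0 z hz).sub_const _
  have hexp : ∀ z ∈ Metric.ball (0:ℂ) R, G z = Complex.exp (L z) := by
    have hq : ∀ z ∈ Metric.ball (0:ℂ) R, HasDerivAt (fun z => G z * Complex.exp (-L z)) 0 z := by
      intro z hz
      have hz' : ‖z‖ ≤ R := by simpa using (Metric.mem_ball.1 hz).le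
      have := ((hG z).hasDerivAt).mul ((hLd z hz).neg.cexp)
      refine this.congr_deriv ?_
      have := hne z hz'
      simp only [logDeriv_apply]
      field_simp
      ring
    intro z hz
    have hc : (fun z => G z * Complex.exp (-L z)) z = (fun z => G z * Complex.exp (-L z)) 0 := by
      refine (convex_ball (0:ℂ) R).is_const_of_fderivWithin_eq_zero (𝕜 := ℂ)
        (fun w hw => (hq w hw).differentiableAt.differentiableWithinAt) ?_ hz (by simpa using hR)
      intro w hw
      rw [fderivWithin_of_isOpen Metric.isOpen_ball hw]
      have := (hq w hw).hasFDerivAt.fderiv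
      rw [this]; ext; simp
    simp only [h0, hL, sub_self, neg_zero, Complex.exp_zero, mul_one] at hc
    have h2 : Complex.exp (-(L0 z - L0 0)) ≠ 0 := Complex.exp_ne_zero _
    rw [Complex.exp_neg] at hc
    have h3 : Complex.exp (L0 z - L0 0) ≠ 0 := Complex.exp_ne_zero _
    field_simp at hc
    rw [hc]
  have hLdiff : DifferentiableOn ℂ L (Metric.ball 0 R) :=
    fun z hz => (hLd z hz).differentiableAt.differentiableWithinAt
  have hmaps : Set.MapsTo L (Metric.ball 0 R) {z | z.re ≤ M} := by
    intro z hz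
    have hz' : ‖z‖ ≤ R := by simpa using (Metric.mem_ball.1 hz).le
    have := hb z hz'
    rw [hexp z hz, Complex.norm_exp] at this
    exact Real.exp_le_exp.1 this
  have hLb : ∀ z : ℂ, ‖z‖ ≤ R / 2 → ‖L z‖ ≤ 2 * M := by
    intro z hz
    have hzb : z ∈ Metric.ball (0:ℂ) R := by simpa using (by linarith : ‖z‖ < R)
    have := Complex.borelCaratheodory_zero hM hLdiff hmaps hR hzb (by simp [hL])
    refine this.trans ?_
    rw [div_le_iff₀ (by linarith)]
    nlinarith
  have hdL : ∀ z : ℂ, ‖z‖ < R / 4 → ‖logDeriv G z‖ ≤ 8 * M / R := by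
    intro z hz
    have hzb : z ∈ Metric.ball (0:ℂ) R := by simpa using (by linarith : ‖z‖ < R)
    rw [← (hLd z hzb).deriv]
    have hsub : Metric.closedBall z (R/4) ⊆ Metric.ball (0:ℂ) R := by
      intro w hw
      have h1 : ‖w - z‖ ≤ R / 4 := by simpa [dist_eq_norm] using hw
      have h2 : ‖w‖ ≤ ‖w - z‖ + ‖z‖ := by simpa using norm_add_le (w - z) z
      simpa using (by linarith : ‖w‖ < R)
    have := Complex.norm_deriv_le_of_forall_mem_sphere_norm_le (c := z) (R := R/4) (C := 2 * M)
      (f := L) (by positivity) ((hLdiff.mono (by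
        rw [closure_ball _ (by positivity)]; exact hsub)).diffContOnCl) ?_
    · refine this.trans (le_of_eq ?_)
      field_simp
      ring
    · intro w hw
      have h1 : ‖w - z‖ = R / 4 := by simpa [dist_eq_norm] using hw
      have h2 : ‖w‖ ≤ ‖w - z‖ + ‖z‖ := by simpa using norm_add_le (w - z) z
      exact hLb w (by linarith)
  have hfin := Complex.dist_le_div_mul_dist_of_mapsTo_ball (f := logDeriv G) (c := 0) (z := s)
    (R₁ := R / 4) (R₂ := 16 * M / R)
    (hdl.mono (Metric.ball_subset_ball (by linarith))) ?_ (by simpa using hs)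
  · rw [dist_eq_norm, dist_zero_right] at hfin
    refine hfin.trans (le_of_eq ?_)
    field_simp
    ring
  · intro z hz
    have hz' : ‖z‖ < R / 4 := by simpa using hz
    rw [Metric.mem_closedBall, dist_eq_norm]
    refine (norm_sub_le _ _).trans ?_
    have h1 := hdL z hz'
    have h2 := hdL 0 (by simp; positivity)
    calc _ ≤ 8 * M / R + 8 * M / R := add_le_add h1 h2
      _ = 16 * M / R := by ring

end LW


namespace LW

/-- the type of zeros -/
abbrev ZZ (f : ℂ → ℂ) := {ρ : ℂ // f ρ = 0}

/-- order 3/2 growth -/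
def Grow (f : ℂ → ℂ) (C : ℝ) : Prop :=
  ∀ R : ℝ, 1 ≤ R → ∀ z : ℂ, ‖z‖ ≤ R → ‖f z‖ ≤ Real.exp (C * R ^ ((3:ℝ)/2))

lemma three_pow : (3:ℝ) ^ ((3:ℝ)/2) ≤ 6 := by
  rw [show (3:ℝ)/2 = 1 + 1/2 by norm_num, Real.rpow_add (by norm_num), Real.rpow_one,
    ← Real.sqrt_eq_rpow]
  nlinarith [Real.sqrt_nonneg 3, Real.sq_sqrt (show (0:ℝ) ≤ 3 by norm_num)]

lemma Grow.three {f : ℂ → ℂ} {C : ℝ} (hC : 0 < C) (hg : Grow f C) {R : ℝ} (hR : 1 ≤ R) :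
    ∀ z : ℂ, ‖z‖ = 3 * R → ‖f z‖ ≤ Real.exp (6 * C * R ^ ((3:ℝ)/2)) := by
  intro z hz
  refine (hg (3 * R) (by linarith) z hz.le).trans (Real.exp_le_exp.2 ?_)
  rw [Real.mul_rpow (by norm_num) (by linarith)]
  have := three_pow
  have h2 : 0 ≤ R ^ ((3:ℝ)/2) := Real.rpow_nonneg (by linarith) _
  nlinarith [mul_nonneg hC.le h2]

lemma count_bound {f : ℂ → ℂ} (hf : Differentiable ℂ f) (h0 : f 0 = 1) (h0' : f 0 ≠ 0)
    {C : ℝ} (hC : 0 < C) (hg : Grow f C) {R : ℝ} (hR : 1 ≤ R) :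
    ((∑ ρ ∈ zs hf h0' R, mu f ρ : ℕ) : ℝ) ≤ 12 * C * R ^ ((3:ℝ)/2) := by
  obtain ⟨G, -, -, -, -, h, -⟩ := factor_ball hf h0 h0' (R := R) (by linarith) (hg.three hC hR)
  have h1 := Real.log_le_log (by positivity) h
  rw [Real.log_exp, Real.log_pow] at h1
  have h2 := Real.log_two_gt_d9
  have h3 : (0:ℝ) ≤ ((∑ ρ ∈ zs hf h0' R, mu f ρ : ℕ) : ℝ) := by positivity
  nlinarith

lemma zero_norm_pos {f : ℂ → ℂ} (h0' : f 0 ≠ 0) (ρ : ZZ f) : 0 < ‖(ρ:ℂ)‖ := by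
  rw [norm_pos_iff]; intro h; apply h0'; have := ρ.2; rwa [h] at this

lemma mu_summable {f : ℂ → ℂ} (hf : Differentiable ℂ f) (h0 : f 0 = 1) (h0' : f 0 ≠ 0)
    {C : ℝ} (hC : 0 < C) (hg : Grow f C) :
    Summable fun ρ : ZZ f => (mu f ρ : ℝ) * (1 + ‖(ρ:ℂ)‖) ^ (-(7/4) : ℝ) := by
  classical
  set r : ℝ := (2:ℝ) ^ (-(1/4) : ℝ) with hr
  have hr0 : 0 < r := by positivity
  have hr1 : r < 1 := Real.rpow_lt_one_of_one_lt_of_neg (by norm_num) (by norm_num)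
  refine summable_of_sum_le (c := 48 * C * (1 - r)⁻¹) (fun ρ => by positivity) ?_
  intro F
  set k : ZZ f → ℕ := fun ρ => ⌈Real.logb 2 ‖(ρ:ℂ)‖⌉₊ with hk
  have hk1 : ∀ ρ : ZZ f, ‖(ρ:ℂ)‖ ≤ (2:ℝ) ^ (k ρ) := by
    intro ρ
    have h1 := Nat.le_ceil (Real.logb 2 ‖(ρ:ℂ)‖)
    rw [Real.logb_le_iff_le_rpow (by norm_num) (zero_norm_pos h0' ρ), Real.rpow_natCast] at h1
    exact h1
  have hk2 : ∀ ρ : ZZ f, (2:ℝ) ^ (k ρ) ≤ 2 * (1 + ‖(ρ:ℂ)‖) := by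
    intro ρ
    have hp := zero_norm_pos h0' ρ
    by_cases h : Real.logb 2 ‖(ρ:ℂ)‖ ≤ 0
    · have : k ρ = 0 := Nat.ceil_eq_zero.2 h
      rw [this]; norm_num; linarith
    · have h1 := Nat.ceil_lt_add_one (not_le.1 h).le
      have h2 : (2:ℝ) ^ ((k ρ : ℕ) : ℝ) ≤ (2:ℝ) ^ (Real.logb 2 ‖(ρ:ℂ)‖ + 1) :=
        Real.rpow_le_rpow_of_exponent_le (by norm_num) h1.le
      rw [Real.rpow_natCast, Real.rpow_add (by norm_num),
        Real.rpow_logb (by norm_num) (by norm_num) hp, Real.rpow_one] at h2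
      linarith
  have hmain : ∀ n : ℕ, ∑ ρ ∈ F with k ρ = n, (mu f ρ : ℝ) * (1 + ‖(ρ:ℂ)‖) ^ (-(7/4) : ℝ)
      ≤ 48 * C * r ^ n := by
    intro n
    have hb : ∀ ρ ∈ F.filter (fun ρ => k ρ = n),
        (mu f ρ : ℝ) * (1 + ‖(ρ:ℂ)‖) ^ (-(7/4) : ℝ) ≤
          (mu f ρ : ℝ) * (4 * ((2:ℝ) ^ n) ^ (-(7/4) : ℝ)) := by
      intro ρ hρ
      have hn : k ρ = n := (Finset.mem_filter.1 hρ).2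
      refine mul_le_mul_of_nonneg_left ?_ (by positivity)
      have h2 := hk2 ρ
      rw [hn] at h2
      have h3 : (1 + ‖(ρ:ℂ)‖) ^ (-(7/4) : ℝ) ≤ ((2:ℝ) ^ n / 2) ^ (-(7/4) : ℝ) :=
        Real.rpow_le_rpow_of_nonpos (by positivity) (by linarith) (by norm_num)
      refine h3.trans ?_
      rw [Real.div_rpow (by positivity) (by norm_num), div_eq_mul_inv, mul_comm,
        ← Real.rpow_neg (by norm_num)]
      refine mul_le_mul_of_nonneg_right ?_ (by positivity)
      calc (2:ℝ) ^ (-(-(7/4)) : ℝ) ≤ (2:ℝ) ^ (2:ℝ) :=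
            Real.rpow_le_rpow_of_exponent_le (by norm_num) (by norm_num)
        _ = 4 := by norm_num
    refine (Finset.sum_le_sum hb).trans ?_
    rw [← Finset.sum_mul]
    have hN : ∑ ρ ∈ F with k ρ = n, (mu f ρ : ℝ) ≤ 12 * C * ((2:ℝ) ^ n) ^ ((3:ℝ)/2) := by
      refine le_trans ?_ (count_bound hf h0 h0' hC hg (R := (2:ℝ) ^ n) (one_le_pow₀ (by norm_num)))
      push_cast
      refine (Finset.sum_map (F.filter (fun ρ => k ρ = n)) (Function.Embedding.subtype _)
        (fun ρ : ℂ => (mu f ρ : ℝ))).symm.trans_le ?_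
      refine Finset.sum_le_sum_of_subset_of_nonneg ?_ (fun _ _ _ => by positivity)
      intro z hz
      obtain ⟨ρ, hρ, rfl⟩ := Finset.mem_map.1 hz
      rw [mem_zs]
      refine ⟨ρ.2, ?_⟩
      have := hk1 ρ
      rw [(Finset.mem_filter.1 hρ).2] at this
      exact this
    refine (mul_le_mul_of_nonneg_right hN (by positivity)).trans (le_of_eq ?_)
    have : ((2:ℝ) ^ n) ^ ((3:ℝ)/2) * ((2:ℝ) ^ n) ^ (-(7/4) : ℝ) = r ^ n := by
      rw [← Real.rpow_add (by positivity), hr, ← Real.rpow_natCast, ← Real.rpow_natCast,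
        ← Real.rpow_mul (by norm_num), ← Real.rpow_mul (by norm_num)]
      congr 1; ring
    rw [← this]; ring
  obtain ⟨K, hK⟩ : ∃ K, ∀ ρ ∈ F, k ρ ∈ Finset.range K := by
    refine ⟨F.sup k + 1, fun ρ hρ => Finset.mem_range.2 (Nat.lt_succ_of_le (Finset.le_sup hρ))⟩
  rw [← Finset.sum_fiberwise_of_maps_to hK]
  refine (Finset.sum_le_sum fun n _ => hmain n).trans ?_
  rw [← Finset.mul_sum]
  refine mul_le_mul_of_nonneg_left ?_ (by positivity)
  rw [← tsum_geometric_of_lt_one hr0.le hr1]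
  exact (summable_geometric_of_lt_one hr0.le hr1).sum_le_tsum _ (fun _ _ => by positivity)

lemma mu_pos {f : ℂ → ℂ} (hf : Differentiable ℂ f) (h0' : f 0 ≠ 0) (ρ : ZZ f) :
    0 < mu f ρ := by
  rw [mu, Nat.pos_iff_ne_zero]
  intro h
  have h1 := ENat.natCast_toNat (order_ne_top hf h0' (ρ:ℂ))
  rw [analyticOrderNatAt] at h
  rw [h] at h1
  have := (hf.analyticAt (ρ:ℂ)).analyticOrderAt_eq_zero.1 h1.symm
  exact this ρ.2

lemma zz_countable {f : ℂ → ℂ} (hf : Differentiable ℂ f) (h0 : f 0 = 1) (h0' : f 0 ≠ 0)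
    {C : ℝ} (hC : 0 < C) (hg : Grow f C) : Countable (ZZ f) := by
  have := (mu_summable hf h0 h0' hC hg).countable_support
  rw [← Set.countable_univ_iff]
  refine this.mono fun ρ _ => ?_
  have h1 := mu_pos hf h0' ρ
  have : 0 < (mu f ρ : ℝ) * (1 + ‖(ρ:ℂ)‖) ^ (-(7/4) : ℝ) := by positivity
  exact this.ne'

lemma mu_summable_sq {f : ℂ → ℂ} (hf : Differentiable ℂ f) (h0 : f 0 = 1) (h0' : f 0 ≠ 0)
    {C : ℝ} (hC : 0 < C) (hg : Grow f C) :
    Summable fun ρ : ZZ f => (mu f ρ : ℝ) * ((1 + ‖(ρ:ℂ)‖) ^ 2)⁻¹ := by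
  refine Summable.of_nonneg_of_le (fun _ => by positivity) (fun ρ => ?_)
    (mu_summable hf h0 h0' hC hg)
  refine mul_le_mul_of_nonneg_left ?_ (by positivity)
  rw [← Real.rpow_natCast, ← Real.rpow_neg (by positivity)]
  exact Real.rpow_le_rpow_of_exponent_le (by linarith [norm_nonneg (ρ:ℂ)]) (by norm_num)

lemma logDeriv_factor {f : ℂ → ℂ} (hf : Differentiable ℂ f) (h0' : f 0 ≠ 0)
    {R : ℝ} {G : ℂ → ℂ} (hG : Differentiable ℂ G) {s : ℂ} (hs : f s ≠ 0) (hGs : G s ≠ 0)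
    (hfac : ∀ z, f z = (∏ ρ ∈ zs hf h0' R, (1 - z / ρ) ^ mu f ρ) * G z) :
    logDeriv f s = ∑ ρ ∈ zs hf h0' R, (mu f ρ : ℂ) * (1 / (s - ρ)) + logDeriv G s := by
  have hρ0 : ∀ ρ ∈ zs hf h0' R, ρ ≠ 0 := by
    rintro ρ hρ rfl
    exact h0' ((mem_zs hf h0' R 0).1 hρ).1
  have hρs : ∀ ρ ∈ zs hf h0' R, s - ρ ≠ 0 := by
    intro ρ hρ h
    rw [sub_eq_zero] at h
    subst h
    exact hs ((mem_zs hf h0' R _).1 hρ).1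
  have hne : ∀ ρ ∈ zs hf h0' R, (1 - s / ρ) ≠ 0 := by
    intro ρ hρ h
    have := hρ0 ρ hρ
    apply hρs ρ hρ
    field_simp at h
    linear_combination -h
  have hfe : f = fun z => (∏ ρ ∈ zs hf h0' R, (1 - z / ρ) ^ mu f ρ) * G z := funext hfac
  conv_lhs => rw [hfe]
  rw [logDeriv_mul s (Finset.prod_ne_zero_iff.2 fun ρ hρ => pow_ne_zero _ (hne ρ hρ)) hGs
    (by fun_prop) (hG s)]
  congr 1
  rw [logDeriv_prod (f := fun (ρ z : ℂ) => (1 - z / ρ) ^ mu f ρ)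
    (fun ρ hρ => pow_ne_zero _ (hne ρ hρ)) (fun ρ _ => by fun_prop)]
  refine Finset.sum_congr rfl fun ρ hρ => ?_
  have h1 : HasDerivAt (fun z : ℂ => 1 - z / ρ) (-(1/ρ)) s := by
    simpa using ((hasDerivAt_id s).div_const ρ).const_sub 1
  have h2 : logDeriv (fun z : ℂ => (1 - z / ρ) ^ mu f ρ) s =
      (mu f ρ : ℂ) * logDeriv (fun z : ℂ => 1 - z / ρ) s := by
    exact logDeriv_fun_pow h1.differentiableAt _
  rw [h2, logDeriv_apply, h1.deriv]
  congr 1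
  have := hρ0 ρ hρ
  have h3 := hρs ρ hρ
  have h4 := hne ρ hρ
  have h5 : ρ - s ≠ 0 := by intro h; apply h3; linear_combination -h
  have h6 : 1 - s / ρ = (ρ - s) / ρ := by field_simp
  rw [h6]
  field_simp
  ring

lemma term_bound {ρ s : ℂ} (h : 2 * ‖s‖ + 1 ≤ ‖ρ‖) :
    ‖1 / (s - ρ) + 1 / ρ‖ ≤ 8 * ‖s‖ * ((1 + ‖ρ‖) ^ 2)⁻¹ := by
  have hs0 := norm_nonneg s
  have h1 : ‖ρ‖ / 2 ≤ ‖s - ρ‖ := by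
    have := norm_sub_norm_le ρ s
    rw [norm_sub_rev] at this; linarith
  have hρ : ρ ≠ 0 := norm_pos_iff.1 (by linarith)
  have hsρ : s - ρ ≠ 0 := norm_pos_iff.1 (by linarith)
  have : 1 / (s - ρ) + 1 / ρ = s / ((s - ρ) * ρ) := by field_simp; ring
  rw [this, norm_div, norm_mul, ← div_eq_mul_inv, div_le_div_iff₀ (by positivity) (by positivity)]
  have h2 : (1 + ‖ρ‖) ^ 2 ≤ 4 * ‖ρ‖ ^ 2 := by nlinarith
  have h3 : ‖ρ‖ ^ 2 ≤ 2 * (‖s - ρ‖ * ‖ρ‖) := by nlinarith [norm_nonneg ρ]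
  nlinarith

lemma partial_fractions {f : ℂ → ℂ} (hf : Differentiable ℂ f) (h0 : f 0 = 1) (h0' : f 0 ≠ 0)
    {C : ℝ} (hC : 0 < C) (hg : Grow f C) {s : ℂ} (hs : f s ≠ 0) :
    HasSum (fun ρ : ZZ f => (mu f ρ : ℂ) * (1 / (s - ρ) + 1 / (ρ:ℂ)))
      (logDeriv f s - logDeriv f 0) := by
  classical
  have hsum : Summable (fun ρ : ZZ f => (mu f ρ : ℂ) * (1 / (s - ρ) + 1 / (ρ:ℂ))) := by
    refine Summable.of_norm_bounded_eventually
      ((mu_summable_sq hf h0 h0' hC hg).mul_left (8 * ‖s‖)) ?_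
    have hfin : {ρ : ZZ f | ‖(ρ:ℂ)‖ ≤ 2 * ‖s‖ + 1}.Finite := by
      refine Set.Finite.of_finite_image (f := Subtype.val)
        ((zeros_finite hf h0' (2 * ‖s‖ + 1)).subset ?_) Subtype.val_injective.injOn
      rintro _ ⟨ρ, hρ, rfl⟩
      exact ⟨ρ.2, hρ⟩
    refine Filter.mem_of_superset hfin.compl_mem_cofinite fun ρ hρ => ?_
    have h1 : 2 * ‖s‖ + 1 < ‖(ρ:ℂ)‖ := by simpa using hρ
    have h2 := term_bound h1.le
    simp only [Set.mem_ofPred_eq, norm_mul, Complex.norm_natCast]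
    calc _ ≤ (mu f ρ : ℝ) * (8 * ‖s‖ * ((1 + ‖(ρ:ℂ)‖) ^ 2)⁻¹) :=
          mul_le_mul_of_nonneg_left h2 (by positivity)
      _ = _ := by ring
  set g : ZZ f → ℂ := fun ρ => (mu f ρ : ℂ) * (1 / (s - ρ) + 1 / (ρ:ℂ)) with hgdef
  set S : ℕ → Finset (ZZ f) := fun n => (zs hf h0' n).subtype (fun z => f z = 0) with hS
  have hSt : Tendsto S atTop atTop := by
    refine tendsto_atTop_finset_of_monotone ?_ ?_
    · intro m n hmn ρ hρ
      simp only [hS, Finset.mem_subtype, mem_zs] at hρ ⊢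
      exact ⟨hρ.1, hρ.2.trans (by exact_mod_cast hmn)⟩
    · intro ρ
      obtain ⟨n, hn⟩ := exists_nat_ge ‖(ρ:ℂ)‖
      refine ⟨n, ?_⟩
      simp only [hS, Finset.mem_subtype, mem_zs]
      exact ⟨ρ.2, hn⟩
  have h1 : Tendsto (fun n => ∑ ρ ∈ S n, g ρ) atTop (nhds (∑' ρ, g ρ)) :=
    hsum.hasSum.comp hSt
  have h2 : Tendsto (fun n => ∑ ρ ∈ S n, g ρ) atTop (nhds (logDeriv f s - logDeriv f 0)) := by
    rw [tendsto_iff_norm_sub_tendsto_zero]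
    have hlim : Tendsto (fun n : ℕ => 64 * (6 * C) * ‖s‖ * ((n:ℝ) ^ (-(1/2) : ℝ))) atTop
        (nhds 0) := by
      have : Tendsto (fun n : ℕ => ((n:ℝ) ^ (-(1/2) : ℝ))) atTop (nhds 0) :=
        (tendsto_rpow_neg_atTop (by norm_num)).comp tendsto_natCast_atTop_atTop
      simpa using this.const_mul (64 * (6 * C) * ‖s‖)
    refine squeeze_zero' (Eventually.of_forall fun _ => norm_nonneg _) ?_ hlim
    obtain ⟨N, hN⟩ := exists_nat_gt (4 * ‖s‖)
    filter_upwards [eventually_ge_atTop N, eventually_ge_atTop 1] with n hn hn1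
    have hn1' : (1:ℝ) ≤ n := by exact_mod_cast hn1
    have hn' : 4 * ‖s‖ < n := hN.trans_le (by exact_mod_cast hn)
    have hnp : (0:ℝ) < n := by linarith
    obtain ⟨G, hG, hG0, hGne, hGb, -, hfac⟩ :=
      factor_ball hf h0 h0' (R := n) (by linarith) (hg.three hC hn1')
    have hb := logDeriv_diff_bound hG hG0 (R := n) (M := 6 * C * (n:ℝ) ^ ((3:ℝ)/2)) hnp
      (by positivity) hGne (fun z hz => hGb z (by linarith)) (s := s) (by linarith)
    have e1 := logDeriv_factor hf h0' hG hs (hGne s (by linarith [norm_nonneg s])) hfac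
    have e2 := logDeriv_factor hf h0' hG h0' (by rw [hG0]; exact one_ne_zero) hfac
    have e3 : ∑ ρ ∈ S n, g ρ = ∑ ρ ∈ zs hf h0' n, (mu f ρ : ℂ) * (1 / (s - ρ) + 1 / ρ) := by
      simp only [hS, hgdef]
      rw [Finset.sum_subtype_of_mem (f := fun ρ : ℂ => (mu f ρ : ℂ) * (1 / (s - ρ) + 1 / ρ))]
      intro z hz
      exact ((mem_zs hf h0' _ z).1 hz).1
    have e4 : ∑ ρ ∈ S n, g ρ - (logDeriv f s - logDeriv f 0) =
        -(logDeriv G s - logDeriv G 0) := by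
      have e5 : ∑ ρ ∈ zs hf h0' n, (mu f ρ : ℂ) * (1 / (s - ρ) + 1 / ρ) =
          ∑ ρ ∈ zs hf h0' n, (mu f ρ : ℂ) * (1 / (s - ρ)) -
          ∑ ρ ∈ zs hf h0' n, (mu f ρ : ℂ) * (1 / (0 - ρ)) := by
        rw [← Finset.sum_sub_distrib]
        refine Finset.sum_congr rfl fun ρ _ => ?_
        rw [zero_sub, one_div_neg_eq_neg_one_div]; ring
      rw [e3, e5, e1, e2]; ring
    rw [e4, norm_neg]
    refine hb.trans (le_of_eq ?_)
    have e6 : (n:ℝ) ^ (-(1/2) : ℝ) = (n:ℝ) ^ ((3:ℝ)/2) / (n:ℝ) ^ 2 := by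
      rw [← Real.rpow_natCast, ← Real.rpow_sub hnp]; norm_num
    rw [e6]; ring
  rw [← tendsto_nhds_unique h1 h2]
  exact hsum.hasSum

end LW


namespace LW

/-- entire completed zeta -/
noncomputable def xi (s : ℂ) : ℂ := s * (s - 1) * completedRiemannZeta₀ s + 1

lemma xi_diff : Differentiable ℂ xi := by
  have := differentiable_completedZeta₀
  unfold xi
  fun_prop

lemma xi_zero : xi 0 = 1 := by simp [xi]

lemma xi_zero' : xi 0 ≠ 0 := by simp [xi]

lemma xi_one_sub (s : ℂ) : xi (1 - s) = xi s := by
  unfold xi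
  rw [completedRiemannZeta₀_one_sub]; ring

lemma xi_eq {s : ℂ} (h0 : s ≠ 0) (h1 : s ≠ 1) : xi s = s * (s - 1) * completedRiemannZeta s := by
  unfold xi
  rw [completedRiemannZeta_eq]
  have : s - 1 ≠ 0 := sub_ne_zero.2 h1
  have h2 : 1 - s ≠ 0 := sub_ne_zero.2 h1.symm
  field_simp
  ring

open HurwitzZeta MeasureTheory in
lemma fmod_bound : ∃ K p : ℝ, 0 < K ∧ 0 < p ∧ ∀ t : ℝ, 1 < t →
    ‖(hurwitzEvenFEPair 0).f_modif t‖ ≤ K * Real.exp (-p * t) := by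
  obtain ⟨p, hp, hO⟩ := isBigO_atTop_evenKernel_sub 0
  simp only [if_true] at hO
  obtain ⟨c, hc0, hc⟩ := hO.exists_pos
  rw [Asymptotics.isBigOWith_iff, eventually_atTop] at hc
  obtain ⟨T, hT⟩ := hc
  have hcont : ContinuousOn (fun t => evenKernel 0 t - 1) (Set.Icc 1 T) :=
    ((continuousOn_evenKernel 0).mono (fun t ht => lt_of_lt_of_le one_pos ht.1)).sub
      continuousOn_const
  obtain ⟨B, hB⟩ := isCompact_Icc.exists_bound_of_continuousOn hcont
  have hfm : ∀ t : ℝ, 1 < t → ‖(hurwitzEvenFEPair 0).f_modif t‖ = ‖evenKernel 0 t - 1‖ := by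
    intro t ht
    rw [WeakFEPair.f_modif, Pi.add_apply, Set.indicator_of_mem (Set.mem_Ioi.2 ht),
      Set.indicator_of_notMem (fun h => absurd h.2 (not_lt.2 ht.le)), add_zero]
    simp only [hurwitzEvenFEPair, Function.comp, if_true]
    rw [← Complex.ofReal_one, ← Complex.ofReal_sub, Complex.norm_real]
  refine ⟨c + |B| * Real.exp (p * T), p, by positivity, hp, fun t ht => ?_⟩
  rw [hfm t ht]
  rcases le_total T t with h | h
  · refine (hT t h).trans ?_
    rw [Real.norm_of_nonneg (Real.exp_pos _).le]
    refine mul_le_mul_of_nonneg_right ?_ (Real.exp_pos _).le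
    have : 0 ≤ |B| * Real.exp (p * T) := by positivity
    linarith
  · refine (hB t ⟨ht.le, h⟩).trans ?_
    rw [add_mul, mul_assoc, ← Real.exp_add]
    have h1 : (1:ℝ) ≤ Real.exp (p * T + -p * t) := Real.one_le_exp (by nlinarith)
    have h2 : |B| * 1 ≤ |B| * Real.exp (p * T + -p * t) :=
      mul_le_mul_of_nonneg_left h1 (abs_nonneg _)
    have h3 : 0 ≤ c * Real.exp (-p * t) := by positivity
    linarith [le_abs_self B]

open HurwitzZeta MeasureTheory in
lemma lam_bound : ∃ A q : ℝ, 0 < A ∧ 1 ≤ q ∧ ∀ (s : ℂ) (n : ℕ), 1/2 ≤ s.re → s.re / 2 ≤ n →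
    ‖completedRiemannZeta₀ s‖ ≤ A * ((n.factorial : ℝ) * q ^ n) := by
  obtain ⟨K, p, hK, hp, hb⟩ := fmod_bound
  set F := (hurwitzEvenFEPair 0).f_modif with hF
  have hconv : MellinConvergent F ((1/4 : ℝ) : ℂ) :=
    ((hurwitzEvenFEPair 0).isStrongFEPair_toStrongFEPair.hasMellin ((1/4 : ℝ) : ℂ)).1
  have hint0 : IntegrableOn (fun t : ℝ => t ^ (-(3/4) : ℝ) * ‖F t‖) (Set.Ioi 0) := by
    have := hconv.norm
    refine (integrableOn_congr_fun (fun t ht => ?_) measurableSet_Ioi).1 this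
    have ht' : 0 < t := ht
    simp only [norm_smul]
    rw [Complex.norm_cpow_eq_rpow_re_of_pos ht']
    congr 2
    simp; norm_num
  have hexp : IntegrableOn (fun t : ℝ => Real.exp (-(p/2) * t)) (Set.Ioi 0) :=
    integrableOn_exp_mul_Ioi (by linarith) 0
  set I1 := ∫ t in Set.Ioi (0:ℝ), t ^ (-(3/4) : ℝ) * ‖F t‖ with hI1
  set I2 := ∫ t in Set.Ioi (0:ℝ), Real.exp (-(p/2) * t) with hI2
  have hI1' : 0 ≤ I1 := setIntegral_nonneg measurableSet_Ioi fun t ht =>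
    mul_nonneg (Real.rpow_nonneg (le_of_lt ht) _) (norm_nonneg _)
  have hI2' : 0 ≤ I2 := setIntegral_nonneg measurableSet_Ioi fun t ht => (Real.exp_pos _).le
  set q : ℝ := max 1 (2 / p) with hq
  have hq1 : 1 ≤ q := le_max_left _ _
  have hq2 : 2 / p ≤ q := le_max_right _ _
  refine ⟨I1 + K * I2 + 1, q, by positivity, hq1, fun s n hs hn => ?_⟩
  have hB1 : (1:ℝ) ≤ (n.factorial : ℝ) * q ^ n := by
    have h1 : (1:ℝ) ≤ (n.factorial : ℝ) := by exact_mod_cast n.factorial_pos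
    have h2 : 1 ≤ q ^ n := one_le_pow₀ hq1
    nlinarith
  set Bn := (n.factorial : ℝ) * q ^ n with hBn
  have hmain : ‖(hurwitzEvenFEPair 0).Λ₀ (s / 2)‖ ≤ I1 + K * Bn * I2 := by
    have hpt : ∀ t ∈ Set.Ioi (0:ℝ), ‖(t:ℂ) ^ (s/2 - 1) • F t‖ ≤
        t ^ (-(3/4) : ℝ) * ‖F t‖ + K * Bn * Real.exp (-(p/2) * t) := by
      intro t ht
      have ht' : 0 < t := ht
      rw [norm_smul, Complex.norm_cpow_eq_rpow_re_of_pos ht']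
      have hre : (s / 2 - 1).re = s.re / 2 - 1 := by simp
      rw [hre]
      rcases le_or_gt t 1 with h1 | h1
      · have : t ^ (s.re / 2 - 1) ≤ t ^ (-(3/4) : ℝ) :=
          Real.rpow_le_rpow_of_exponent_ge ht' h1 (by linarith)
        have h3 : 0 ≤ K * Bn * Real.exp (-(p/2) * t) := by positivity
        have := mul_le_mul_of_nonneg_right this (norm_nonneg (F t))
        linarith
      · have h2 : t ^ (s.re / 2 - 1) ≤ t ^ n := by
          rw [← Real.rpow_natCast]
          exact Real.rpow_le_rpow_of_exponent_le h1.le (by linarith)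
        have h3 : t ^ n ≤ Bn * Real.exp (p/2 * t) := by
          have h4 := Real.pow_div_factorial_le_exp (p/2*t) (by positivity) n
          rw [div_le_iff₀ (by positivity)] at h4
          have h5 : t ^ n = (2/p) ^ n * (p/2*t) ^ n := by
            rw [← mul_pow]; congr 1; field_simp
          rw [h5]
          have h6 : (2/p) ^ n ≤ q ^ n := pow_le_pow_left₀ (by positivity) hq2 n
          calc _ ≤ q ^ n * (Real.exp (p/2*t) * n.factorial) :=
                mul_le_mul h6 h4 (by positivity) (by positivity)
            _ = _ := by rw [hBn]; ring
        have h7 := hb t h1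
        have h8 : 0 ≤ t ^ (-(3/4) : ℝ) * ‖F t‖ := by positivity
        calc t ^ (s.re / 2 - 1) * ‖F t‖ ≤ (Bn * Real.exp (p/2 * t)) * (K * Real.exp (-p * t)) :=
              mul_le_mul (h2.trans h3) h7 (norm_nonneg _) (by positivity)
          _ = K * Bn * (Real.exp (p/2*t) * Real.exp (-p*t)) := by ring
          _ = K * Bn * Real.exp (-(p/2) * t) := by rw [← Real.exp_add]; ring_nf
          _ ≤ _ := by linarith
    have hle := norm_integral_le_of_norm_le (μ := volume.restrict (Set.Ioi (0:ℝ)))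
      (f := fun t : ℝ => (t:ℂ) ^ (s/2 - 1) • F t)
      (hint0.add (hexp.const_mul (K * Bn))) ((ae_restrict_iff' measurableSet_Ioi).2
        (Eventually.of_forall hpt))
    refine hle.trans (le_of_eq ?_)
    simp only [Pi.add_apply]
    rw [integral_add hint0 (hexp.const_mul _), integral_const_mul]
  have : completedRiemannZeta₀ s = (hurwitzEvenFEPair 0).Λ₀ (s / 2) / 2 := rfl
  rw [this, norm_div]
  have h2 : ‖(2:ℂ)‖ = 2 := by simp
  rw [h2]
  have : I1 ≤ I1 * Bn := le_mul_of_one_le_right hI1' hB1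
  have h3 : 0 ≤ K * Bn * I2 := by positivity
  have h4 : 0 ≤ Bn := by linarith
  nlinarith

lemma fact_bound {q R : ℝ} (hq : 1 ≤ q) (hR : 1 ≤ R) :
    ((⌈R⌉₊).factorial : ℝ) * q ^ ⌈R⌉₊ ≤ Real.exp (4 * √(2 * q) * R ^ ((3:ℝ)/2)) := by
  set n := ⌈R⌉₊ with hn
  have hn1 : (n:ℝ) ≤ 2 * R := by
    have := Nat.ceil_lt_add_one (show 0 ≤ R by linarith)
    rw [← hn] at this; linarith
  have h1 : (n.factorial : ℝ) ≤ (n:ℝ) ^ n := by exact_mod_cast n.factorial_le_pow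
  have hq0 : 0 < q := by linarith
  have hb : 1 ≤ 2 * R * q := by nlinarith
  have h2 : (n.factorial : ℝ) * q ^ n ≤ (2 * R * q) ^ n := by
    rw [mul_pow]
    refine mul_le_mul_of_nonneg_right (h1.trans ?_) (by positivity)
    exact pow_le_pow_left₀ (by positivity) hn1 n
  refine h2.trans ?_
  have h3 : (2 * R * q) ^ n ≤ (2 * R * q) ^ (2 * R) := by
    rw [← Real.rpow_natCast]
    exact Real.rpow_le_rpow_of_exponent_le hb hn1
  refine h3.trans ?_
  rw [Real.rpow_def_of_pos (by linarith)]
  apply Real.exp_le_exp.2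
  have h4 : Real.log (2 * R * q) ≤ 2 * √(2 * q) * √R := by
    have e : 2 * R * q = (√(2 * q) * √R) ^ 2 := by
      rw [mul_pow, Real.sq_sqrt (by positivity), Real.sq_sqrt (by positivity)]; ring
    have hpos : 0 < √(2 * q) * √R := by positivity
    rw [e, Real.log_pow]
    have := Real.log_le_sub_one_of_pos hpos
    push_cast; linarith
  have h5 : R ^ ((3:ℝ)/2) = R * √R := by
    rw [show (3:ℝ)/2 = 1 + 1/2 by norm_num, Real.rpow_add (by linarith), Real.rpow_one,
      ← Real.sqrt_eq_rpow]
  rw [h5]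
  nlinarith

lemma xi_grow : ∃ C : ℝ, 0 < C ∧ Grow xi C := by
  obtain ⟨A, q, hA, hq, hb⟩ := lam_bound
  have hmain : ∀ R : ℝ, 1 ≤ R → ∀ z : ℂ, ‖z‖ ≤ 2 * R → 1/2 ≤ z.re →
      ‖xi z‖ ≤ Real.exp ((6 * A + 3 + 4 * √(2 * q)) * R ^ ((3:ℝ)/2)) := by
    intro R hR z hz hre
    have h1 := hb z ⌈R⌉₊ hre (by
      have := Complex.re_le_norm z
      have h2 := Nat.le_ceil R
      linarith)
    have h2 := fact_bound hq hR
    set E := Real.exp (4 * √(2 * q) * R ^ ((3:ℝ)/2)) with hE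
    have hRR : R ≤ R ^ ((3:ℝ)/2) := by
      conv_lhs => rw [← Real.rpow_one R]
      exact Real.rpow_le_rpow_of_exponent_le hR (by norm_num)
    have h3 : ‖completedRiemannZeta₀ z‖ ≤ A * E :=
      h1.trans (mul_le_mul_of_nonneg_left h2 hA.le)
    have hE1 : 1 ≤ E := Real.one_le_exp (by positivity)
    have hz1 : ‖z - 1‖ ≤ 3 * R := by
      have := norm_sub_le z 1
      rw [norm_one] at this; linarith
    have h4 : ‖xi z‖ ≤ (2 * R) * (3 * R) * (A * E) + 1 := by
      unfold xi
      refine (norm_add_le _ _).trans ?_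
      rw [norm_mul, norm_mul, norm_one]
      gcongr
    have hRe : R ≤ Real.exp R := by linarith [Real.add_one_le_exp R]
    have hRe2 : R * R ≤ Real.exp (2 * R) := by
      rw [two_mul, Real.exp_add]
      exact mul_le_mul hRe hRe (by linarith) (Real.exp_pos _).le
    have hAe : 6 * A + 1 ≤ Real.exp (6 * A) := Real.add_one_le_exp _
    have h5 : (2 * R) * (3 * R) * (A * E) + 1 ≤ (6 * A + 1) * (R * R) * E := by
      have : 1 ≤ R * R := by nlinarith
      have : 1 ≤ R * R * E := by nlinarith
      nlinarith
    refine (h4.trans h5).trans ?_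
    have h6 : (6 * A + 1) * (R * R) * E ≤ Real.exp (6 * A) * Real.exp (2 * R) * E := by
      gcongr
    refine h6.trans ?_
    rw [hE, ← Real.exp_add, ← Real.exp_add]
    apply Real.exp_le_exp.2
    nlinarith [Real.sqrt_nonneg (2 * q)]
  refine ⟨6 * A + 3 + 4 * √(2 * q), by positivity, ?_⟩
  intro R hR z hz
  rcases le_total (1/2) z.re with h | h
  · exact hmain R hR z (by linarith) h
  · rw [← xi_one_sub]
    refine hmain R hR (1 - z) ?_ (by simp; linarith)
    have := norm_sub_le 1 z
    rw [norm_one] at this; linarith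

end LW


namespace LW
open MeasureTheory

/-- A continuous function supported on the positive half line with a Laplace transform. -/
structure Good (F : ℝ → ℂ) (b : ℝ) (v : ℂ → ℂ) : Prop where
  cont : Continuous F
  zero : ∀ u ≤ 0, F u = 0
  b0 : 0 ≤ b
  bd : ∀ u, ‖F u‖ ≤ b * Real.exp (3/2 * u)
  lap : ∀ s : ℂ, s.re = 2 → ∫ u : ℝ, F u * Complex.exp (-s * u) = v s

lemma ind_int : Integrable (fun u : ℝ => (Set.Ioi (0:ℝ)).indicator (fun u => Real.exp (-(1/2) * u)) u) :=
  (integrable_indicator_iff measurableSet_Ioi).2 (integrableOn_exp_mul_Ioi (by norm_num) 0)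

lemma ind_int_eq : ∫ u : ℝ, (Set.Ioi (0:ℝ)).indicator (fun u => Real.exp (-(1/2) * u)) u = 2 := by
  rw [integral_indicator measurableSet_Ioi]
  rw [integral_exp_mul_Ioi (by norm_num) 0]
  norm_num

lemma Good.pt {F : ℝ → ℂ} {b : ℝ} {v : ℂ → ℂ} (h : Good F b v) {s : ℂ} (hs : s.re = 2) (u : ℝ) :
    ‖F u * Complex.exp (-s * u)‖ ≤
      b * (Set.Ioi (0:ℝ)).indicator (fun u => Real.exp (-(1/2) * u)) u := by
  rcases le_or_gt u 0 with hu | hu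
  · rw [h.zero u hu, zero_mul, norm_zero, Set.indicator_of_notMem (by simpa using hu), mul_zero]
  · rw [Set.indicator_of_mem (Set.mem_Ioi.2 hu), norm_mul, Complex.norm_exp]
    have : (-s * (u:ℂ)).re = -2 * u := by simp [hs]
    rw [this]
    calc _ ≤ b * Real.exp (3/2 * u) * Real.exp (-2 * u) :=
          mul_le_mul_of_nonneg_right (h.bd u) (Real.exp_pos _).le
      _ = b * (Real.exp (3/2 * u) * Real.exp (-2 * u)) := by ring
      _ = _ := by rw [← Real.exp_add]; ring_nf

lemma Good.int {F : ℝ → ℂ} {b : ℝ} {v : ℂ → ℂ} (h : Good F b v) {s : ℂ} (hs : s.re = 2) :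
    Integrable (fun u : ℝ => F u * Complex.exp (-s * u)) := by
  refine (ind_int.const_mul b).mono' ?_ (Eventually.of_forall (h.pt hs))
  have := h.cont
  exact Continuous.aestronglyMeasurable (by fun_prop)

lemma Good.add {F G : ℝ → ℂ} {b c : ℝ} {v w : ℂ → ℂ} (h : Good F b v) (k : Good G c w) :
    Good (fun u => F u + G u) (b + c) (fun s => v s + w s) := by
  refine ⟨h.cont.add k.cont, fun u hu => by rw [h.zero u hu, k.zero u hu, add_zero],
    add_nonneg h.b0 k.b0, fun u => ?_, fun s hs => ?_⟩
  · rw [add_mul]; exact (norm_add_le _ _).trans (add_le_add (h.bd u) (k.bd u))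
  · simp only [add_mul]
    rw [integral_add (h.int hs) (k.int hs), h.lap s hs, k.lap s hs]

lemma Good.smul {F : ℝ → ℂ} {b : ℝ} {v : ℂ → ℂ} (h : Good F b v) (c : ℂ) :
    Good (fun u => c * F u) (‖c‖ * b) (fun s => c * v s) := by
  refine ⟨continuous_const.mul h.cont, fun u hu => by rw [h.zero u hu, mul_zero],
    mul_nonneg (norm_nonneg _) h.b0, fun u => ?_, fun s hs => ?_⟩
  · rw [norm_mul, mul_assoc]; exact mul_le_mul_of_nonneg_left (h.bd u) (norm_nonneg _)
  · simp only [mul_assoc]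
    rw [integral_const_mul, h.lap s hs]

lemma Good.tsum {ι : Type*} [Countable ι] {F : ι → ℝ → ℂ} {b : ι → ℝ} {v : ι → ℂ → ℂ}
    (h : ∀ i, Good (F i) (b i) (v i)) (hb : Summable b) :
    Good (fun u => ∑' i, F i u) (∑' i, b i) (fun s => ∑' i, v i s) := by
  have hsum : ∀ u, Summable fun i => ‖F i u‖ := fun u =>
    Summable.of_nonneg_of_le (fun _ => norm_nonneg _) (fun i => (h i).bd u) (hb.mul_right _)
  refine ⟨?_, fun u hu => ?_, tsum_nonneg fun i => (h i).b0, fun u => ?_, fun s hs => ?_⟩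
  · have h1 : Continuous fun u : ℝ => ∑' i, F i u * Complex.exp (-(3/2) * u) := by
      refine continuous_tsum (fun i => ?_) hb fun i u => ?_
      · have := (h i).cont
        fun_prop
      · rw [norm_mul, Complex.norm_exp]
        have e : (-(3/2) * (u:ℂ)).re = -(3/2 * u) := by simp
        rw [e, Real.exp_neg, ← div_eq_mul_inv, div_le_iff₀ (Real.exp_pos _)]
        exact (h i).bd u
    have h2 : (fun u => ∑' i, F i u) = fun u : ℝ => (∑' i, F i u * Complex.exp (-(3/2) * u)) *
        Complex.exp (3/2 * u) := by
      funext u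
      rw [← tsum_mul_right]
      congr 1
      funext i
      rw [mul_assoc, ← Complex.exp_add]
      simp
    rw [h2]
    fun_prop
  · simp [fun i => (h i).zero u hu]
  · refine (norm_tsum_le_tsum_norm (hsum u)).trans ?_
    rw [← tsum_mul_right]
    exact (hsum u).tsum_le_tsum (fun i => (h i).bd u) (hb.mul_right _)
  · have key := hasSum_integral_of_summable_integral_norm (μ := volume)
      (F := fun i (u:ℝ) => F i u * Complex.exp (-s * u)) (fun i => (h i).int hs) ?_
    · simp only [← tsum_mul_right]
      rw [← key.tsum_eq]
      congr 1; funext i; rw [(h i).lap s hs]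
    · refine Summable.of_nonneg_of_le (fun i => integral_nonneg fun _ => norm_nonneg _)
        (fun i => ?_) (hb.mul_right 2)
      have := integral_mono ((h i).int hs).norm (ind_int.const_mul (b i)) ((h i).pt hs)
      rwa [integral_const_mul, ind_int_eq] at this

open FourierTransform in
lemma Good.unique {F : ℝ → ℂ} {b : ℝ} {v : ℂ → ℂ} (h : Good F b v)
    (hv : ∀ s : ℂ, s.re = 2 → v s = 0) (u : ℝ) : F u = 0 := by
  set G : ℝ → ℂ := fun u => F u * Complex.exp (-2 * u) with hG
  have hc : Continuous G := by have := h.cont; fun_prop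
  have hi : Integrable G := h.int (s := 2) (by simp)
  have hF : 𝓕 G = 0 := by
    funext w
    rw [Real.fourier_real_eq_integral_exp_smul]
    have hs : ((2:ℂ) + (2 * π * w : ℝ) * Complex.I).re = 2 := by simp
    have := h.lap _ hs
    rw [hv _ hs] at this
    rw [Pi.zero_apply, ← this]
    congr 1
    funext x
    simp only [hG, smul_eq_mul]
    rw [mul_left_comm, ← Complex.exp_add]
    congr 2
    push_cast; ring
  have h1 := hc.fourierInv_fourier_eq hi (by rw [hF]; exact integrable_zero _ _ _)
  have h2 : G u = 0 := by
    rw [← h1, hF, Real.fourierInv_eq]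
    simp
  exact (mul_eq_zero.1 h2).resolve_right (Complex.exp_ne_zero _)

lemma good_exp {a : ℂ} (ha : a.re ≤ 1) :
    Good (fun u : ℝ => Complex.exp (a * (max u 0 : ℝ)) - 1) 2 (fun s => a / (s * (s - a))) := by
  have hzero : ∀ u ≤ (0:ℝ), Complex.exp (a * (max u 0 : ℝ)) - 1 = 0 := by
    intro u hu
    rw [max_eq_right hu]; simp
  refine ⟨by fun_prop, hzero, by norm_num, fun u => ?_, fun s hs => ?_⟩
  · rcases le_or_gt u 0 with hu | hu
    · rw [hzero u hu, norm_zero]; positivity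
    · rw [max_eq_left hu.le]
      refine (norm_sub_le _ _).trans ?_
      rw [Complex.norm_exp, norm_one]
      have e : (a * (u:ℂ)).re = a.re * u := by simp
      have h1 : Real.exp (a * (u:ℂ)).re ≤ Real.exp (3/2 * u) := by
        rw [e]; apply Real.exp_le_exp.2; nlinarith
      have h2 : 1 ≤ Real.exp (3/2 * u) := Real.one_le_exp (by positivity)
      linarith
  · have e1 : ∀ u : ℝ, (Complex.exp (a * (max u 0 : ℝ)) - 1) * Complex.exp (-s * u) =
        (Set.Ioi (0:ℝ)).indicator (fun u : ℝ => Complex.exp ((a - s) * u) - Complex.exp (-s * u)) u := by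
      intro u
      rcases le_or_gt u 0 with hu | hu
      · rw [hzero u hu, zero_mul, Set.indicator_of_notMem (by simpa using hu)]
      · rw [Set.indicator_of_mem (Set.mem_Ioi.2 hu), max_eq_left hu.le, sub_mul, one_mul,
          ← Complex.exp_add]
        ring_nf
    have r1 : (a - s).re < 0 := by simp [hs]; linarith
    have r2 : (-s).re < 0 := by simp [hs]
    simp_rw [e1]
    rw [integral_indicator measurableSet_Ioi, integral_sub
      (integrableOn_exp_mul_complex_Ioi r1 0) (integrableOn_exp_mul_complex_Ioi r2 0),
      integral_exp_mul_complex_Ioi r1, integral_exp_mul_complex_Ioi r2]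
    have n1 : s - a ≠ 0 := by
      intro h; rw [← neg_eq_zero, neg_sub] at h; rw [h] at r1; simp at r1
    have n1' : a - s ≠ 0 := by intro h; apply n1; linear_combination -h
    have n2 : s ≠ 0 := by rintro rfl; simp at hs
    have : a - s = -(s - a) := by ring
    rw [this]
    simp only [Complex.ofReal_zero, mul_zero, Complex.exp_zero]
    field_simp
    ring

lemma good_lin {a : ℝ} (ha : 0 ≤ a) :
    Good (fun u : ℝ => ((max (u - a) 0 : ℝ) : ℂ)) (Real.exp (-(3/2) * a))
      (fun s => Complex.exp (-s * a) / s ^ 2) := by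
  refine ⟨by fun_prop, fun u hu => ?_, (Real.exp_pos _).le, fun u => ?_, fun s hs => ?_⟩
  · rw [max_eq_right (by linarith)]; simp
  · rw [Complex.norm_real, Real.norm_of_nonneg (le_max_right _ _), ← Real.exp_add]
    refine max_le ?_ (Real.exp_pos _).le
    have h1 := Real.add_one_le_exp (-(3/2) * a + 3/2 * u)
    by_cases hua : u - a ≤ 0
    · exact hua.trans (Real.exp_pos _).le
    · push Not at hua; linarith
  · have n2 : s ≠ 0 := by rintro rfl; simp at hs
    have e1 : ∀ u : ℝ, ((max (u - a) 0 : ℝ) : ℂ) * Complex.exp (-s * u) =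
        (Set.Ioi a).indicator (fun u : ℝ => ((u:ℂ) - a) * Complex.exp (-s * u)) u := by
      intro u
      rcases le_or_gt u a with hu | hu
      · rw [max_eq_right (by linarith), Set.indicator_of_notMem (by simpa using hu)]; simp
      · rw [Set.indicator_of_mem (Set.mem_Ioi.2 hu), max_eq_left (by linarith)]; simp
    have hexpn : ∀ u : ℝ, ‖Complex.exp (-s * u)‖ = Real.exp (-2 * u) := by
      intro u; rw [Complex.norm_exp]; congr 1; simp [hs]
    have hint : IntegrableOn (fun u : ℝ => ((u:ℂ) - a) * Complex.exp (-s * u)) (Set.Ioi a) := by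
      have hd : IntegrableOn (fun u : ℝ => Real.exp (-a) * Real.exp (-1 * u)) (Set.Ioi a) :=
        (integrableOn_exp_mul_Ioi (by norm_num) a).const_mul _
      refine hd.mono' (Continuous.aestronglyMeasurable (by fun_prop)) ?_
      refine (ae_restrict_iff' measurableSet_Ioi).2 (Eventually.of_forall fun u hu => ?_)
      have hu' : a < u := hu
      rw [norm_mul, hexpn, ← Complex.ofReal_sub, Complex.norm_real, Real.norm_of_nonneg (by linarith)]
      have h1 : u - a ≤ Real.exp (u - a) := by linarith [Real.add_one_le_exp (u - a)]
      calc _ ≤ Real.exp (u - a) * Real.exp (-2 * u) :=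
            mul_le_mul_of_nonneg_right h1 (Real.exp_pos _).le
        _ = _ := by rw [← Real.exp_add, ← Real.exp_add]; ring_nf
    simp_rw [e1]
    rw [integral_indicator measurableSet_Ioi]
    have hder : ∀ u ∈ Set.Ici a, HasDerivAt
        (fun u : ℝ => -(((u:ℂ) - a) / s + 1 / s ^ 2) * Complex.exp (-s * u))
        (((u:ℂ) - a) * Complex.exp (-s * u)) u := by
      intro u _
      have h1 : HasDerivAt (fun z : ℂ => -((z - a) / s + 1 / s ^ 2) * Complex.exp (-s * z))
          (((u:ℂ) - a) * Complex.exp (-s * u)) (u:ℂ) := by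
        have a1 : HasDerivAt (fun z : ℂ => -((z - a) / s + 1 / s ^ 2)) (-(1 / s)) (u:ℂ) := by
          exact ((((hasDerivAt_id (u:ℂ)).sub_const (a:ℂ)).div_const s).add_const (1/s^2)).neg
        have a2 : HasDerivAt (fun z : ℂ => Complex.exp (-s * z))
            (Complex.exp (-s * u) * (-s * 1)) (u:ℂ) :=
          ((hasDerivAt_id (u:ℂ)).const_mul (-s)).cexp
        refine (a1.mul a2).congr_deriv ?_
        field_simp
        ring
      exact h1.comp_ofReal
    have hlim : Tendsto (fun u : ℝ => -(((u:ℂ) - a) / s + 1 / s ^ 2) * Complex.exp (-s * u))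
        atTop (nhds 0) := by
      rw [tendsto_zero_iff_norm_tendsto_zero]
      have hub : Tendsto (fun u : ℝ => (1/‖s‖ + 1 / ‖s‖^2) * Real.exp (-1 * u)) atTop (nhds 0) := by
        have : Tendsto (fun u : ℝ => Real.exp (-1 * u)) atTop (nhds 0) := by
          simpa using Real.tendsto_exp_neg_atTop_nhds_zero
        have h9 := this.const_mul (1/‖s‖ + 1 / ‖s‖^2)
        rwa [mul_zero] at h9
      refine squeeze_zero' (Eventually.of_forall fun _ => norm_nonneg _) ?_ hub
      filter_upwards [eventually_ge_atTop a] with u hu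
      rw [norm_mul, hexpn, norm_neg]
      have h1 : ‖((u:ℂ) - a) / s + 1 / s ^ 2‖ ≤ (1/‖s‖ + 1 / ‖s‖^2) * Real.exp u := by
        refine (norm_add_le _ _).trans ?_
        rw [norm_div, norm_div, norm_pow, norm_one, ← Complex.ofReal_sub, Complex.norm_real,
          Real.norm_of_nonneg (by linarith), add_mul]
        have h2 : u - a ≤ Real.exp u := by linarith [Real.add_one_le_exp u]
        have h3 : 1 ≤ Real.exp u := Real.one_le_exp (by linarith)
        refine add_le_add ?_ (le_mul_of_one_le_right (by positivity) h3)
        rw [div_mul_eq_mul_div, one_mul]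
        gcongr
      calc _ ≤ (1/‖s‖ + 1 / ‖s‖^2) * Real.exp u * Real.exp (-2 * u) :=
            mul_le_mul_of_nonneg_right h1 (Real.exp_pos _).le
        _ = (1/‖s‖ + 1 / ‖s‖^2) * (Real.exp u * Real.exp (-2 * u)) := by ring
        _ = _ := by rw [← Real.exp_add]; ring_nf
    rw [integral_Ioi_of_hasDerivAt_of_tendsto (hder a (Set.self_mem_Ici)).continuousAt.continuousWithinAt
      (fun u hu => hder u (Set.mem_Ici.2 (le_of_lt hu))) hint hlim]
    simp
    ring

end LW


namespace LW

/-- real digamma -/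
noncomputable def rdig (x : ℝ) : ℝ := deriv (Real.log ∘ Real.Gamma) x

lemma lg_diff {x : ℝ} (hx : 0 < x) : DifferentiableAt ℝ (Real.log ∘ Real.Gamma) x := by
  refine ((Real.differentiableAt_Gamma ?_).log (Real.Gamma_ne_zero ?_)) <;>
    exact fun m => ne_of_gt (by have : (0:ℝ) ≤ m := Nat.cast_nonneg m
                                linarith)

lemma lg_rec {x : ℝ} (hx : 0 < x) :
    (Real.log ∘ Real.Gamma) (x + 1) = (Real.log ∘ Real.Gamma) x + Real.log x := by
  simp only [Function.comp_apply, Real.Gamma_add_one hx.ne',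
    Real.log_mul hx.ne' (Real.Gamma_pos_of_pos hx).ne', add_comm]

lemma rdig_rec {x : ℝ} (hx : 0 < x) : rdig (x + 1) = rdig x + 1 / x := by
  unfold rdig
  rw [← deriv_comp_add_const, one_div, ← Real.deriv_log,
    ← deriv_add (lg_diff hx) (Real.differentiableAt_log hx.ne')]
  apply EventuallyEq.deriv_eq
  filter_upwards [eventually_gt_nhds hx] with y hy using lg_rec hy

lemma rdig_lb {x : ℝ} (hx : 0 < x) : Real.log x ≤ rdig (x + 1) := by
  refine (le_of_eq ?_).trans <| Real.convexOn_log_Gamma.slope_le_deriv (x := x) (y := x + 1)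
    (Set.mem_Ioi.mpr hx) (Set.mem_Ioi.2 (by linarith)) (by linarith) (lg_diff (by linarith))
  rw [slope_def_field, lg_rec hx]; simp

lemma rdig_ub {x : ℝ} (hx : 0 < x) : rdig x ≤ Real.log x := by
  refine (Real.convexOn_log_Gamma.deriv_le_slope (x := x) (y := x + 1)
    (Set.mem_Ioi.mpr hx) (Set.mem_Ioi.2 (by linarith)) (by linarith)
    (lg_diff hx)).trans (le_of_eq ?_)
  rw [slope_def_field, lg_rec hx]; simp

lemma rdig_sum {x : ℝ} (hx : 0 < x) (N : ℕ) :
    ∑ n ∈ Finset.range N, 1 / (x + n) = rdig (x + N) - rdig x := by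
  induction N with
  | zero => simp
  | succ N ih =>
    rw [Finset.sum_range_succ, ih]
    push_cast
    rw [← add_assoc, rdig_rec (by positivity)]; ring

lemma log_diff_le {a b : ℝ} (ha : 0 < a) (hb : 0 < b) : Real.log b - Real.log a ≤ (b - a) / a := by
  rw [← Real.log_div hb.ne' ha.ne']
  refine (Real.log_le_sub_one_of_pos (by positivity)).trans (le_of_eq ?_)
  field_simp

lemma rdig_series {y : ℝ} (hy : 0 < y) :
    HasSum (fun n : ℕ => y / ((n + 1) * (n + 1 + y))) (rdig (1 + y) - rdig 1) := by
  rw [hasSum_iff_tendsto_nat_of_nonneg (fun n => by positivity)]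
  have e : ∀ N : ℕ, ∑ n ∈ Finset.range N, y / (((n:ℝ) + 1) * (n + 1 + y)) =
      (rdig (1 + y) - rdig 1) - (rdig (1 + y + N) - rdig (1 + N)) := by
    intro N
    have h1 := rdig_sum (x := 1) one_pos N
    have h2 := rdig_sum (x := 1 + y) (by positivity) N
    have : ∑ n ∈ Finset.range N, y / (((n:ℝ) + 1) * (n + 1 + y)) =
        ∑ n ∈ Finset.range N, 1 / (1 + (n:ℝ)) - ∑ n ∈ Finset.range N, 1 / (1 + y + n) := by
      rw [← Finset.sum_sub_distrib]
      refine Finset.sum_congr rfl fun n _ => ?_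
      have : (0:ℝ) ≤ n := by positivity
      field_simp
      ring
    rw [this, h1, h2]; ring
  simp_rw [e]
  have hlim : Tendsto (fun N : ℕ => rdig (1 + y + N) - rdig (1 + N)) atTop (nhds 0) := by
    have hz : Tendsto (fun N : ℕ => (1 + y) / (N:ℝ)) atTop (nhds 0) :=
      tendsto_const_div_atTop_nhds_zero_nat _
    refine squeeze_zero_norm' ?_ hz
    filter_upwards [eventually_ge_atTop 1] with N hN
    have hN' : (1:ℝ) ≤ N := by exact_mod_cast hN
    have a1 := rdig_ub (x := 1 + y + N) (by positivity)
    have a2 := rdig_lb (x := (N:ℝ)) (by positivity)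
    have a3 := rdig_ub (x := 1 + (N:ℝ)) (by positivity)
    have a4 := rdig_lb (x := (N:ℝ) + y) (by positivity)
    have a5 := log_diff_le (a := (N:ℝ)) (b := 1 + y + N) (by positivity) (by positivity)
    have a6 := log_diff_le (a := (N:ℝ)) (b := 1 + N) (by positivity) (by positivity)
    have a7 : Real.log N ≤ Real.log (N + y) := Real.log_le_log (by positivity) (by linarith)
    have e1 : (N:ℝ) + y + 1 = 1 + y + N := by ring
    have e2 : (N:ℝ) + 1 = 1 + N := by ring
    rw [e1] at a4
    rw [e2] at a2
    have e3 : 1 + y + (N:ℝ) - N = 1 + y := by ring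
    have e4 : 1 + (N:ℝ) - N = 1 := by ring
    rw [e3] at a5
    rw [e4] at a6
    have a8 : 1 / (N:ℝ) ≤ (1 + y) / N := by gcongr; linarith
    rw [Real.norm_eq_abs, abs_le]
    constructor <;> linarith
  simpa using hlim.const_sub (rdig (1 + y) - rdig 1)

lemma digamma_real {x : ℝ} (hx : 0 < x) : Complex.digamma (x:ℂ) = (rdig x : ℝ) := by
  have hne : ∀ m : ℕ, (x:ℂ) ≠ -m := by
    intro m h
    have h2 := congrArg Complex.re h
    simp at h2
    have : (0:ℝ) ≤ m := Nat.cast_nonneg m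
    linarith
  have hneR : ∀ m : ℕ, x ≠ -m := by
    intro m h
    have : (0:ℝ) ≤ m := Nat.cast_nonneg m
    linarith
  have h1 : HasDerivAt (fun y : ℝ => Complex.Gamma (y:ℂ)) (deriv Complex.Gamma (x:ℂ)) x :=
    (Complex.differentiableAt_Gamma _ hne).hasDerivAt.comp_ofReal
  have h2 : HasDerivAt (fun y : ℝ => ((Real.Gamma y : ℝ) : ℂ)) ((deriv Real.Gamma x : ℝ) : ℂ) x :=
    (Real.differentiableAt_Gamma hneR).hasDerivAt.ofReal_comp
  have h3 : (fun y : ℝ => Complex.Gamma (y:ℂ)) = fun y : ℝ => ((Real.Gamma y : ℝ) : ℂ) := by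
    funext y; exact Complex.Gamma_ofReal y
  rw [h3] at h1
  have h4 := h1.unique h2
  rw [Complex.digamma_def, logDeriv_apply, h4, Complex.Gamma_ofReal, rdig, Function.comp_def,
    deriv.log (Real.differentiableAt_Gamma hneR) (Real.Gamma_pos_of_pos hx).ne']
  push_cast; rfl

lemma gterm_bound {s : ℂ} (hs : 0 < s.re) (n : ℕ) :
    ‖1 / (2 * ((n:ℂ) + 1) * (s + 2 * (n + 1)))‖ ≤ 1 / ((n:ℝ) + 1) ^ 2 := by
  rw [norm_div, norm_one, norm_mul, norm_mul]
  have h1 : ‖(n:ℂ) + 1‖ = n + 1 := by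
    rw [← Nat.cast_succ, Complex.norm_natCast]; push_cast; rfl
  have h2 : 2 * ((n:ℝ) + 1) ≤ ‖s + 2 * ((n:ℂ) + 1)‖ := by
    refine le_trans ?_ (Complex.re_le_norm _)
    simp; linarith
  rw [h1, Complex.norm_ofNat]
  apply one_div_le_one_div_of_le (by positivity)
  have : (0:ℝ) ≤ n := by positivity
  nlinarith

lemma inv_sq_summable : Summable fun n : ℕ => 1 / ((n:ℝ) + 1) ^ 2 := by
  have := (summable_nat_add_iff 1).2 (Real.summable_one_div_nat_pow.2 (le_refl 2))
  simpa using this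

lemma digamma_series {s : ℂ} (hs : 0 < s.re) :
    ∑' n : ℕ, 1 / (2 * ((n:ℂ) + 1) * (s + 2 * (n + 1))) * s =
      1/2 * Complex.digamma (s/2 + 1) - 1/2 * Complex.digamma 1 := by
  set U : Set ℂ := {s | 0 < s.re} with hU
  have hUo : IsOpen U := isOpen_lt continuous_const Complex.continuous_re
  have hUc : IsPreconnected U := (convex_halfSpace_re_gt 0).isPreconnected
  have d1 : DifferentiableOn ℂ (fun s : ℂ => ∑' n : ℕ, 1 / (2 * ((n:ℂ) + 1) * (s + 2 * (n + 1)))) U := by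
    refine Complex.differentiableOn_tsum_of_summable_norm inv_sq_summable (fun n => ?_) hUo
      (fun n s hs => gterm_bound hs n)
    intro w hw
    have hw' : 0 < w.re := hw
    refine DifferentiableAt.differentiableWithinAt (DifferentiableAt.div (by fun_prop) (by fun_prop) ?_)
    refine mul_ne_zero (mul_ne_zero two_ne_zero (Nat.cast_add_one_ne_zero n)) ?_
    intro h
    have := congrArg Complex.re h
    simp at this
    have h2 : (0:ℝ) ≤ n := Nat.cast_nonneg n
    linarith
  have d2 : DifferentiableOn ℂ (fun s : ℂ => 1/2 * Complex.digamma (s/2 + 1) - 1/2 * Complex.digamma 1) U := by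
    intro w hw
    have hw' : 0 < w.re := hw
    have hV : IsOpen {z : ℂ | 0 < z.re} := hUo
    have hGd : DifferentiableOn ℂ Complex.Gamma {z : ℂ | 0 < z.re} := by
      intro z hz
      have hz' : 0 < z.re := hz
      refine (Complex.differentiableAt_Gamma _ fun m h => ?_).differentiableWithinAt
      have := congrArg Complex.re h
      simp at this
      have h2 : (0:ℝ) ≤ m := Nat.cast_nonneg m
      linarith
    have hmem : w/2 + 1 ∈ {z : ℂ | 0 < z.re} := by
      change 0 < (w/2 + 1).re
      simp; linarith
    have hdg : DifferentiableAt ℂ Complex.digamma (w/2 + 1) := by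
      have h1 := (hGd.deriv hV).differentiableAt (hV.mem_nhds hmem)
      have h2 := hGd.differentiableAt (hV.mem_nhds hmem)
      exact h1.div h2 (Complex.Gamma_ne_zero_of_re_pos hmem)
    have h3 : DifferentiableAt ℂ (fun s : ℂ => Complex.digamma (s/2 + 1)) w :=
      DifferentiableAt.comp w (g := Complex.digamma) (f := fun s : ℂ => s/2 + 1) hdg (by fun_prop)
    exact ((h3.const_mul _).sub_const _).differentiableWithinAt
  have hreal : ∀ x : ℝ, 0 < x → (fun s : ℂ => (∑' n : ℕ, 1 / (2 * ((n:ℂ) + 1) * (s + 2 * (n + 1)))) * s) x =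
      (fun s : ℂ => 1/2 * Complex.digamma (s/2 + 1) - 1/2 * Complex.digamma 1) x := by
    intro x hx
    have h1 := rdig_series (y := x/2) (by positivity)
    have h2 : HasSum (fun n : ℕ => (1 / (2 * ((n:ℂ) + 1) * (x + 2 * (n + 1)))) * x)
        (1/2 * ((rdig (1 + x/2) - rdig 1 : ℝ) : ℂ)) := by
      have h3 := (Complex.hasSum_ofReal.2 h1).mul_left (1/2 : ℂ)
      refine h3.congr_fun ?_
      intro n
      have h5 : ((n:ℂ) + 1) ≠ 0 := Nat.cast_add_one_ne_zero n
      have h6 : ((x:ℂ) + 2 * (n + 1)) ≠ 0 := by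
        have : (x + 2 * (n + 1) : ℝ) ≠ 0 := by positivity
        exact_mod_cast this
      have h7 : ((n:ℂ) + 1 + x/2) ≠ 0 := by
        have : ((n:ℝ) + 1 + x/2 : ℝ) ≠ 0 := by positivity
        exact_mod_cast this
      push_cast
      have e : ((n:ℂ) + 1 + (x:ℂ)/2) = ((x:ℂ) + 2 * (n + 1))/2 := by ring
      simp only [e]
      field_simp
    simp only
    rw [← tsum_mul_right, h2.tsum_eq]
    have e1 : (x:ℂ)/2 + 1 = ((1 + x/2 : ℝ) : ℂ) := by push_cast; ring
    have e2 : Complex.digamma 1 = ((rdig 1 : ℝ) : ℂ) := by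
      rw [← digamma_real one_pos]; simp
    rw [e1, e2, digamma_real (by positivity)]
    push_cast; ring
  have key := AnalyticOnNhd.eqOn_of_preconnected_of_frequently_eq
    (f := fun s : ℂ => (∑' n : ℕ, 1 / (2 * ((n:ℂ) + 1) * (s + 2 * (n + 1)))) * s)
    (g := fun s : ℂ => 1/2 * Complex.digamma (s/2 + 1) - 1/2 * Complex.digamma 1)
    ((d1.mul differentiableOn_id).analyticOnNhd hUo) (d2.analyticOnNhd hUo) hUc
    (z₀ := 1) (by simp [hU]) ?_
  · rw [tsum_mul_right]; exact key hs
  · have ht : Tendsto (fun k : ℕ => ((1 + 1/((k:ℝ)+1) : ℝ) : ℂ)) atTop (nhdsWithin 1 {1}ᶜ) := by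
      rw [tendsto_nhdsWithin_iff]
      constructor
      · have h1 : Tendsto (fun k : ℕ => (1 + 1/((k:ℝ)+1) : ℝ)) atTop (nhds (1 + 0)) :=
          tendsto_const_nhds.add tendsto_one_div_add_atTop_nhds_zero_nat
        rw [add_zero] at h1
        exact (Complex.continuous_ofReal.tendsto 1).comp h1
      · refine Eventually.of_forall fun k => ?_
        simp only [Set.mem_compl_iff, Set.mem_singleton_iff]
        intro h
        have h1 : (1 + 1/((k:ℝ)+1) : ℝ) = 1 := by exact_mod_cast h
        have : 0 < 1/((k:ℝ)+1) := by positivity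
        linarith
    exact ht.frequently (Frequently.of_forall fun k => hreal _ (by positivity))

end LW

namespace LW
open ArithmeticFunction in
lemma LL_eq {s : ℂ} (hs : 1 < s.re) :
    LSeries (fun n => ((ArithmeticFunction.vonMangoldt n : ℝ) : ℂ)) s =
     - logDeriv xi s + 1/(s-1) - 1/2 * Real.log π + 1/2 * Complex.digamma (s/2+1) := by
  have hs1 : s ≠ 1 := by rintro rfl; simp at hs
  have hs0 : s ≠ 0 := by rintro rfl; simp at hs; linarith
  have e1 := ArithmeticFunction.LSeries_vonMangoldt_eq_deriv_riemannZeta_div hs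
  have hz : riemannZeta s ≠ 0 := riemannZeta_ne_zero_of_one_le_re hs.le
  have hpi : (π:ℂ) ≠ 0 := by exact_mod_cast Real.pi_ne_zero
  have hG0 : Complex.Gamma (s/2+1) ≠ 0 := by
    apply Complex.Gamma_ne_zero_of_re_pos
    simp; linarith
  have hGd : DifferentiableAt ℂ (fun z : ℂ => Complex.Gamma (z/2+1)) s := by
    refine DifferentiableAt.comp s (g := Complex.Gamma) (f := fun z : ℂ => z/2+1) ?_ (by fun_prop)
    refine Complex.differentiableAt_Gamma _ fun m h => ?_
    have := congrArg Complex.re h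
    simp at this
    have h2 : (0:ℝ) ≤ m := Nat.cast_nonneg m
    linarith
  have hPd : DifferentiableAt ℂ (fun z : ℂ => Complex.exp (-(Real.log π) / 2 * z)) s := by fun_prop
  have hev : xi =ᶠ[nhds s] fun z => (2 * z - 2) * (Complex.exp (-(Real.log π) / 2 * z) * (Complex.Gamma (z/2+1) * riemannZeta z)) := by
    have : ∀ᶠ z : ℂ in nhds s, 1 < z.re :=
      (isOpen_lt continuous_const Complex.continuous_re).mem_nhds hs
    filter_upwards [this] with z hz1
    have hz0 : z ≠ 0 := by rintro rfl; simp at hz1; linarith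
    have hz1' : z ≠ 1 := by rintro rfl; simp at hz1
    rw [xi_eq hz0 hz1', riemannZeta_def_of_ne_zero hz0, Complex.Gammaℝ_def,
      Complex.Gamma_add_one _ (div_ne_zero hz0 two_ne_zero)]
    have hg : Complex.Gamma (z/2) ≠ 0 := by
      apply Complex.Gamma_ne_zero_of_re_pos
      simp; linarith
    have hp : (π:ℂ) ^ (-z/2) = Complex.exp (-(Real.log π) / 2 * z) := by
      rw [Complex.cpow_def_of_ne_zero hpi, Complex.ofReal_log Real.pi_pos.le]
      congr 1; ring
    rw [hp]
    have := Complex.exp_ne_zero (-(Real.log π) / 2 * z)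
    field_simp
  have e2 : logDeriv xi s = 1/(s-1) + (-(Real.log π)/2 + (1/2 * Complex.digamma (s/2+1) + deriv riemannZeta s / riemannZeta s)) := by
    have e0 : logDeriv xi s = logDeriv (fun z : ℂ => (2 * z - 2) * (Complex.exp (-(Real.log π) / 2 * z) * (Complex.Gamma (z/2+1) * riemannZeta z))) s := by
      rw [logDeriv_apply, logDeriv_apply, hev.deriv_eq, hev.self_of_nhds]
    rw [e0]
    have hzd := differentiableAt_riemannZeta hs1
    have n1 : s - 1 ≠ 0 := sub_ne_zero.2 hs1
    rw [logDeriv_mul, logDeriv_mul, logDeriv_mul]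
    · congr 1
      · rw [logDeriv_apply, deriv_sub_const, deriv_const_mul _ (by fun_prop)]
        simp
        rw [show 2 * s - 2 = 2 * (s - 1) by ring]
        field_simp
      congr 1
      · rw [logDeriv_apply, deriv_cexp (by fun_prop), deriv_const_mul _ (by fun_prop)]
        simp
      congr 1
      · have := logDeriv_comp (f := Complex.Gamma) (g := fun z : ℂ => z/2+1) (x := s) ?_ (by fun_prop)
        · change logDeriv (Complex.Gamma ∘ fun z : ℂ => z/2+1) s = _
          rw [this]
          simp [Complex.digamma]
          ring
        refine Complex.differentiableAt_Gamma _ fun m h => ?_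
        have := congrArg Complex.re h
        simp at this
        have h2 : (0:ℝ) ≤ m := Nat.cast_nonneg m
        linarith
    · exact hG0
    · exact hz
    · exact hGd
    · exact hzd
    · exact Complex.exp_ne_zero _
    · exact mul_ne_zero hG0 hz
    · exact hPd
    · exact hGd.mul hzd
    · simp only [show 2 * s - 2 = 2 * (s - 1) by ring]
      exact mul_ne_zero two_ne_zero n1
    · exact mul_ne_zero (Complex.exp_ne_zero _) (mul_ne_zero hG0 hz)
    · fun_prop
    · exact hPd.mul (hGd.mul hzd)
  rw [e1, e2]
  ring

/-- The integrated Chebyshev function. -/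
noncomputable def Psi (u : ℝ) : ℝ := ∑' n : ℕ, ArithmeticFunction.vonMangoldt n * max (u - Real.log n) 0

/-- The contribution of the trivial zeros. -/
noncomputable def hh (u : ℝ) : ℝ := ∑' n : ℕ, (1 - Real.exp (-2 * (n+1) * max u 0)) / (4 * ((n:ℝ)+1)^2)

lemma hh_summable (u : ℝ) : Summable fun n : ℕ => (1 - Real.exp (-2 * (n+1) * max u 0)) / (4 * ((n:ℝ)+1)^2) := by
  refine Summable.of_nonneg_of_le (fun n => ?_) (fun n => ?_) inv_sq_summable
  · have : Real.exp (-2 * (n+1) * max u 0) ≤ 1 := by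
      rw [Real.exp_le_one_iff]
      have : 0 ≤ max u 0 := le_max_right _ _
      have h : (0:ℝ) ≤ n := Nat.cast_nonneg n
      nlinarith [mul_nonneg h this]
    apply div_nonneg (by linarith) (by positivity)
  · apply div_le_div₀ zero_le_one _ (by positivity)
    · nlinarith [sq_nonneg ((n:ℝ)+1)]
    · linarith [Real.exp_pos (-2 * (n+1) * max u 0)]

lemma vM_summable : Summable fun n : ℕ => ArithmeticFunction.vonMangoldt n * Real.exp (-(3/2) * Real.log n) := by
  have h := ArithmeticFunction.LSeriesSummable_vonMangoldt (s := (3/2:ℝ)) (by norm_num)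
  rw [LSeriesSummable, ← summable_norm_iff] at h
  refine h.congr fun n => ?_
  rcases Nat.eq_zero_or_pos n with rfl | hn
  · simp
  · rw [LSeries.term_of_ne_zero hn.ne', norm_div, Complex.norm_real, Real.norm_of_nonneg ArithmeticFunction.vonMangoldt_nonneg,
      Complex.norm_natCast_cpow_of_pos hn, div_eq_mul_inv, ← Real.rpow_neg (Nat.cast_nonneg n),
      Real.rpow_def_of_pos (by exact_mod_cast hn)]
    simp
    left; ring

lemma Psi_summable (u : ℝ) : Summable fun n : ℕ => ArithmeticFunction.vonMangoldt n * max (u - Real.log n) 0 := by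
  refine Summable.of_nonneg_of_le (fun n => mul_nonneg ArithmeticFunction.vonMangoldt_nonneg (le_max_right _ _)) (fun n => ?_)
    (vM_summable.mul_right (Real.exp (3/2*u)))
  rw [mul_assoc]
  apply mul_le_mul_of_nonneg_left _ ArithmeticFunction.vonMangoldt_nonneg
  have := (good_lin (Real.log_natCast_nonneg n)).bd u
  rwa [Complex.norm_real, Real.norm_of_nonneg (le_max_right _ _)] at this


lemma norm_half {ρ : ℂ} (h : ρ.re = 1/2) : 1/2 ≤ ‖ρ‖ := h ▸ Complex.re_le_norm ρ

lemma zsum_summable (hRH : ∀ ρ : ℂ, xi ρ = 0 → ρ.re = 1/2) :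
    Summable fun ρ : ZZ xi => (mu xi ρ : ℝ) / ‖(ρ:ℂ)‖^2 := by
  obtain ⟨C, hC, hg⟩ := xi_grow
  refine Summable.of_nonneg_of_le (fun _ => by positivity) (fun ρ => ?_)
    ((mu_summable_sq xi_diff xi_zero xi_zero' hC hg).mul_right 9)
  have h1 := norm_half (hRH ρ ρ.2)
  rw [div_eq_mul_inv, mul_assoc]
  apply mul_le_mul_of_nonneg_left _ (Nat.cast_nonneg _)
  rw [inv_mul_eq_div, ← one_div, div_le_div_iff₀ (by positivity) (by positivity)]
  nlinarith

/-- The constant. -/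
noncomputable def KK : ℂ := - logDeriv xi 0 + 1/2 * Complex.digamma 1 - 1/2 * Real.log π

lemma explicit0 (hRH : ∀ ρ : ℂ, xi ρ = 0 → ρ.re = 1/2) {u : ℝ} (hu : 0 ≤ u) :
    (Psi u : ℂ) = - (∑' ρ : ZZ xi, (mu xi ρ : ℂ) / (ρ:ℂ)^2 * (Complex.exp (ρ * u) - 1)) + KK * u
      + (Real.exp u - 1 - u : ℝ) + hh u := by
  obtain ⟨C, hC, hg⟩ := xi_grow
  have := zz_countable xi_diff xi_zero xi_zero' hC hg
  have g1 := Good.tsum (F := fun n : ℕ => fun u : ℝ => ((ArithmeticFunction.vonMangoldt n : ℝ) : ℂ) * ((max (u - Real.log n) 0 : ℝ) : ℂ))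
    (fun n => (good_lin (Real.log_natCast_nonneg n)).smul _) (by
      refine vM_summable.congr fun n => ?_
      rw [Complex.norm_real, Real.norm_of_nonneg ArithmeticFunction.vonMangoldt_nonneg])
  have g2 := Good.tsum (F := fun ρ : ZZ xi => fun u : ℝ => ((mu xi ρ : ℂ) / (ρ:ℂ)^2) * (Complex.exp (ρ * (max u 0 : ℝ)) - 1))
    (fun ρ => (good_exp (by rw [hRH ρ ρ.2]; norm_num)).smul _) (by
      refine ((zsum_summable hRH).mul_right 2).congr fun ρ => ?_
      simp)
  have g3 := Good.tsum (F := fun n : ℕ => fun u : ℝ => (1 / (4 * ((n:ℂ)+1)^2)) * (Complex.exp ((-2 * ((n:ℂ)+1)) * (max u 0 : ℝ)) - 1))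
    (fun n => (good_exp (by simp; have : (0:ℝ) ≤ n := Nat.cast_nonneg n; linarith)).smul _) (by
      refine (inv_sq_summable.mul_right (1/2)).congr fun n => ?_
      have : ‖(n:ℂ) + 1‖ = n + 1 := by
        rw [← Nat.cast_succ, Complex.norm_natCast]; push_cast; rfl
      rw [norm_div, norm_mul, norm_pow, this]; simp; ring)
  have g4 := (good_lin (le_refl 0)).smul (- KK + 1)
  have g5 := (good_exp (a := 1) (by simp)).smul (-1)
  have G := ((((g1.add g2).add g3).add g4).add g5)
  have hG := G.unique (fun s hs => ?_) u
  · simp only [max_eq_left hu, sub_zero] at hG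
    have p1 : (Psi u : ℂ) = ∑' n : ℕ, ((ArithmeticFunction.vonMangoldt n : ℝ) : ℂ) * ((max (u - Real.log n) 0 : ℝ) : ℂ) := by
      rw [Psi, Complex.ofReal_tsum]; push_cast; rfl
    have p2 : -(hh u : ℂ) = ∑' n : ℕ, (1 / (4 * ((n:ℂ)+1)^2)) * (Complex.exp ((-2 * ((n:ℂ)+1)) * u) - 1) := by
      rw [hh, Complex.ofReal_tsum, ← tsum_neg]; congr 1; funext n; rw [max_eq_left hu]; push_cast; ring
    rw [← p1, ← p2] at hG
    push_cast
    rw [one_mul] at hG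
    linear_combination hG
  · have hs0 : s ≠ 0 := by rintro rfl; simp at hs
    have hs1 : s - 1 ≠ 0 := by intro h; rw [sub_eq_zero] at h; rw [h] at hs; simp at hs
    have q1 : ∑' n : ℕ, ((ArithmeticFunction.vonMangoldt n : ℝ) : ℂ) * (Complex.exp (-s * Real.log n) / s^2) =
        LSeries (fun n => ((ArithmeticFunction.vonMangoldt n : ℝ) : ℂ)) s / s^2 := by
      rw [LSeries, ← tsum_div_const]
      congr 1; funext n
      rcases Nat.eq_zero_or_pos n with rfl | hn
      · simp
      · rw [LSeries.term_of_ne_zero hn.ne', Complex.cpow_def_of_ne_zero (by exact_mod_cast hn.ne'), neg_mul, Complex.exp_neg,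
          Complex.natCast_log, mul_comm s]
        field_simp
    have hxs : xi s ≠ 0 := by intro h; have := hRH s h; rw [hs] at this; norm_num at this
    have q2 : ∑' ρ : ZZ xi, (mu xi ρ : ℂ) / (ρ:ℂ)^2 * ((ρ:ℂ) / (s * (s - ρ))) = (logDeriv xi s - logDeriv xi 0) / s^2 := by
      rw [← (partial_fractions xi_diff xi_zero xi_zero' hC hg hxs).tsum_eq, ← tsum_div_const]
      congr 1; funext ρ
      have h1 : (ρ:ℂ) ≠ 0 := by rw [← norm_pos_iff]; have := norm_half (hRH ρ ρ.2); linarith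
      have h2 : s - ρ ≠ 0 := by
        intro h; rw [sub_eq_zero] at h; exact hxs (h ▸ ρ.2)
      field_simp
      ring
    have q3 : ∑' n : ℕ, (1 / (4 * ((n:ℂ)+1)^2)) * ((-2 * ((n:ℂ)+1)) / (s * (s - (-2 * ((n:ℂ)+1))))) =
        - (1/2 * Complex.digamma (s/2 + 1) - 1/2 * Complex.digamma 1) / s^2 := by
      rw [← digamma_series (by rw [hs]; norm_num), ← tsum_neg, ← tsum_div_const]
      congr 1; funext n
      have h1 : (n:ℂ) + 1 ≠ 0 := Nat.cast_add_one_ne_zero n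
      have h2 : s + 2 * ((n:ℂ) + 1) ≠ 0 := by
        intro h
        have := congrArg Complex.re h
        simp [hs] at this
        have h2 : (0:ℝ) ≤ n := Nat.cast_nonneg n
        linarith
      have h3 : s - (-2 * ((n:ℂ)+1)) = s + 2 * ((n:ℂ) + 1) := by ring
      rw [h3]
      field_simp
      ring
    rw [q1, q2, q3, LL_eq (by rw [hs]; norm_num), KK]
    simp
    field_simp
    ring

end LW

namespace LW
lemma Psi_deriv (u : ℝ) : HasDerivWithinAt Psi (Chebyshev.psi (Real.exp u)) (Set.Ioi u) u := by
  set m := ⌊Real.exp u⌋₊ with hm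
  have hlt : Real.exp u < m + 1 := Nat.lt_floor_add_one _
  have hlog : u < Real.log (m + 1) := by rwa [Real.lt_log_iff_exp_lt (by positivity)]
  have key : ∀ v ∈ Set.Ico u (Real.log (m+1)), Psi v = Psi u + (v - u) * Chebyshev.psi (Real.exp u) := by
    intro v hv
    have e1 : ∀ n : ℕ, ArithmeticFunction.vonMangoldt n * max (v - Real.log n) 0 =
        ArithmeticFunction.vonMangoldt n * max (u - Real.log n) 0 +
        if n ∈ Finset.Ioc 0 m then (v - u) * ArithmeticFunction.vonMangoldt n else 0 := by
      intro n
      rcases Nat.eq_zero_or_pos n with rfl | hn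
      · simp
      have hn' : (0:ℝ) < n := by exact_mod_cast hn
      by_cases h : n ≤ m
      · rw [if_pos (Finset.mem_Ioc.2 ⟨hn, h⟩)]
        have : Real.log n ≤ u := by
          rw [Real.log_le_iff_le_exp hn']
          exact (Nat.cast_le.2 h).trans (Nat.floor_le (Real.exp_pos u).le)
        rw [max_eq_left (by linarith [hv.1]), max_eq_left (by linarith)]
        ring
      · rw [if_neg (by simp [h])]
        push Not at h
        have : Real.log (m+1) ≤ Real.log n := Real.log_le_log (by positivity) (by exact_mod_cast h)
        rw [max_eq_right (by linarith [hv.2]), max_eq_right (by linarith), mul_zero, add_zero]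
    have hs2 : HasSum (fun n : ℕ => if n ∈ Finset.Ioc 0 m then (v - u) * ArithmeticFunction.vonMangoldt n else 0)
        ((v - u) * Chebyshev.psi (Real.exp u)) := by
      have := hasSum_sum_of_ne_finset_zero (L := SummationFilter.unconditional ℕ) (s := Finset.Ioc 0 m)
        (f := fun n : ℕ => if n ∈ Finset.Ioc 0 m then (v - u) * ArithmeticFunction.vonMangoldt n else 0)
        (fun n hn => if_neg hn)
      convert! this using 1
      rw [Chebyshev.psi, Finset.mul_sum]
      exact Finset.sum_congr rfl fun n hn => (if_pos hn).symm
    rw [Psi]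
    simp_rw [e1]
    exact ((Psi_summable u).hasSum.add hs2).tsum_eq
  have h1 : HasDerivWithinAt (fun v => Psi u + (v - u) * Chebyshev.psi (Real.exp u)) (Chebyshev.psi (Real.exp u)) (Set.Ioi u) u := by
    have := (((hasDerivAt_id u).sub_const u).mul_const (Chebyshev.psi (Real.exp u))).const_add (Psi u)
    simpa using this.hasDerivWithinAt
  refine h1.congr_of_eventuallyEq ?_ (by simp)
  filter_upwards [Ioo_mem_nhdsGT hlog] with v hv
  exact key v ⟨hv.1.le, hv.2⟩

lemma Psi_cont : Continuous Psi := by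
  have g1 := Good.tsum (F := fun n : ℕ => fun u : ℝ => ((ArithmeticFunction.vonMangoldt n : ℝ) : ℂ) * ((max (u - Real.log n) 0 : ℝ) : ℂ))
    (fun n => (good_lin (Real.log_natCast_nonneg n)).smul _) (by
      refine vM_summable.congr fun n => ?_
      rw [Complex.norm_real, Real.norm_of_nonneg ArithmeticFunction.vonMangoldt_nonneg])
  refine (Complex.continuous_re.comp g1.cont).congr fun u => ?_
  rw [Function.comp]
  have : (Psi u : ℂ) = ∑' n : ℕ, ((ArithmeticFunction.vonMangoldt n : ℝ) : ℂ) * ((max (u - Real.log n) 0 : ℝ) : ℂ) := by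
      rw [Psi, Complex.ofReal_tsum]; push_cast; rfl
  rw [← this, Complex.ofReal_re]

lemma Psi_zero {u : ℝ} (hu : u ≤ Real.log 2) : Psi u = 0 := by
  rw [Psi]
  convert tsum_zero with n
  rcases lt_or_ge n 2 with h | h
  · interval_cases n <;> simp
  · have : Real.log 2 ≤ Real.log n := Real.log_le_log (by norm_num) (by exact_mod_cast h)
    rw [max_eq_right (by linarith), mul_zero]

/-- The error term of the integrated Chebyshev function. -/
noncomputable def EE (u : ℝ) : ℝ := Psi u - Real.exp u

/-- The error term of the Chebyshev function. -/
noncomputable def ee (u : ℝ) : ℝ := Chebyshev.psi (Real.exp u) - Real.exp u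

lemma EE_cont : Continuous EE := Psi_cont.sub Real.continuous_exp

lemma EE_deriv (u : ℝ) : HasDerivWithinAt EE (ee u) (Set.Ioi u) u :=
  (Psi_deriv u).sub (Real.hasDerivAt_exp u).hasDerivWithinAt

lemma ee_int (a b : ℝ) : IntervalIntegrable ee MeasureTheory.volume a b := by
  have : Monotone fun u : ℝ => Chebyshev.psi (Real.exp u) := fun a b h => Chebyshev.psi_mono (Real.exp_le_exp.2 h)
  exact (this.intervalIntegrable).sub (Real.continuous_exp.intervalIntegrable a b)

lemma EE_sub (a b : ℝ) : ∫ v in a..b, ee v = EE b - EE a :=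
  intervalIntegral.integral_eq_sub_of_hasDeriv_right EE_cont.continuousOn (fun x _ => EE_deriv x) (ee_int a b)

lemma ee_exists_le {a b M : ℝ} (hab : a < b) (h : EE b - EE a ≤ M * (b - a)) : ∃ v ∈ Set.Icc a b, ee v ≤ M := by
  by_contra! hcon
  rw [← EE_sub] at h
  have h2 := intervalIntegral.intervalIntegral_pos_of_pos_on (f := fun v => ee v - M)
    ((ee_int a b).sub intervalIntegrable_const) (fun x hx => sub_pos.2 (hcon x (Set.Ioo_subset_Icc_self hx))) hab
  rw [intervalIntegral.integral_sub (ee_int a b) intervalIntegrable_const, intervalIntegral.integral_const, smul_eq_mul] at h2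
  linarith

lemma ee_exists_ge {a b M : ℝ} (hab : a < b) (h : M * (b - a) ≤ EE b - EE a) : ∃ v ∈ Set.Icc a b, M ≤ ee v := by
  by_contra! hcon
  rw [← EE_sub] at h
  have h2 := intervalIntegral.intervalIntegral_pos_of_pos_on (f := fun v => M - ee v)
    (intervalIntegrable_const.sub (ee_int a b)) (fun x hx => sub_pos.2 (hcon x (Set.Ioo_subset_Icc_self hx))) hab
  rw [intervalIntegral.integral_sub intervalIntegrable_const (ee_int a b), intervalIntegral.integral_const, smul_eq_mul] at h2
  linarith

/-- One oscillating term. -/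
noncomputable def gt (ρ : ZZ xi) (u : ℝ) : ℝ := (mu xi ρ : ℝ) * (Complex.exp (Complex.I * ((ρ:ℂ).im * u : ℝ)) / (ρ:ℂ)^2).re

/-- The sum over zeros. -/
noncomputable def GG (u : ℝ) : ℝ := ∑' ρ : ZZ xi, gt ρ u

lemma gt_bd (ρ : ZZ xi) (u : ℝ) : |gt ρ u| ≤ (mu xi ρ : ℝ) / ‖(ρ:ℂ)‖^2 := by
  rw [gt, abs_mul, Nat.abs_cast, div_eq_mul_inv (mu xi ρ : ℝ)]
  apply mul_le_mul_of_nonneg_left _ (Nat.cast_nonneg _)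
  refine (Complex.abs_re_le_norm _).trans ?_
  rw [norm_div, mul_comm Complex.I, Complex.norm_exp_ofReal_mul_I, norm_pow, one_div]

lemma gt_diff (ρ : ZZ xi) (u v : ℝ) : |gt ρ (u + v) - gt ρ v| ≤
    (mu xi ρ : ℝ) / ‖(ρ:ℂ)‖^2 * ‖Complex.exp (Complex.I * ((ρ:ℂ).im * u : ℝ)) - 1‖ := by
  rw [gt, gt, ← mul_sub, abs_mul, Nat.abs_cast, div_eq_mul_inv (mu xi ρ : ℝ), mul_assoc, ← Complex.sub_re]
  apply mul_le_mul_of_nonneg_left _ (Nat.cast_nonneg _)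
  refine (Complex.abs_re_le_norm _).trans (le_of_eq ?_)
  have : Complex.exp (Complex.I * ((ρ:ℂ).im * (u+v) : ℝ)) = Complex.exp (Complex.I * ((ρ:ℂ).im * u : ℝ)) * Complex.exp (Complex.I * ((ρ:ℂ).im * v : ℝ)) := by
    rw [← Complex.exp_add]; push_cast; ring_nf
  rw [← sub_div, this, ← sub_one_mul, norm_div, norm_mul, mul_comm Complex.I ((ρ:ℂ).im * v : ℝ), Complex.norm_exp_ofReal_mul_I, norm_pow, mul_one, div_eq_mul_inv, mul_comm]

lemma gt_summable (hRH : ∀ ρ : ℂ, xi ρ = 0 → ρ.re = 1/2) (u : ℝ) : Summable fun ρ => gt ρ u :=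
  Summable.of_norm_bounded (zsum_summable hRH) (fun ρ => gt_bd ρ u)

lemma GG_bd (hRH : ∀ ρ : ℂ, xi ρ = 0 → ρ.re = 1/2) (u : ℝ) : |GG u| ≤ ∑' ρ : ZZ xi, (mu xi ρ : ℝ) / ‖(ρ:ℂ)‖^2 := by
  rw [← Real.norm_eq_abs, GG]
  exact tsum_of_norm_bounded (zsum_summable hRH).hasSum (fun ρ => gt_bd ρ u)

lemma explicit1 (hRH : ∀ ρ : ℂ, xi ρ = 0 → ρ.re = 1/2) {u : ℝ} (hu : 0 ≤ u) :
    EE u = - Real.exp (u/2) * GG u + GG 0 + (KK.re - 1) * u - 1 + hh u := by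
  have h := congrArg Complex.re (explicit0 hRH hu)
  have e : ∀ ρ : ZZ xi, (mu xi ρ : ℂ) / (ρ:ℂ)^2 * (Complex.exp (ρ * u) - 1) =
      (Real.exp (u/2) : ℝ) * ((mu xi ρ : ℝ) * (Complex.exp (Complex.I * ((ρ:ℂ).im * u : ℝ)) / (ρ:ℂ)^2)) -
      (mu xi ρ : ℝ) * (Complex.exp (Complex.I * ((ρ:ℂ).im * (0:ℝ) : ℝ)) / (ρ:ℂ)^2) := by
    intro ρ
    have h1 : Complex.exp (ρ * u) = (Real.exp (u/2) : ℝ) * Complex.exp (Complex.I * ((ρ:ℂ).im * u : ℝ)) := by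
      rw [Complex.ofReal_exp, ← Complex.exp_add]
      congr 1
      conv_lhs => rw [← Complex.re_add_im (ρ:ℂ), hRH ρ ρ.2]
      push_cast; ring
    rw [h1]; simp; ring
  have e2 : ∀ ρ : ZZ xi, ((mu xi ρ : ℂ) / (ρ:ℂ)^2 * (Complex.exp (ρ * u) - 1)).re = Real.exp (u/2) * gt ρ u - gt ρ 0 := by
    intro ρ
    rw [e, Complex.sub_re, Complex.re_ofReal_mul, Complex.re_ofReal_mul, Complex.re_ofReal_mul]; rfl
  have hs : Summable fun ρ : ZZ xi => (mu xi ρ : ℂ) / (ρ:ℂ)^2 * (Complex.exp (ρ * u) - 1) := by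
    refine Summable.of_norm_bounded ((zsum_summable hRH).mul_right (Real.exp (u/2) + 1)) fun ρ => ?_
    rw [norm_mul, norm_div, norm_pow, Complex.norm_natCast]
    apply mul_le_mul_of_nonneg_left _ (by positivity)
    refine (norm_sub_le _ _).trans ?_
    rw [Complex.norm_exp, norm_one]
    simp [hRH ρ ρ.2]
    linarith
  simp only [Complex.add_re, Complex.neg_re, Complex.ofReal_re, Complex.re_mul_ofReal] at h
  rw [Complex.re_tsum hs] at h
  simp only [e2] at h
  rw [((gt_summable hRH u).mul_left _).tsum_sub (gt_summable hRH 0), tsum_mul_left] at h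
  rw [EE, h, GG, GG]; ring

lemma hh_diff {u v : ℝ} (hu : 1 ≤ u) (hv : 1 ≤ v) : |hh u - hh v| ≤ (∑' n : ℕ, 1 / ((n:ℝ) + 1) ^ 2) * |u - v| := by
  rw [hh, hh, ← (hh_summable u).tsum_sub (hh_summable v), ← tsum_mul_right, ← Real.norm_eq_abs]
  refine tsum_of_norm_bounded (inv_sq_summable.mul_right _).hasSum fun n => ?_
  rw [max_eq_left (by linarith), max_eq_left (by linarith), ← sub_div, norm_div, div_mul_eq_mul_div, one_mul]
  apply div_le_div₀ (abs_nonneg _) _ (by positivity)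
  · rw [Real.norm_of_nonneg (by positivity)]; nlinarith [sq_nonneg ((n:ℝ)+1)]
  · rw [Real.norm_eq_abs, show (1 - Real.exp (-2 * ((n:ℝ)+1) * u) - (1 - Real.exp (-2 * ((n:ℝ)+1) * v))) = (Real.exp (-2 * ((n:ℝ)+1) * v) - Real.exp (-2 * ((n:ℝ)+1) * u)) by ring]
    have key : ∀ u v : ℝ, 1 ≤ u → u ≤ v → |Real.exp (-2 * ((n:ℝ)+1) * v) - Real.exp (-2 * ((n:ℝ)+1) * u)| ≤ |u - v| := by
      intro u v hu huv
      have h0 : (0:ℝ) ≤ n := Nat.cast_nonneg n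
      set a := 2 * ((n:ℝ)+1) with ha
      have ha0 : 0 < a := by positivity
      rw [show -2 * ((n:ℝ)+1) = -a by rw [ha]; ring]
      rw [abs_sub_comm, abs_of_nonneg (sub_nonneg.2 (Real.exp_le_exp.2 (by nlinarith))), abs_sub_comm, abs_of_nonneg (sub_nonneg.2 huv)]
      have h1 : Real.exp (-a * v) = Real.exp (-a * u) * Real.exp (-(a * (v-u))) := by rw [← Real.exp_add]; ring_nf
      have h2 : 1 - a * (v - u) ≤ Real.exp (-(a * (v-u))) := by have := Real.add_one_le_exp (-(a * (v-u))); linarith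
      have h3 : Real.exp (-a*u) * a ≤ 1 := by
        have : a ≤ Real.exp (a * u) := by have := Real.add_one_le_exp (a*u); nlinarith
        rw [neg_mul, Real.exp_neg, inv_mul_le_iff₀ (Real.exp_pos _)]; linarith
      rw [h1]
      have h4 := Real.exp_pos (-a*u)
      have h5 : 0 ≤ v - u := by linarith
      nlinarith [mul_le_mul_of_nonneg_left h2 h4.le, mul_le_mul_of_nonneg_right h3 h5]
    rcases le_total u v with h | h
    · rw [abs_sub_comm]
      have := key u v hu h
      rwa [abs_sub_comm] at this
    · rw [abs_sub_comm u v]; have := key v u hv h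
      rwa [abs_sub_comm] at this

lemma hh_lower {d : ℝ} (hd : 0 < d) : d/2 * Real.log (1/(4*d)) ≤ hh (2*d) := by
  set N := ⌊1/(4*d)⌋₊ with hN
  have hN1 : (N:ℝ) ≤ 1/(4*d) := Nat.floor_le (by positivity)
  have hN2 : 1/(4*d) < N + 1 := Nat.lt_floor_add_one _
  have h1 : Real.log (1/(4*d)) ≤ ∑ n ∈ Finset.range N, 1/((n:ℝ)+1) := by
    have := log_add_one_le_harmonic N
    refine (Real.log_le_log (by positivity) hN2.le).trans ?_
    refine (by exact_mod_cast this : Real.log (N+1) ≤ (harmonic N : ℝ)).trans (le_of_eq ?_)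
    rw [harmonic]; push_cast; simp
  calc d/2 * Real.log (1/(4*d)) ≤ d/2 * ∑ n ∈ Finset.range N, 1/((n:ℝ)+1) := by gcongr
    _ = ∑ n ∈ Finset.range N, d/2 * (1/((n:ℝ)+1)) := Finset.mul_sum _ _ _
    _ ≤ ∑ n ∈ Finset.range N, (1 - Real.exp (-2 * (n+1) * max (2*d) 0)) / (4 * ((n:ℝ)+1)^2) := by
      refine Finset.sum_le_sum fun n hn => ?_
      rw [max_eq_left (by positivity)]
      have hn' : (n:ℝ) + 1 ≤ N := by exact_mod_cast Finset.mem_range.1 hn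
      set x := 4 * ((n:ℝ)+1) * d with hx
      have hx0 : 0 ≤ x := by positivity
      have hx1 : x ≤ 1 := by
        have : (n:ℝ) + 1 ≤ 1/(4*d) := hn'.trans hN1
        rw [le_div_iff₀ (by positivity)] at this
        linarith
      have h3 : Real.exp (-x) ≤ 1 - x/2 := by
        rw [Real.exp_neg, inv_le_comm₀ (Real.exp_pos _) (by linarith)]
        have := Real.add_one_le_exp x
        rw [inv_le_comm₀ (by linarith) (Real.exp_pos _)]
        refine (inv_anti₀ (by positivity) this).trans ?_
        rw [inv_le_iff_one_le_mul₀ (by positivity)]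
        nlinarith
      rw [show -2 * ((n:ℝ)+1) * (2*d) = -x by rw [hx]; ring, le_div_iff₀ (by positivity)]
      have : d/2 * (1/((n:ℝ)+1)) * (4 * ((n:ℝ)+1)^2) = x/2 := by rw [hx]; field_simp
      linarith
    _ ≤ hh (2*d) := by
      refine (hh_summable (2*d)).sum_le_tsum _ fun n _ => ?_
      rw [max_eq_left (by positivity)]
      apply div_nonneg _ (by positivity)
      rw [sub_nonneg, Real.exp_le_one_iff]
      have h0 : (0:ℝ) ≤ n := Nat.cast_nonneg n
      nlinarith [mul_nonneg h0 hd.le]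

lemma hh_nonneg (u : ℝ) : 0 ≤ hh u := tsum_nonneg fun n => by
  apply div_nonneg _ (by positivity)
  rw [sub_nonneg, Real.exp_le_one_iff]
  have h0 : (0:ℝ) ≤ n := Nat.cast_nonneg n
  have := le_max_right u 0
  nlinarith [mul_nonneg h0 this]

lemma hh_le (u : ℝ) : hh u ≤ ∑' n : ℕ, 1 / ((n:ℝ) + 1) ^ 2 := by
  refine (hh_summable u).tsum_le_tsum (fun n => ?_) inv_sq_summable
  apply div_le_div₀ zero_le_one _ (by positivity)
  · nlinarith [sq_nonneg ((n:ℝ)+1)]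
  · linarith [Real.exp_pos (-2 * (n+1) * max u 0)]
end LW

namespace LW
lemma dirichlet (S : Finset ℂ) {q : ℕ} (hq : 0 < q) (Y : ℝ) :
    ∃ n : ℕ, 1 ≤ n ∧ n ≤ q ^ S.card ∧ ∀ ρ ∈ S, ‖Complex.exp (Complex.I * (ρ.im * (n * Y) : ℝ)) - 1‖ ≤ 2 * π / q := by
  have hq' : (0:ℝ) < q := by exact_mod_cast hq
  have hfl : ∀ t : ℝ, ⌊q * Int.fract t⌋₊ < q := by
    intro t
    rw [Nat.floor_lt (mul_nonneg hq'.le (Int.fract_nonneg _))]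
    nlinarith [Int.fract_lt_one t]
  let f : ℕ → (S → Fin q) := fun n ρ => ⟨⌊q * Int.fract ((ρ:ℂ).im * (n * Y) / (2 * π))⌋₊, hfl _⟩
  obtain ⟨a, ha, b, hb, hab, hf⟩ := Finset.exists_ne_map_eq_of_card_lt_of_maps_to
    (s := Finset.range (q ^ S.card + 1)) (t := (Finset.univ : Finset (S → Fin q))) (f := f) (by simp) (by intro x _; simp)
  have key : ∀ a b : ℕ, a < b → f a = f b → ∀ ρ ∈ S, ‖Complex.exp (Complex.I * (ρ.im * (((b - a : ℕ):ℝ) * Y) : ℝ)) - 1‖ ≤ 2 * π / q := by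
    intro a b hab hf ρ hρ
    have h1 := congrArg Fin.val (congrFun hf ⟨ρ, hρ⟩)
    simp only [f] at h1
    set x := ρ.im * (a * Y) / (2 * π) with hx
    set y := ρ.im * (b * Y) / (2 * π) with hy
    have h2 : |Int.fract y - Int.fract x| ≤ 1 / q := by
      have l1 := Nat.floor_le (mul_nonneg hq'.le (Int.fract_nonneg x))
      have l2 := Nat.lt_floor_add_one (q * Int.fract x)
      have l3 := Nat.floor_le (mul_nonneg hq'.le (Int.fract_nonneg y))
      have l4 := Nat.lt_floor_add_one (q * Int.fract y)
      rw [h1] at l1 l2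
      rw [abs_le, ← neg_div, div_le_iff₀ hq', le_div_iff₀ hq']
      constructor <;> nlinarith
    have h3 : (ρ.im * (((b - a : ℕ):ℝ) * Y) : ℝ) = 2 * π * (Int.fract y - Int.fract x) + ((⌊y⌋ - ⌊x⌋ : ℤ) : ℝ) * (2 * π) := by
      have e1 : Int.fract y = y - ⌊y⌋ := rfl
      have e2 : Int.fract x = x - ⌊x⌋ := rfl
      rw [e1, e2, hx, hy, Nat.cast_sub hab.le]
      push_cast
      field_simp
      ring
    have h4 : Complex.exp (Complex.I * (ρ.im * (((b - a : ℕ):ℝ) * Y) : ℝ)) = Complex.exp (Complex.I * (2 * π * (Int.fract y - Int.fract x) : ℝ)) := by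
      rw [h3, Complex.ofReal_add, mul_add, Complex.exp_add]
      have : Complex.I * ((((⌊y⌋ - ⌊x⌋ : ℤ) : ℝ) * (2 * π) : ℝ) : ℂ) = ((⌊y⌋ - ⌊x⌋ : ℤ) : ℂ) * (2 * π * Complex.I) := by
        push_cast; ring
      rw [this, Complex.exp_int_mul_two_pi_mul_I, mul_one]
    rw [h4]
    refine Real.norm_exp_I_mul_ofReal_sub_one_le.trans ?_
    rw [Real.norm_eq_abs, abs_mul, abs_of_pos (by positivity : (0:ℝ) < 2 * π), mul_div_assoc]
    calc 2 * π * |Int.fract y - Int.fract x| ≤ 2 * π * (1/q) := by gcongr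
      _ = _ := by ring
  rw [Finset.mem_range] at ha hb
  rcases lt_or_gt_of_ne hab with h | h
  · exact ⟨b - a, by omega, by omega, key a b h hf⟩
  · exact ⟨a - b, by omega, by omega, key b a h hf.symm⟩

lemma zs_card {C : ℝ} (hC : 0 < C) (hg : Grow xi C) {R : ℝ} (hR : 1 ≤ R) :
    ((zs xi_diff xi_zero' R).card : ℝ) ≤ 12 * C * R ^ ((3:ℝ)/2) := by
  refine le_trans ?_ (count_bound xi_diff xi_zero xi_zero' hC hg hR)
  have : (zs xi_diff xi_zero' R).card ≤ ∑ ρ ∈ zs xi_diff xi_zero' R, mu xi ρ := by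
    rw [Finset.card_eq_sum_ones]
    refine Finset.sum_le_sum fun ρ hρ => ?_
    exact mu_pos xi_diff xi_zero' ⟨ρ, ((mem_zs xi_diff xi_zero' R ρ).1 hρ).1⟩
  exact_mod_cast this

lemma almost_period (hRH : ∀ ρ : ℂ, xi ρ = 0 → ρ.re = 1/2) : ∃ B : ℝ, 0 < B ∧ ∃ W : ℝ, 0 ≤ W ∧
    ∀ d : ℝ, 0 < d → d ≤ 1 → ∃ y0 : ℝ, 2/d ≤ y0 ∧ Real.log y0 ≤ B * (1/d)^7 ∧ ∀ y, |GG (y0 + y) - GG y| ≤ W * d := by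
  obtain ⟨C, hC, hg⟩ := xi_grow
  set w : ZZ xi → ℝ := fun ρ => (mu xi ρ : ℝ) / ‖(ρ:ℂ)‖^2 * 7 + 54 * ((mu xi ρ : ℝ) * (1 + ‖(ρ:ℂ)‖)^(-(7/4) : ℝ)) with hw
  have hws : Summable w := ((zsum_summable hRH).mul_right 7).add ((mu_summable xi_diff xi_zero xi_zero' hC hg).mul_left 54)
  refine ⟨24 * C + 2, by positivity, ∑' ρ, w ρ, tsum_nonneg fun ρ => by positivity, fun d hd hd1 => ?_⟩
  have hd' : 1 ≤ 1/d := by rw [le_div_iff₀ hd]; linarith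
  set q := ⌈1/d⌉₊ with hq
  have hq1 : 1/d ≤ q := Nat.le_ceil _
  have hq2 : (q:ℝ) ≤ 2/d := by
    have := Nat.ceil_lt_add_one (by positivity : (0:ℝ) ≤ 1/d)
    have e : 2/d = 1/d + 1/d := by ring
    linarith
  have hq0 : (0:ℝ) < q := by linarith
  set T := (1/d)^4 with hT
  have hT1 : 1 ≤ T := one_le_pow₀ hd'
  obtain ⟨n, hn1, hn2, hn⟩ := dirichlet (zs xi_diff xi_zero' T) (by exact_mod_cast hq0 : 0 < q) (2/d)
  have hn1' : (1:ℝ) ≤ n := by exact_mod_cast hn1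
  refine ⟨n * (2/d), ?_, ?_, fun y => ?_⟩
  · have : 0 < 2/d := by positivity
    nlinarith
  · rw [Real.log_mul (by positivity) (by positivity)]
    have h1 : Real.log n ≤ (zs xi_diff xi_zero' T).card * Real.log q := by
      rw [← Real.log_pow]
      apply Real.log_le_log (by positivity)
      exact_mod_cast hn2
    have h2 := zs_card hC hg hT1
    have h3 : T ^ ((3:ℝ)/2) = (1/d)^6 := by
      rw [hT, ← Real.rpow_natCast, ← Real.rpow_natCast, ← Real.rpow_mul (by positivity)]; norm_num
    rw [h3] at h2
    have h4 : Real.log q ≤ 2/d := by have := Real.log_le_sub_one_of_pos hq0; linarith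
    have h5 : Real.log (2/d) ≤ 2/d := by have := Real.log_le_sub_one_of_pos (by positivity : 0 < 2/d); linarith
    have h6 : 0 ≤ Real.log q := Real.log_natCast_nonneg q
    have h7 : ((zs xi_diff xi_zero' T).card : ℝ) * Real.log q ≤ 12 * C * (1/d)^6 * (2/d) := by gcongr
    have h8 : 1/d ≤ (1/d)^7 := le_self_pow₀ hd' (by norm_num)
    have h9 : 12 * C * (1/d)^6 * (2/d) = 24 * C * (1/d)^7 := by ring
    have h10 : 2/d = 2 * (1/d) := by ring
    linarith
  · rw [GG, GG, ← (gt_summable hRH _).tsum_sub (gt_summable hRH _), ← Real.norm_eq_abs, ← tsum_mul_right]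
    refine tsum_of_norm_bounded (hws.mul_right d).hasSum fun ρ => ?_
    refine (gt_diff ρ _ y).trans ?_
    have hm : (0:ℝ) ≤ mu xi ρ := Nat.cast_nonneg _
    have hρ := norm_half (hRH ρ ρ.2)
    by_cases h : ‖(ρ:ℂ)‖ ≤ T
    · have h1 := hn ρ ((mem_zs xi_diff xi_zero' T ρ).2 ⟨ρ.2, h⟩)
      have h2 : 2 * π / q ≤ 7 * d := by
        rw [div_le_iff₀ hq0]
        have : 1 ≤ q * d := by rwa [div_le_iff₀ hd] at hq1
        have := Real.pi_lt_d2
        nlinarith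
      calc _ ≤ (mu xi ρ : ℝ) / ‖(ρ:ℂ)‖^2 * (7 * d) := by gcongr; exact h1.trans h2
        _ ≤ w ρ * d := by
          rw [hw]; simp only
          have : 0 ≤ 54 * ((mu xi ρ : ℝ) * (1 + ‖(ρ:ℂ)‖)^(-(7/4) : ℝ)) := by positivity
          nlinarith
    · push Not at h
      have h1 : ‖Complex.exp (Complex.I * ((ρ:ℂ).im * (n * (2/d)) : ℝ)) - 1‖ ≤ 2 := by
        refine (norm_sub_le _ _).trans ?_
        rw [mul_comm Complex.I, Complex.norm_exp_ofReal_mul_I]; norm_num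
      have h2 : 1 / ‖(ρ:ℂ)‖^2 ≤ 27 * d * (1 + ‖(ρ:ℂ)‖)^(-(7/4) : ℝ) := by
        have hp : (0:ℝ) < ‖(ρ:ℂ)‖ := by linarith
        have k1 : 1 / ‖(ρ:ℂ)‖^2 = ‖(ρ:ℂ)‖^(-(1/4) : ℝ) * ‖(ρ:ℂ)‖^(-(7/4) : ℝ) := by
          rw [← Real.rpow_add hp, one_div, ← Real.rpow_natCast, ← Real.rpow_neg hp.le]; norm_num
        have k2 : ‖(ρ:ℂ)‖^(-(1/4) : ℝ) ≤ d := by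
          have : T ^ (-(1/4) : ℝ) = d := by
            rw [hT, ← Real.rpow_natCast, ← Real.rpow_mul (by positivity)]
            norm_num
            rw [Real.rpow_neg (by positivity), Real.rpow_one, inv_inv]
          rw [← this]
          exact Real.rpow_le_rpow_of_nonpos (by linarith) h.le (by norm_num)
        have k3 : ‖(ρ:ℂ)‖^(-(7/4) : ℝ) ≤ 27 * (1 + ‖(ρ:ℂ)‖)^(-(7/4) : ℝ) := by
          have j1 : ((1 + ‖(ρ:ℂ)‖)/3)^(-(7/4) : ℝ) ≥ ‖(ρ:ℂ)‖^(-(7/4) : ℝ) :=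
            Real.rpow_le_rpow_of_nonpos (by positivity) (by linarith) (by norm_num)
          rw [Real.div_rpow (by positivity) (by norm_num)] at j1
          have j2 : (3:ℝ)^(-(7/4) : ℝ) ≥ 1/27 := by
            have : (3:ℝ)^(-(3:ℝ)) ≤ (3:ℝ)^(-(7/4) : ℝ) := Real.rpow_le_rpow_of_exponent_le (by norm_num) (by norm_num)
            have e : (3:ℝ)^(-(3:ℝ)) = 1/27 := by rw [Real.rpow_neg (by norm_num)]; norm_num
            linarith
          refine j1.le.trans ?_
          rw [div_le_iff₀ (by positivity)]
          have : 0 ≤ (1 + ‖(ρ:ℂ)‖)^(-(7/4) : ℝ) := by positivity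
          nlinarith
        rw [k1]
        calc _ ≤ d * (27 * (1 + ‖(ρ:ℂ)‖)^(-(7/4) : ℝ)) := by gcongr
          _ = _ := by ring
      calc _ ≤ (mu xi ρ : ℝ) / ‖(ρ:ℂ)‖^2 * 2 := by gcongr
        _ = (mu xi ρ : ℝ) * (1 / ‖(ρ:ℂ)‖^2) * 2 := by ring
        _ ≤ (mu xi ρ : ℝ) * (27 * d * (1 + ‖(ρ:ℂ)‖)^(-(7/4) : ℝ)) * 2 := by gcongr
        _ ≤ w ρ * d := by
          rw [hw]; simp only
          have : 0 ≤ (mu xi ρ : ℝ) / ‖(ρ:ℂ)‖^2 * 7 * d := by positivity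
          linarith

lemma GG_sym (hRH : ∀ ρ : ℂ, xi ρ = 0 → ρ.re = 1/2) (u : ℝ) :
    |GG u - GG (-u)| ≤ 2 * (∑' ρ : ZZ xi, (mu xi ρ : ℝ) / ‖(ρ:ℂ)‖^2) * |u| := by
  rw [GG, GG, ← (gt_summable hRH _).tsum_sub (gt_summable hRH _), ← Real.norm_eq_abs u, ← Real.norm_eq_abs, ← tsum_mul_left, ← tsum_mul_right]
  refine tsum_of_norm_bounded (((zsum_summable hRH).mul_left 2).mul_right _).hasSum fun ρ => ?_
  have hρ := norm_half (hRH ρ ρ.2)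
  have hre := hRH ρ ρ.2
  set g := (ρ:ℂ).im with hgdef
  have hN : ‖(ρ:ℂ)‖^2 = 1/4 + g^2 := by
    rw [Complex.sq_norm, Complex.normSq_apply, hre]; ring
  have e : gt ρ u - gt ρ (-u) = (mu xi ρ : ℝ) * (2 * Real.sin (g * u) * g / (‖(ρ:ℂ)‖^2)^2) := by
    rw [gt, gt, ← mul_sub]
    congr 1
    rw [← Complex.sub_re, ← sub_div]
    have e1 : Complex.exp (Complex.I * ((ρ:ℂ).im * u : ℝ)) - Complex.exp (Complex.I * ((ρ:ℂ).im * (-u) : ℝ)) = 2 * (Real.sin (g*u) : ℝ) * Complex.I := by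
      rw [mul_comm Complex.I, mul_comm Complex.I, Complex.exp_mul_I, Complex.exp_mul_I, mul_neg]
      push_cast
      rw [Complex.cos_neg, Complex.sin_neg]; ring
    rw [e1, Complex.div_re]
    have e2 : Complex.normSq ((ρ:ℂ)^2) = (‖(ρ:ℂ)‖^2)^2 := by rw [map_pow, Complex.sq_norm]
    rw [e2]
    generalize Real.sin (g * u) = S0
    simp [pow_two, hre, ← hgdef]
    ring
  rw [e, Real.norm_eq_abs, abs_mul, Nat.abs_cast]
  have h1 : |2 * Real.sin (g * u) * g / (‖(ρ:ℂ)‖^2)^2| ≤ 2 * |u| / ‖(ρ:ℂ)‖^2 := by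
    rw [abs_div, abs_mul, abs_mul, abs_of_pos (by norm_num : (0:ℝ) < 2), abs_of_nonneg (by positivity : (0:ℝ) ≤ (‖(ρ:ℂ)‖^2)^2), pow_two (‖(ρ:ℂ)‖^2), ← div_div]
    apply div_le_div_of_nonneg_right _ (by positivity)
    rw [div_le_iff₀ (by positivity)]
    have h2 := Real.abs_sin_le_abs (x := g * u)
    rw [abs_mul] at h2
    rw [hN]
    have h3 : |g| * |g| = g^2 := by rw [← pow_two, sq_abs]
    calc 2 * |Real.sin (g*u)| * |g| ≤ 2 * (|g| * |u|) * |g| := by gcongr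
      _ = 2 * |u| * g^2 := by rw [← h3]; ring
      _ ≤ _ := by have := abs_nonneg u; nlinarith
  calc _ ≤ (mu xi ρ : ℝ) * (2 * |u| / ‖(ρ:ℂ)‖^2) := by gcongr
    _ = _ := by rw [Real.norm_eq_abs]; ring

end LW

namespace LW

lemma EE_bd (hRH : ∀ ρ : ℂ, xi ρ = 0 → ρ.re = 1/2) : ∃ C : ℝ, 0 < C ∧ ∀ u, 0 ≤ u → |EE u| ≤ C * Real.exp (u/2) := by
  set S := ∑' ρ : ZZ xi, (mu xi ρ : ℝ) / ‖(ρ:ℂ)‖^2 with hS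
  set H := ∑' n : ℕ, 1 / ((n:ℝ) + 1) ^ 2 with hH
  have hS0 : 0 ≤ S := tsum_nonneg fun _ => by positivity
  have hH0 : 0 ≤ H := tsum_nonneg fun _ => by positivity
  refine ⟨2 * S + 2 * |KK.re - 1| + 1 + H, by positivity, fun u hu => ?_⟩
  rw [explicit1 hRH hu]
  have h1 := GG_bd hRH u
  have h2 := GG_bd hRH 0
  rw [← hS] at h1 h2
  have h3 := hh_nonneg u
  have h4 := hh_le u
  rw [← hH] at h4
  have h5 : 1 ≤ Real.exp (u/2) := Real.one_le_exp (by linarith)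
  have h6 : u ≤ 2 * Real.exp (u/2) := by have := Real.add_one_le_exp (u/2); linarith
  set e := Real.exp (u/2)
  set k := KK.re - 1
  have h7 : |k * u| ≤ |k| * (2 * e) := by rw [abs_mul, abs_of_nonneg hu]; gcongr
  have h8 : |e * GG u| ≤ e * S := by rw [abs_mul, abs_of_nonneg (by linarith)]; gcongr
  have e1 : S ≤ S * e := le_mul_of_one_le_right hS0 h5
  have e2 : H ≤ H * e := le_mul_of_one_le_right hH0 h5
  rw [abs_le] at *
  constructor <;> nlinarith

set_option maxHeartbeats 400000 in
lemma psi_osc (hRH : ∀ ρ : ℂ, xi ρ = 0 → ρ.re = 1/2) : ∃ c : ℝ, 0 < c ∧ ∀ X : ℝ,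
    (∃ v ≥ X, ee v ≤ -(c * Real.exp (v/2) * Real.log (Real.log v))) ∧
    (∃ v ≥ X, c * Real.exp (v/2) * Real.log (Real.log v) ≤ ee v) := by
  obtain ⟨B, hB, W, hW, hap⟩ := almost_period hRH
  refine ⟨1/128, by norm_num, fun X => ?_⟩
  set S := ∑' ρ : ZZ xi, (mu xi ρ : ℝ) / ‖(ρ:ℂ)‖^2 with hS
  set H := ∑' n : ℕ, 1 / ((n:ℝ) + 1) ^ 2 with hH
  set k := KK.re - 1 with hk
  have hS0 : 0 ≤ S := tsum_nonneg fun _ => by positivity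
  have hH0 : 0 ≤ H := tsum_nonneg fun _ => by positivity
  set C1 := 4 * |k| + 3 * W + 2 * H + 7 * S with hC1
  have hC10 : 0 ≤ C1 := by positivity
  have hlB : 0 ≤ Real.log (B+1) := Real.log_nonneg (by linarith)
  have hl4 : 0 ≤ Real.log 4 := Real.log_nonneg (by norm_num)
  set L := 4 * C1 + Real.log (B+1) + 7 * Real.log 4 + |X| + 1 with hL
  have hL1 : 1 ≤ L := by have := abs_nonneg X; linarith
  set d := Real.exp (-L) / 4 with hd
  clear_value S H k C1 L d
  have hd0 : 0 < d := by rw [hd]; positivity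
  have hd4 : d ≤ 1/4 := by
    have : Real.exp (-L) ≤ 1 := Real.exp_le_one_iff.2 (by linarith)
    linarith
  have hdL : 1/d = 4 * Real.exp L := by rw [hd, Real.exp_neg]; field_simp
  have hLlog : Real.log (1/(4*d)) = L := by
    rw [show 1/(4*d) = Real.exp L by rw [hd, Real.exp_neg]; field_simp, Real.log_exp]
  have hdX : X + 1 ≤ 1/d := by
    rw [hdL]
    have := Real.add_one_le_exp L
    have := le_abs_self X
    linarith
  have hd4' : 4 ≤ 1/d := by rw [le_div_iff₀ hd0]; linarith
  obtain ⟨y0, hy0, hy1, hy⟩ := hap d hd0 (by linarith)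
  have hy0' : 8 ≤ y0 := by have : 2/d = 2 * (1/d) := by ring
                           linarith
  have hy0X : X + 1 ≤ y0 := by have : 2/d = 2 * (1/d) := by ring
                               linarith
  -- common
  have hed2 : Real.exp d ≤ 1 + 2 * d := by
    have := Real.abs_exp_sub_one_sub_id_le (x := d) (by rw [abs_of_pos hd0]; linarith)
    have h1 := (abs_le.1 this).2
    have h2 : d^2 ≤ d * 1 := by rw [pow_two]; gcongr; linarith
    linarith
  have hed1 : 1 - d ≤ Real.exp (-d) := by have := Real.add_one_le_exp (-d); linarith
  have hed0 : 1 + d ≤ Real.exp d := by have := Real.add_one_le_exp d; linarith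
  have hP : Real.exp d * GG (2*d) - GG 0 ≥ d/2 * L - 2 * |k| * d := by
    have h1 := explicit1 hRH (u := 2*d) (by positivity)
    have h2 : EE (2*d) = - Real.exp (2*d) := by
      rw [EE, Psi_zero (by have := Real.log_two_gt_d9; linarith), zero_sub]
    rw [h2, show 2*d/2 = d by ring, ← hk] at h1
    have h3 := hh_lower hd0
    rw [hLlog] at h3
    have h4 : 1 ≤ Real.exp (2*d) := Real.one_le_exp (by positivity)
    have h5 := mul_le_mul_of_nonneg_right (neg_abs_le k) (by linarith : 0 ≤ 2 * d)
    linarith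
  have hey : 1 ≤ Real.exp (y0/2) := Real.one_le_exp (by linarith)
  have hfin : ∀ v, y0 - 2*d ≤ v → v ≤ y0 + 2*d → X ≤ v ∧
      1/128 * Real.exp (v/2) * Real.log (Real.log v) ≤ Real.exp (y0/2) * (L/2 - C1) / 2 := by
    intro v hv1 hv2
    refine ⟨by linarith, ?_⟩
    have h1 : L/8 ≤ (L/2 - C1)/2 := by have := abs_nonneg X; linarith
    have h2 : Real.exp (v/2) ≤ 2 * Real.exp (y0/2) := by
      calc Real.exp (v/2) ≤ Real.exp (d + y0/2) := Real.exp_le_exp.2 (by linarith)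
        _ = Real.exp d * Real.exp (y0/2) := Real.exp_add _ _
        _ ≤ 2 * Real.exp (y0/2) := by gcongr; linarith
    have h3 : Real.log (Real.log v) ≤ 8 * L := by
      have hv0 : 1 < v := by linarith
      have j1 : Real.log v ≤ (B+1) * (1/d)^7 := by
        have : Real.log v ≤ Real.log (2 * y0) := Real.log_le_log (by linarith) (by linarith)
        rw [Real.log_mul (by norm_num) (by linarith)] at this
        have j2 := Real.log_two_lt_d9
        have j3 : 1 ≤ (1/d)^7 := one_le_pow₀ (by linarith)
        linarith
      have j4 : 0 < Real.log v := Real.log_pos hv0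
      refine (Real.log_le_log j4 j1).trans ?_
      rw [Real.log_mul (by positivity) (by positivity), Real.log_pow, hdL, Real.log_mul (by norm_num) (by positivity), Real.log_exp]
      push_cast
      have := abs_nonneg X
      linarith
    have h4 : 0 < Real.exp (y0/2) := Real.exp_pos _
    have h5 : 0 < Real.exp (v/2) := Real.exp_pos _
    calc 1/128 * Real.exp (v/2) * Real.log (Real.log v) ≤ 1/128 * Real.exp (v/2) * (8 * L) := by gcongr
      _ ≤ 1/128 * (2 * Real.exp (y0/2)) * (8 * L) := by gcongr
      _ = Real.exp (y0/2) * (L/8) := by ring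
      _ ≤ Real.exp (y0/2) * ((L/2 - C1)/2) := by gcongr
      _ = _ := by ring
  have hkabs1 := le_abs_self k
  have hkabs2 := neg_abs_le k
  have hb0 := abs_le.1 (hy 0)
  rw [add_zero] at hb0
  constructor
  · have h1 := explicit1 hRH (u := y0) (by linarith)
    have h2 := explicit1 hRH (u := y0 + 2*d) (by linarith)
    have h3 := abs_le.1 (hy (2*d))
    have h4 := hh_diff (u := y0 + 2*d) (v := y0) (by linarith) (by linarith)
    rw [← hH, show y0 + 2*d - y0 = 2*d by ring, abs_of_pos (by positivity : 0 < 2*d)] at h4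
    have h4 := (abs_le.1 h4).2
    have e1 : Real.exp ((y0 + 2*d)/2) = Real.exp (y0/2) * Real.exp d := by rw [← Real.exp_add]; ring_nf
    rw [e1] at h2
    have k1 : Real.exp d * GG (y0 + 2*d) - GG y0 ≥ d/2 * L - 2 * |k| * d - 3 * W * d := by
      have : Real.exp d * (GG (y0 + 2*d) - GG (2*d)) ≥ -(2 * W * d) := by
        have j : 0 < Real.exp d := Real.exp_pos d
        have j2 : Real.exp d * (W * d) ≤ 2 * (W * d) := by gcongr; linarith
        have j3 := mul_le_mul_of_nonneg_left h3.1 j.le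
        linarith
      linarith
    have k2 : EE (y0 + 2*d) - EE y0 ≤ -(Real.exp (y0/2) * (L/2 - C1) / 2) * (y0 + 2*d - y0) := by
      have : EE (y0 + 2*d) - EE y0 = -(Real.exp (y0/2) * (Real.exp d * GG (y0 + 2*d) - GG y0)) + k * (2*d) + (hh (y0 + 2*d) - hh y0) := by
        rw [h1, h2, hk]; ring
      rw [this]
      have j1 := mul_le_mul_of_nonneg_left k1.le (by linarith : 0 ≤ Real.exp (y0/2))
      have j2 : 0 ≤ Real.exp (y0/2) * (7 * S * d) := by positivity
      have j3 : 2 * |k| * d + 2 * H * d ≤ Real.exp (y0/2) * (2 * |k| * d + 2 * H * d) := le_mul_of_one_le_left (by positivity) hey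
      have j4 : k * (2*d) ≤ 2 * |k| * d := by
        have := mul_le_mul_of_nonneg_right hkabs1 (by linarith : 0 ≤ 2 * d)
        linarith
      have j5 : Real.exp (y0/2) * C1 * d = Real.exp (y0/2) * (4 * |k| + 3 * W + 2 * H + 7 * S) * d := by rw [hC1]
      linarith
    obtain ⟨v, hv, hv2⟩ := ee_exists_le (by linarith) k2
    obtain ⟨f1, f2⟩ := hfin v (by linarith [hv.1]) hv.2
    exact ⟨v, f1, by linarith⟩
  · have h1 := explicit1 hRH (u := y0) (by linarith)
    have h2 := explicit1 hRH (u := y0 - 2*d) (by linarith)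
    have h3 := abs_le.1 (hy (-(2*d)))
    rw [← sub_eq_add_neg] at h3
    have h4 := hh_diff (u := y0) (v := y0 - 2*d) (by linarith) (by linarith)
    rw [← hH, show y0 - (y0 - 2*d) = 2*d by ring, abs_of_pos (by positivity : 0 < 2*d)] at h4
    have h4 := (abs_le.1 h4).1
    have h5 := GG_sym hRH (2*d)
    rw [← hS, abs_of_pos (by positivity : 0 < 2*d)] at h5
    have h5 := abs_le.1 h5
    have h6 := GG_bd hRH (2*d)
    rw [← hS] at h6
    have h6 := abs_le.1 h6
    have e1 : Real.exp ((y0 - 2*d)/2) = Real.exp (y0/2) * Real.exp (-d) := by rw [← Real.exp_add]; ring_nf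
    rw [e1] at h2
    have hed3 : Real.exp (-d) ≤ 1 := Real.exp_le_one_iff.2 (by linarith)
    have k1 : GG y0 - Real.exp (-d) * GG (y0 - 2*d) ≤ -(d/2 * L - 2 * |k| * d - 2 * W * d - 7 * S * d) := by
      have i1 : Real.exp (-d) * (GG (2*d) - GG (y0 - 2*d)) ≤ W * d + 4 * S * d := by
        have j : 0 ≤ W * d + 4 * S * d := by positivity
        have j2 : GG (2*d) - GG (y0 - 2*d) ≤ W * d + 4 * S * d := by linarith
        have j3 := mul_le_mul_of_nonneg_left j2 (Real.exp_pos (-d)).le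
        have j4 := mul_le_mul_of_nonneg_right hed3 j
        linarith
      have i2 : (Real.exp d - Real.exp (-d)) * GG (2*d) ≤ 3 * d * S := by
        have j0 : 0 ≤ Real.exp d - Real.exp (-d) := by linarith
        calc _ ≤ (Real.exp d - Real.exp (-d)) * S := by gcongr; exact h6.2
          _ ≤ _ := by gcongr; linarith
      linarith
    have k2 : (Real.exp (y0/2) * (L/2 - C1) / 2) * (y0 - (y0 - 2*d)) ≤ EE y0 - EE (y0 - 2*d) := by
      have : EE y0 - EE (y0 - 2*d) = -(Real.exp (y0/2) * (GG y0 - Real.exp (-d) * GG (y0 - 2*d))) + k * (2*d) + (hh y0 - hh (y0 - 2*d)) := by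
        rw [h1, h2, hk]; ring
      rw [this]
      have j1 := mul_le_mul_of_nonneg_left k1 (by linarith : 0 ≤ Real.exp (y0/2))
      have j2 : 0 ≤ Real.exp (y0/2) * (W * d) := by positivity
      have j3 : 2 * |k| * d + 2 * H * d ≤ Real.exp (y0/2) * (2 * |k| * d + 2 * H * d) := le_mul_of_one_le_left (by positivity) hey
      have j4 : -(2 * |k| * d) ≤ k * (2*d) := by
        have := mul_le_mul_of_nonneg_right hkabs2 (by linarith : 0 ≤ 2 * d)
        linarith
      have j5 : Real.exp (y0/2) * C1 * d = Real.exp (y0/2) * (4 * |k| + 3 * W + 2 * H + 7 * S) * d := by rw [hC1]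
      linarith
    obtain ⟨v, hv, hv2⟩ := ee_exists_ge (by linarith) k2
    obtain ⟨f1, f2⟩ := hfin v hv.1 (by linarith [hv.2])
    exact ⟨v, f1, by linarith⟩
end LW

namespace LW

/-- Comparison function. -/
noncomputable def F2 (t : ℝ) : ℝ := Real.sqrt t / Real.log t + 40 * Real.log t

lemma F2_deriv {t : ℝ} (ht : 2 ≤ t) : ∃ D, HasDerivAt F2 D t ∧ 1 / (Real.sqrt t * Real.log t ^ 2) ≤ D := by
  have hl : 0.69 < Real.log t := by
    have h1 := Real.log_two_gt_d9
    have h2 := Real.log_le_log (by norm_num) ht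
    linarith
  have ht0 : t ≠ 0 := by linarith
  have h1 := ((Real.hasDerivAt_sqrt ht0).div (Real.hasDerivAt_log ht0) (by linarith)).add ((Real.hasDerivAt_log ht0).const_mul 40)
  refine ⟨_, h1, ?_⟩
  set L := Real.log t with hL
  set s := Real.sqrt t with hs
  have hs0 : 0 < s := Real.sqrt_pos.2 (by linarith)
  have hts : t = s^2 := (Real.sq_sqrt (by linarith)).symm
  rw [hts]
  have hL0 : 0 < L := by linarith
  have e : (1 / (2 * s) * L - s * (s^2)⁻¹) / L^2 + 40 * (s^2)⁻¹ - 1 / (s * L^2) = (s * (L/2 - 2) + 40 * L^2) / (s^2 * L^2) := by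
    field_simp; ring
  have : 0 ≤ (s * (L/2 - 2) + 40 * L^2) / (s^2 * L^2) := by
    apply div_nonneg _ (by positivity)
    rcases le_total 4 L with h | h
    · have : 0 ≤ s * (L/2 - 2) := mul_nonneg hs0.le (by linarith)
      positivity
    · have : s < 8 := by
        rw [hs, Real.sqrt_lt' (by norm_num)]
        have : t = Real.exp L := (Real.exp_log (by linarith)).symm
        rw [this]
        calc Real.exp L ≤ Real.exp 4 := Real.exp_le_exp.2 h
          _ = Real.exp 1 ^ 4 := by rw [← Real.exp_nat_mul]; norm_num
          _ < 2.7182818286 ^ 4 := by gcongr; exact Real.exp_one_lt_d9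
          _ < 8^2 := by norm_num
      nlinarith
  linarith

lemma F2_deriv2 : ∀ t : ℝ, 2 ≤ t → ∃ D, HasDerivAt F2 D t ∧ 1 / (Real.sqrt t * Real.log t ^ 2) ≤ D := fun _ ht => F2_deriv ht

lemma log_sq_le {x : ℝ} (hx : 2 ≤ x) : Real.log x ≤ 16 * (Real.sqrt x / Real.log x) := by
  have hl : 0 < Real.log x := Real.log_pos (by linarith)
  rw [← mul_div_assoc, le_div_iff₀ hl]
  have h1 : Real.log x = 4 * Real.log (Real.sqrt (Real.sqrt x)) := by
    rw [Real.log_sqrt (Real.sqrt_nonneg _), Real.log_sqrt (by linarith)]; ring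
  have h2 : Real.log (Real.sqrt (Real.sqrt x)) ≤ Real.sqrt (Real.sqrt x) := Real.log_le_self (Real.sqrt_nonneg _)
  have h3 : Real.sqrt (Real.sqrt x) * Real.sqrt (Real.sqrt x) = Real.sqrt x := Real.mul_self_sqrt (Real.sqrt_nonneg _)
  nlinarith

lemma pi_li (hRH : ∀ ρ : ℂ, xi ρ = 0 → ρ.re = 1/2) : ∃ C : ℝ, 0 < C ∧ ∀ x, 2 ≤ x →
    |primePi x - li x - (Chebyshev.psi x - x) / Real.log x| ≤ C * (Real.sqrt x / Real.log x) := by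
  obtain ⟨C0, hC0, hE⟩ := EE_bd hRH
  obtain ⟨C2', hC2'⟩ := Chebyshev.psi_sub_theta_le_mul_sqrt
  set C2 := |C2'| with hC2
  have hC20 : 0 ≤ C2 := abs_nonneg _
  have hr : ∀ t, Chebyshev.psi t - Chebyshev.theta t ≤ C2 * Real.sqrt t := fun t =>
    (hC2' t).trans (mul_le_mul_of_nonneg_right (le_abs_self _) (Real.sqrt_nonneg _))
  set Φ : ℝ → ℝ := fun t => EE (Real.log t) / Real.log t ^ 2 - t / Real.log t with hΦ
  set C3 := C2 + 4 * C0 with hC3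
  have hC30 : 0 ≤ C3 := by positivity
  have hlt : ∀ t : ℝ, 2 ≤ t → 0.69 < Real.log t := by
    intro t ht
    have h1 := Real.log_two_gt_d9
    have h2 := Real.log_le_log (by norm_num) ht
    linarith
  have hEt : ∀ t : ℝ, 2 ≤ t → |EE (Real.log t)| ≤ C0 * Real.sqrt t := by
    intro t ht
    have := hE (Real.log t) (by linarith [hlt t ht])
    rwa [show Real.exp (Real.log t / 2) = Real.sqrt t by
      rw [Real.exp_half, Real.exp_log (by linarith)]] at this
  set f : ℝ → ℝ := fun t => Chebyshev.theta t / (t * Real.log t ^ 2) - 1 / Real.log t with hf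
  have hΦd : ∀ t, 2 ≤ t → ∃ D, HasDerivWithinAt Φ D (Set.Ioi t) t ∧ |f t - D| ≤ C3 * (1 / (Real.sqrt t * Real.log t ^ 2)) := by
    intro t ht
    have hl := hlt t ht
    have ht0 : t ≠ 0 := by linarith
    have hL0 : Real.log t ≠ 0 := by linarith
    have d0 := Real.hasDerivAt_log ht0
    have d1 : HasDerivWithinAt (fun t => EE (Real.log t)) (ee (Real.log t) * t⁻¹) (Set.Ioi t) t := by
      refine HasDerivWithinAt.comp t (h₂ := EE) (h := Real.log) (s' := Set.Ioi (Real.log t)) (EE_deriv _) d0.hasDerivWithinAt ?_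
      intro y hy
      exact Real.log_lt_log (by linarith) hy
    have d2 := (d1.div (d0.pow 2).hasDerivWithinAt (pow_ne_zero 2 hL0)).sub (((hasDerivAt_id t).div d0 hL0).hasDerivWithinAt)
    refine ⟨_, d2, ?_⟩
    have hee : ee (Real.log t) = Chebyshev.psi t - t := by rw [ee, Real.exp_log (by linarith)]
    rw [hee]
    have hts : Real.sqrt t ^ 2 = t := Real.sq_sqrt (by linarith)
    have hs0 : 0 < Real.sqrt t := Real.sqrt_pos.2 (by linarith)
    have e : f t - (((Chebyshev.psi t - t) * t⁻¹ * Real.log t ^ 2 - EE (Real.log t) * (((2:ℕ):ℝ) * Real.log t ^ (2-1) * t⁻¹)) / (Real.log t ^ 2) ^ 2 - (1 * Real.log t - t * t⁻¹) / Real.log t ^ 2) =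
       (-(Chebyshev.psi t - Chebyshev.theta t) + 2 * EE (Real.log t) / Real.log t) / (t * Real.log t ^ 2) := by
      rw [hf]; simp only; field_simp; norm_num; ring
    simp only [id, Pi.pow_apply]
    rw [e, abs_div, abs_of_pos (by positivity : 0 < t * Real.log t ^ 2)]
    have h1 : |-(Chebyshev.psi t - Chebyshev.theta t) + 2 * EE (Real.log t) / Real.log t| ≤ C3 * Real.sqrt t := by
      refine (abs_add_le _ _).trans ?_
      rw [abs_neg, abs_of_nonneg (by linarith [Chebyshev.theta_le_psi t]), abs_div, abs_mul, abs_of_pos (by norm_num : (0:ℝ) < 2), abs_of_pos (by linarith : 0 < Real.log t)]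
      have : 2 * |EE (Real.log t)| / Real.log t ≤ 4 * C0 * Real.sqrt t := by
        rw [div_le_iff₀ (by linarith)]
        have := hEt t ht
        have : 0 ≤ C0 * Real.sqrt t := by positivity
        nlinarith
      linarith [hr t]
    rw [div_le_iff₀ (by positivity)]
    calc _ ≤ C3 * Real.sqrt t := h1
      _ = C3 * (1 / (Real.sqrt t * Real.log t ^ 2)) * (Real.sqrt t ^ 2 * Real.log t ^ 2) := by field_simp
      _ = _ := by rw [hts]
  have hΦc : ContinuousOn Φ (Set.Ici 2) := by
    have hlc : ContinuousOn Real.log (Set.Ici 2) := Real.continuousOn_log.mono (fun t ht => by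
      have : (2:ℝ) ≤ t := ht
      simp; linarith)
    have hl0 : ∀ t ∈ Set.Ici (2:ℝ), Real.log t ≠ 0 := fun t ht => by linarith [hlt t ht]
    exact ((EE_cont.comp_continuousOn hlc).div (hlc.pow 2) (fun t ht => pow_ne_zero 2 (hl0 t ht))).sub (continuousOn_id.div hlc hl0)
  have hFc : ContinuousOn F2 (Set.Ici 2) := fun t ht => by
    obtain ⟨D, hD, -⟩ := F2_deriv ht
    exact hD.continuousAt.continuousWithinAt
  have hFpos : ∀ t, 2 ≤ t → 0 ≤ F2 t := fun t ht => by
    have := hlt t ht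
    have : 0 < Real.log t := by linarith
    rw [F2]; positivity
  refine ⟨C2 + 2 * C0 + |Φ 2| * 64 + C3 * 641, by positivity, fun x hx => ?_⟩
  have hi1 : MeasureTheory.IntegrableOn (fun t => Chebyshev.theta t / (t * Real.log t ^ 2)) (Set.Icc 2 x) :=
    Chebyshev.integrableOn_theta_div_id_mul_log_sq x
  have hi2 : MeasureTheory.IntegrableOn (fun t => 1 / Real.log t) (Set.Icc 2 x) := by
    apply ContinuousOn.integrableOn_Icc
    apply continuousOn_const.div
    · exact Real.continuousOn_log.mono (fun t ht => by
        have : (2:ℝ) ≤ t := ht.1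
        simp; linarith)
    · intro t ht; linarith [hlt t ht.1]
  have hi : MeasureTheory.IntegrableOn f (Set.Icc 2 x) := hi1.sub hi2
  have hmono : Set.Icc 2 x ⊆ Set.Ici 2 := fun t ht => ht.1
  have up : ∫ t in (2:ℝ)..x, f t ≤ (Φ x + C3 * F2 x) - (Φ 2 + C3 * F2 2) := by
    choose! D hD1 hD2 using hΦd
    choose! D' hD1' hD2' using F2_deriv2
    refine intervalIntegral.integral_le_sub_of_hasDeriv_right_of_le hx (g := fun t => Φ t + C3 * F2 t) (g' := fun t => D t + C3 * D' t)
      ((hΦc.add (continuousOn_const.mul hFc)).mono hmono) (fun t ht => (hD1 t ht.1.le).add ((hD1' t ht.1.le).hasDerivWithinAt.const_mul C3)) hi ?_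
    intro t ht
    have h1 := (abs_le.1 (hD2 t ht.1.le)).2
    have h2 := mul_le_mul_of_nonneg_left (hD2' t ht.1.le) hC30
    linarith
  have lo : (Φ x - C3 * F2 x) - (Φ 2 - C3 * F2 2) ≤ ∫ t in (2:ℝ)..x, f t := by
    choose! D hD1 hD2 using hΦd
    choose! D' hD1' hD2' using F2_deriv2
    refine intervalIntegral.sub_le_integral_of_hasDeriv_right_of_le hx (g := fun t => Φ t - C3 * F2 t) (g' := fun t => D t - C3 * D' t)
      ((hΦc.sub (continuousOn_const.mul hFc)).mono hmono) (fun t ht => (hD1 t ht.1.le).sub ((hD1' t ht.1.le).hasDerivWithinAt.const_mul C3)) hi ?_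
    intro t ht
    have h1 := (abs_le.1 (hD2 t ht.1.le)).1
    have h2 := mul_le_mul_of_nonneg_left (hD2' t ht.1.le) hC30
    linarith
  have hpi : primePi x - li x = Chebyshev.theta x / Real.log x + ∫ t in (2:ℝ)..x, f t := by
    have h1 := Chebyshev.primeCounting_eq_theta_div_log_add_integral hx
    have h2 : primePi x = (Nat.primeCounting ⌊x⌋₊ : ℝ) := by
      rw [primePi, Nat.primeCounting, Nat.primeCounting', Nat.count_eq_card_filter_range]
      congr 3
      ext n; simp
    rw [h2, h1, li, hf, intervalIntegral.integral_sub]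
    · ring
    · exact (intervalIntegrable_iff_integrableOn_Icc_of_le hx).2 hi1
    · exact (intervalIntegrable_iff_integrableOn_Icc_of_le hx).2 hi2
  have hl := hlt x hx
  have hl0 : 0 < Real.log x := by linarith
  set Q := Real.sqrt x / Real.log x with hQ
  have hQ0 : 0 ≤ Q := by positivity
  have hQl := log_sq_le hx
  rw [← hQ] at hQl
  have hF2x : F2 x ≤ 641 * Q := by
    rw [F2, ← hQ]; linarith
  have hF22 := hFpos 2 le_rfl
  have hF2xp := hFpos x hx
  have hθ : |(Chebyshev.theta x - Chebyshev.psi x) / Real.log x| ≤ C2 * Q := by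
    rw [abs_div, abs_of_pos hl0, abs_sub_comm, abs_of_nonneg (by linarith [Chebyshev.theta_le_psi x]), hQ, ← mul_div_assoc]
    gcongr
    exact hr x
  have hΦx : |EE (Real.log x) / Real.log x ^ 2| ≤ 2 * C0 * Q := by
    rw [abs_div, abs_of_pos (by positivity : 0 < Real.log x ^ 2), div_le_iff₀ (by positivity)]
    refine (hEt x hx).trans ?_
    have : 2 * C0 * Q * Real.log x ^ 2 = C0 * Real.sqrt x * (2 * Real.log x) := by rw [hQ]; field_simp
    rw [this]
    exact le_mul_of_one_le_right (by positivity) (by linarith)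
  have e : primePi x - li x - (Chebyshev.psi x - x) / Real.log x = (Chebyshev.theta x - Chebyshev.psi x) / Real.log x + EE (Real.log x) / Real.log x ^ 2 + ((∫ t in (2:ℝ)..x, f t) - Φ x) := by
    rw [hpi, hΦ]; simp only; ring
  rw [e]
  have hint : |(∫ t in (2:ℝ)..x, f t) - Φ x| ≤ |Φ 2| + C3 * F2 x := by
    have h1 := abs_le.1 (le_refl |Φ 2|)
    have h2 : 0 ≤ C3 * F2 2 := by positivity
    rw [abs_le]; constructor <;> linarith
  have h3 : |Φ 2| ≤ |Φ 2| * (64 * Q) := le_mul_of_one_le_right (abs_nonneg _) (by linarith)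
  have h4 : C3 * F2 x ≤ C3 * (641 * Q) := by gcongr
  refine (abs_add_le _ _).trans ?_
  have := abs_add_le ((Chebyshev.theta x - Chebyshev.psi x) / Real.log x) (EE (Real.log x) / Real.log x ^ 2)
  linarith

lemma rh_case (hRH : ∀ ρ : ℂ, xi ρ = 0 → ρ.re = 1/2) : ∃ c : ℝ, 0 < c ∧ ∀ X : ℝ,
    (∃ x ≥ X, primePi x - li x > c * x ^ ((1:ℝ)/2) * Real.log (Real.log (Real.log x)) / Real.log x) ∧
    (∃ x ≥ X, primePi x - li x < -(c * x ^ ((1:ℝ)/2) * Real.log (Real.log (Real.log x)) / Real.log x)) := by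
  obtain ⟨c, hc, hosc⟩ := psi_osc hRH
  obtain ⟨C, hC, hpl⟩ := pi_li hRH
  refine ⟨c/2, by positivity, fun X => ?_⟩
  set V := |X| + Real.exp (Real.exp (4 * C / c)) + 1 with hV
  have key : ∀ v, V ≤ v → X ≤ Real.exp v ∧ 2 ≤ Real.exp v ∧ 0 < v ∧ C < c/2 * Real.log (Real.log v) := by
    intro v hv
    have h1 := Real.add_one_le_exp v
    have h2 := le_abs_self X
    have h3 := abs_nonneg X
    have h4 := Real.exp_pos (Real.exp (4 * C / c))
    refine ⟨by linarith, by linarith, by linarith, ?_⟩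
    have h5 : Real.exp (4 * C / c) ≤ Real.log v := by
      rw [Real.le_log_iff_exp_le (by linarith)]; linarith
    have h6 : 4 * C / c ≤ Real.log (Real.log v) := by
      rw [Real.le_log_iff_exp_le (lt_of_lt_of_le (Real.exp_pos _) h5)]; linarith
    rw [div_le_iff₀ hc] at h6
    linarith
  have hx : ∀ v : ℝ, (Real.exp v) ^ ((1:ℝ)/2) = Real.exp (v/2) := by
    intro v; rw [← Real.exp_mul]; ring_nf
  have hx' : ∀ v : ℝ, Real.sqrt (Real.exp v) = Real.exp (v/2) := fun v => (Real.exp_half v).symm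
  constructor
  · obtain ⟨v, hv, h⟩ := (hosc V).2
    obtain ⟨k1, k2, k3, k4⟩ := key v hv
    refine ⟨Real.exp v, k1, ?_⟩
    have h1 := (abs_le.1 (hpl _ k2)).1
    rw [hx', Real.log_exp] at h1
    rw [hx, Real.log_exp, gt_iff_lt]
    have h2 : c * Real.exp (v/2) * Real.log (Real.log v) / v ≤ (Chebyshev.psi (Real.exp v) - Real.exp v) / v := by
      gcongr; exact h
    have h3 : C * (Real.exp (v/2) / v) < c/2 * Real.log (Real.log v) * (Real.exp (v/2) / v) := by
      have : 0 < Real.exp (v/2) / v := by positivity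
      gcongr
    have h4 : c * Real.exp (v/2) * Real.log (Real.log v) / v = c/2 * Real.exp (v/2) * Real.log (Real.log v) / v + c/2 * Real.log (Real.log v) * (Real.exp (v/2) / v) := by ring
    linarith
  · obtain ⟨v, hv, h⟩ := (hosc V).1
    obtain ⟨k1, k2, k3, k4⟩ := key v hv
    refine ⟨Real.exp v, k1, ?_⟩
    have h1 := (abs_le.1 (hpl _ k2)).2
    rw [hx', Real.log_exp] at h1
    rw [hx, Real.log_exp]
    have h2 : (Chebyshev.psi (Real.exp v) - Real.exp v) / v ≤ -(c * Real.exp (v/2) * Real.log (Real.log v)) / v := by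
      gcongr; exact h
    have h3 : C * (Real.exp (v/2) / v) < c/2 * Real.log (Real.log v) * (Real.exp (v/2) / v) := by
      have : 0 < Real.exp (v/2) / v := by positivity
      gcongr
    have h4 : -(c * Real.exp (v/2) * Real.log (Real.log v)) / v = -(c/2 * Real.exp (v/2) * Real.log (Real.log v) / v) - c/2 * Real.log (Real.log v) * (Real.exp (v/2) / v) := by ring
    linarith
end LW

namespace LW
open MeasureTheory ProbabilityTheory

lemma landau {Ω : Type*} {m : MeasurableSpace Ω} {X : Ω → ℝ} {μ : Measure Ω} (hX : ∀ᵐ ω ∂μ, 0 ≤ X ω)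
    {b r : ℝ} (hr : 0 < r) (hS : ∀ t < b, t ∈ integrableExpSet X μ) (Φ : ℂ → ℂ)
    (hΦ : DifferentiableOn ℂ Φ (Metric.ball (b:ℂ) r))
    (heq : ∀ z ∈ Metric.ball (b:ℂ) r, z.re < b → Φ z = complexMGF X μ z) :
    ∃ b' > b, b' ∈ integrableExpSet X μ := by
  set c : ℝ := b - r/4 with hc
  have hint : ∀ t < b, t ∈ interior (integrableExpSet X μ) := fun t ht =>
    mem_interior.2 ⟨Set.Iio b, fun t ht => hS t ht, isOpen_Iio, ht⟩
  have hcb : c < b := by rw [hc]; linarith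
  refine ⟨c + r/2, by rw [hc]; linarith, ?_⟩
  have hXm : AEMeasurable X μ := aemeasurable_of_integrable_exp_mul (u := b-1) (v := b-2) (by intro h; linarith) (hS _ (by linarith)) (hS _ (by linarith))
  have hsub : Metric.ball (c:ℂ) (3*r/4) ⊆ Metric.ball (b:ℂ) r := by
    apply Metric.ball_subset_ball'
    rw [Complex.dist_of_im_eq (by simp)]
    simp only [Complex.ofReal_re, Real.dist_eq, hc]
    rw [show b - r/4 - b = -(r/4) by ring, abs_neg, abs_of_pos (by linarith)]; linarith
  have hz : ((c + r/2 : ℝ):ℂ) ∈ Metric.ball (c:ℂ) (3*r/4) := by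
    rw [Metric.mem_ball, Complex.dist_of_im_eq (by simp)]
    simp only [Complex.ofReal_re, Real.dist_eq]
    rw [show c + r/2 - c = r/2 by ring, abs_of_pos (by linarith)]; linarith
  have hT := Complex.hasSum_taylorSeries_on_ball (hΦ.mono hsub) hz
  have hev : Φ =ᶠ[nhds (c:ℂ)] complexMGF X μ := by
    have h1 : Metric.ball (b:ℂ) r ∈ nhds (c:ℂ) := Metric.isOpen_ball.mem_nhds (hsub (Metric.mem_ball_self (by linarith)))
    have h2 : {z : ℂ | z.re < b} ∈ nhds (c:ℂ) := (isOpen_lt Complex.continuous_re continuous_const).mem_nhds (by simpa using hcb)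
    filter_upwards [h1, h2] with z hz1 hz2 using heq z hz1 hz2
  set f : ℕ → Ω → ℝ := fun k ω => (r/2)^k / (k.factorial:ℝ) * (X ω ^ k * Real.exp (c * X ω)) with hf
  have hit : ∀ k, iteratedDeriv k Φ (c:ℂ) = ((∫ ω, X ω ^ k * Real.exp (c * X ω) ∂μ : ℝ) : ℂ) := by
    intro k
    rw [hev.iteratedDeriv_eq k, iteratedDeriv_complexMGF (by simpa using hint c hcb), ← integral_complex_ofReal]
    congr 1; ext ω; push_cast; rfl
  have hfi : ∀ k, Integrable (f k) μ := by
    intro k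
    apply Integrable.const_mul
    exact integrable_pow_mul_exp_of_integrable_exp_mul (t := r/8) (by positivity) (hS _ (by rw [hc]; linarith)) (hS _ (by rw [hc]; linarith)) k
  have hf0 : ∀ k, 0 ≤ᵐ[μ] f k := by
    intro k; filter_upwards [hX] with ω hω
    simp only [hf, Pi.zero_apply]; positivity
  have hsum : Summable fun k => ∫ ω, f k ω ∂μ := by
    have := Complex.hasSum_re hT.summable.hasSum
    refine this.summable.congr fun k => ?_
    rw [hit, hf]
    simp only [integral_const_mul, smul_eq_mul]
    rw [show ((c + r/2 : ℝ):ℂ) - (c:ℂ) = ((r/2 : ℝ) : ℂ) by push_cast; ring]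
    rw [← Complex.ofReal_natCast, ← Complex.ofReal_inv, ← Complex.ofReal_pow, ← Complex.ofReal_mul, ← Complex.ofReal_mul, Complex.ofReal_re]
    ring
  have hexp : ∀ ω, HasSum (fun k => f k ω) (Real.exp ((c + r/2) * X ω)) := by
    intro ω
    have := (NormedSpace.expSeries_div_hasSum_exp (r/2 * X ω)).mul_right (Real.exp (c * X ω))
    rw [← Real.exp_eq_exp_ℝ, ← Real.exp_add] at this
    rw [show (c + r/2) * X ω = r/2 * X ω + c * X ω by ring]
    refine this.congr_fun fun k => ?_
    simp only [hf]; rw [mul_pow]; ring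
  refine ⟨by fun_prop, ?_⟩
  rw [hasFiniteIntegral_iff_ofReal (Eventually.of_forall fun ω => (Real.exp_pos _).le)]
  have h1 : ∫⁻ ω, ENNReal.ofReal (Real.exp ((c + r/2) * X ω)) ∂μ = ∫⁻ ω, ∑' k, ENNReal.ofReal (f k ω) ∂μ := by
    apply lintegral_congr_ae
    filter_upwards [ae_all_iff.2 hf0] with ω hω
    rw [← (hexp ω).tsum_eq, ENNReal.ofReal_tsum_of_nonneg hω (hexp ω).summable]
  rw [h1, lintegral_tsum fun k => (hfi k).aemeasurable.ennreal_ofReal]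
  have h2 : ∀ k, ∫⁻ ω, ENNReal.ofReal (f k ω) ∂μ = ENNReal.ofReal (∫ ω, f k ω ∂μ) := fun k =>
    (ofReal_integral_eq_lintegral_ofReal (hfi k) (hf0 k)).symm
  simp_rw [h2]
  rw [← ENNReal.ofReal_tsum_of_nonneg (fun k => integral_nonneg_of_ae (hf0 k)) hsum]
  exact ENNReal.ofReal_lt_top

end LW

namespace LW
open MeasureTheory ProbabilityTheory

/-- The measure `g(t) dt / t` on `(1,∞)`. -/
noncomputable def mug (g : ℝ → ℝ) : Measure ℝ :=
  (volume.restrict (Set.Ioi 1)).withDensity (fun t => ENNReal.ofReal (g t / t))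

lemma mug_nonneg (g : ℝ → ℝ) : ∀ᵐ t ∂(mug g), 0 ≤ Real.log t := by
  have h : mug g ≪ volume.restrict (Set.Ioi 1) := withDensity_absolutelyContinuous _ _
  apply h
  filter_upwards [self_mem_ae_restrict measurableSet_Ioi] with t ht
  exact Real.log_nonneg (le_of_lt ht)

lemma mgf_int {g : ℝ → ℝ} (hg : Measurable g) (h0 : ∀ t, 1 < t → 0 ≤ g t) (s : ℂ) :
    complexMGF Real.log (mug g) (-s) = ∫ t in Set.Ioi (1:ℝ), (g t : ℂ) * (t:ℂ) ^ (-(s+1)) := by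
  rw [complexMGF, mug, integral_withDensity_eq_integral_toReal_smul (by fun_prop) (by simp)]
  apply setIntegral_congr_fun measurableSet_Ioi
  intro t ht
  have ht' : 1 < t := ht
  have ht0 : 0 < t := by linarith
  have hne : (t:ℂ) ≠ 0 := by exact_mod_cast ht0.ne'
  simp only
  rw [ENNReal.toReal_ofReal (div_nonneg (h0 t ht') ht0.le), Complex.real_smul, neg_add, Complex.cpow_add _ _ hne,
    Complex.cpow_neg_one, Complex.cpow_def_of_ne_zero hne, Complex.ofReal_log ht0.le, Complex.ofReal_div]
  rw [mul_comm (-s)]; ring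

lemma mgf_mem {g : ℝ → ℝ} (hg : Measurable g) (h0 : ∀ t, 1 < t → 0 ≤ g t) {C a : ℝ}
    (hb : ∀ t, 1 < t → g t ≤ C * t ^ a) {σ : ℝ} (hσ : a < σ) : -σ ∈ integrableExpSet Real.log (mug g) := by
  rw [integrableExpSet, Set.mem_ofPred_eq, mug, integrable_withDensity_iff (by fun_prop) (by simp)]
  have h1 : IntegrableOn (fun t : ℝ => C * t ^ (a - σ - 1)) (Set.Ioi 1) :=
    (integrableOn_Ioi_rpow_of_lt (by linarith) one_pos).const_mul C
  refine Integrable.mono' h1 (by fun_prop) ?_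
  filter_upwards [self_mem_ae_restrict measurableSet_Ioi] with t ht
  have ht' : 1 < t := ht
  have ht0 : 0 < t := by linarith
  have hq := div_nonneg (h0 t ht') ht0.le
  rw [ENNReal.toReal_ofReal hq, Real.norm_of_nonneg (by positivity)]
  have e1 : Real.exp (-σ * Real.log t) = t ^ (-σ) := by rw [Real.rpow_def_of_pos ht0]; ring_nf
  have e2 : t ^ (a - σ - 1) = t ^ a * t ^ (-σ) * t⁻¹ := by
    rw [← Real.rpow_neg_one, ← Real.rpow_add ht0, ← Real.rpow_add ht0]; ring_nf
  rw [e1, e2]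
  have := mul_le_mul_of_nonneg_right (hb t ht') (mul_nonneg (Real.rpow_nonneg ht0.le (-σ)) (inv_nonneg.2 ht0.le))
  calc _ = g t * (t ^ (-σ) * t⁻¹) := by ring
    _ ≤ _ := this
    _ = _ := by ring

/-- `(s-1) ζ(s)`, an entire function. -/
noncomputable def Zf : ℂ → ℂ := Function.update (fun s => (s - 1) * riemannZeta s) 1 1

lemma Zf_ne {s : ℂ} (hs : s ≠ 1) : Zf s = (s - 1) * riemannZeta s := by
  rw [Zf, Function.update_of_ne hs]

lemma Zf_one : Zf 1 = 1 := by simp [Zf]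

lemma Zf_diff : Differentiable ℂ Zf := by
  rw [← differentiableOn_univ]
  refine (Complex.differentiableOn_compl_singleton_and_continuousAt_iff (c := 1) univ_mem).1 ⟨?_, ?_⟩
  · intro s hs
    have hs' : s ≠ 1 := by simpa using hs
    have : DifferentiableAt ℂ (fun s => (s - 1) * riemannZeta s) s :=
      (by fun_prop : DifferentiableAt ℂ (fun s : ℂ => s - 1) s).mul (differentiableAt_riemannZeta hs')
    refine (this.congr_of_eventuallyEq ?_).differentiableWithinAt
    filter_upwards [isOpen_ne.mem_nhds hs'] with z hz using Zf_ne hz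
  · rw [Zf, continuousAt_update_same]; exact riemannZeta_residue_one

lemma hp_preconn (a : ℝ) : IsPreconnected {s : ℂ | a < s.re} := (convex_halfSpace_re_gt a).isPreconnected

lemma hp_open (a : ℝ) : IsOpen {s : ℂ | a < s.re} := isOpen_lt continuous_const Complex.continuous_re

/-- Identity theorem on half planes. -/
lemma hp_ident {f g : ℂ → ℂ} {a : ℝ} (hf : DifferentiableOn ℂ f {s | a < s.re}) (hg : DifferentiableOn ℂ g {s | a < s.re})
    (h : ∀ s : ℂ, 1 < s.re → a < s.re → f s = g s) : ∀ s : ℂ, a < s.re → f s = g s := by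
  set z : ℂ := ((max a 1 + 1 : ℝ) : ℂ)
  have hza : a < z.re := by simp only [z, Complex.ofReal_re]; linarith [le_max_left a 1]
  have hz1 : 1 < z.re := by simp only [z, Complex.ofReal_re]; linarith [le_max_right a 1]
  have := (hf.analyticOnNhd (hp_open a)).eqOn_of_preconnected_of_eventuallyEq (hg.analyticOnNhd (hp_open a)) (hp_preconn a) hza (by
    filter_upwards [(hp_open a).mem_nhds hza, (hp_open 1).mem_nhds hz1] with s h1 h2 using h s h2 h1)
  exact fun s hs => this hs

lemma mgf_diffOn {g : ℝ → ℝ} {a : ℝ} (h : ∀ σ, a < σ → -σ ∈ integrableExpSet Real.log (mug g)) :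
    DifferentiableOn ℂ (fun s => complexMGF Real.log (mug g) (-s)) {s | a < s.re} := by
  have := differentiableOn_complexMGF (X := Real.log) (μ := mug g)
  refine this.comp (by fun_prop) ?_
  intro s hs
  simp only [Set.mem_ofPred_eq, Complex.neg_re]
  refine mem_interior.2 ⟨Set.Iio (-a), fun t ht => ?_, isOpen_Iio, ?_⟩
  · have := h (-t) (by simp only [Set.mem_Iio] at ht; linarith)
    simpa using this
  · simp only [Set.mem_Iio]; have : a < s.re := hs; linarith

lemma zeta_frac {s : ℂ} (hs : 1 < s.re) :
    Zf s = s - s * (s - 1) * complexMGF Real.log (mug Int.fract) (-s) := by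
  have hs1 : s ≠ 1 := by rintro rfl; simp at hs
  have hO : (fun n : ℕ => ∑ k ∈ Icc 1 n, (fun _ : ℕ => (1:ℝ)) k) =O[atTop] fun n => (n:ℝ) ^ (1:ℝ) := by
    simp [Asymptotics.isBigO_refl]
  have h1 := LSeries_eq_mul_integral_of_nonneg (fun _ => (1:ℝ)) zero_le_one hs hO (fun _ => zero_le_one)
  have h2 : LSeries (fun n => ((1:ℝ):ℂ)) s = riemannZeta s := by
    have := LSeries_one_eq_riemannZeta hs
    rw [← this]; congr 1
  have hi1 : IntegrableOn (fun t : ℝ => (t:ℂ) * (t:ℂ) ^ (-(s+1))) (Set.Ioi 1) := by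
    have : IntegrableOn (fun t : ℝ => (t:ℂ) ^ (-s)) (Set.Ioi 1) := integrableOn_Ioi_cpow_of_lt (by simpa using hs) one_pos
    refine this.congr_fun (fun t ht => ?_) measurableSet_Ioi
    have hne : (t:ℂ) ≠ 0 := by have : (1:ℝ) < t := ht; exact_mod_cast (by linarith : t ≠ 0)
    simp only
    rw [neg_add, Complex.cpow_add _ _ hne, Complex.cpow_neg_one]; field_simp
  have hi2 : IntegrableOn (fun t : ℝ => ((Int.fract t:ℝ):ℂ) * (t:ℂ) ^ (-(s+1))) (Set.Ioi 1) := by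
    refine Integrable.mono hi1 (by fun_prop) ?_
    filter_upwards [self_mem_ae_restrict measurableSet_Ioi] with t ht
    have ht' : (1:ℝ) < t := ht
    rw [norm_mul, norm_mul]
    gcongr
    rw [Complex.norm_real, Complex.norm_real, Real.norm_of_nonneg (Int.fract_nonneg _), Real.norm_of_nonneg (by linarith)]
    linarith [Int.fract_lt_one t]
  have h3 : ∫ t in Set.Ioi (1:ℝ), (∑ k ∈ Icc 1 ⌊t⌋₊, (((fun _ : ℕ => (1:ℝ)) k : ℝ) : ℂ)) * (t:ℂ) ^ (-(s + 1))
      = (∫ t in Set.Ioi (1:ℝ), (t:ℂ) * (t:ℂ) ^ (-(s+1))) - ∫ t in Set.Ioi (1:ℝ), ((Int.fract t:ℝ):ℂ) * (t:ℂ) ^ (-(s+1)) := by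
    rw [← integral_sub hi1 hi2]
    apply setIntegral_congr_fun measurableSet_Ioi
    intro t ht
    have ht' : (1:ℝ) < t := ht
    simp only [Complex.ofReal_one, sum_const, Nat.card_Icc, add_tsub_cancel_right, nsmul_eq_mul, mul_one]
    have : (⌊t⌋₊ : ℝ) = t - Int.fract t := by
      rw [Int.fract, natCast_floor_eq_intCast_floor (by linarith)]; ring
    rw [← Complex.ofReal_natCast, this]; push_cast; ring
  have h4 : ∫ t in Set.Ioi (1:ℝ), (t:ℂ) * (t:ℂ) ^ (-(s+1)) = 1 / (s - 1) := by
    have : ∫ t in Set.Ioi (1:ℝ), (t:ℂ) * (t:ℂ) ^ (-(s+1)) = ∫ t in Set.Ioi (1:ℝ), (t:ℂ) ^ (-s) := by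
      apply setIntegral_congr_fun measurableSet_Ioi
      intro t ht
      have hne : (t:ℂ) ≠ 0 := by have : (1:ℝ) < t := ht; exact_mod_cast (by linarith : t ≠ 0)
      simp only
      rw [neg_add, Complex.cpow_add _ _ hne, Complex.cpow_neg_one]; field_simp
    rw [this, integral_Ioi_cpow_of_lt (by simpa using hs) one_pos]
    simp only [Complex.ofReal_one, Complex.one_cpow]
    have : s - 1 ≠ 0 := sub_ne_zero.2 hs1
    have : -s + 1 ≠ 0 := by intro h; apply this; linear_combination -h
    field_simp; ring
  rw [h2, h3, h4, ← mgf_int (by fun_prop) (fun t _ => Int.fract_nonneg t)] at h1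
  rw [Zf_ne hs1, h1]
  have : s - 1 ≠ 0 := sub_ne_zero.2 hs1
  field_simp

lemma Zf_real {σ : ℝ} (hσ : 0 < σ) : Zf (σ:ℂ) ≠ 0 := by
  rcases lt_or_ge σ 1 with h1 | h1
  · have hd := mgf_diffOn (g := Int.fract) (a := 0) (fun σ hσ => mgf_mem (C := 1) (a := 0) (by fun_prop) (fun t _ => Int.fract_nonneg t)
      (fun t _ => by simpa using (Int.fract_lt_one t).le) hσ)
    have := hp_ident (f := Zf) (g := fun s => s - s * (s - 1) * complexMGF Real.log (mug Int.fract) (-s)) (a := 0)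
      Zf_diff.differentiableOn (by fun_prop) (fun s h1 _ => zeta_frac h1) (σ:ℂ) (by simpa using hσ)
    rw [this, ← Complex.ofReal_neg, complexMGF_ofReal]
    have h0 : 0 ≤ mgf Real.log (mug Int.fract) (-σ) := mgf_nonneg
    have : 0 < σ - σ * (σ - 1) * mgf Real.log (mug Int.fract) (-σ) := by
      have : 0 ≤ σ * (1 - σ) * mgf Real.log (mug Int.fract) (-σ) := by
        apply mul_nonneg (mul_nonneg hσ.le (by linarith)) h0
      linarith
    exact_mod_cast this.ne'
  · by_cases h : σ = 1
    · rw [h]; simp [Zf_one]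
    · have hne : (σ:ℂ) ≠ 1 := by exact_mod_cast h
      rw [Zf_ne hne]
      exact mul_ne_zero (sub_ne_zero.2 hne) (riemannZeta_ne_zero_of_one_le_re (by simpa using h1))

end LW

namespace LW

/-- Prime indicator. -/
noncomputable def p1 (n : ℕ) : ℝ := if n.Prime then 1 else 0
/-- `1/log n`. -/
noncomputable def nl (n : ℕ) : ℝ := 1 / Real.log n

lemma nl_nonneg (n : ℕ) : 0 ≤ nl n := by
  rw [nl]; exact div_nonneg zero_le_one (Real.log_natCast_nonneg n)

lemma nl_le (n : ℕ) : nl n ≤ 2 := by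
  rcases Nat.lt_or_ge n 2 with h | h
  · interval_cases n <;> simp [nl]
  · rw [nl, div_le_iff₀ (Real.log_pos (by exact_mod_cast h))]
    have h1 := Real.log_two_gt_d9
    have h2 : Real.log 2 ≤ Real.log n := Real.log_le_log (by norm_num) (by exact_mod_cast h)
    linarith

lemma p1_nonneg (n : ℕ) : 0 ≤ p1 n := by rw [p1]; split_ifs <;> norm_num
lemma p1_le (n : ℕ) : p1 n ≤ 1 := by rw [p1]; split_ifs <;> norm_num

lemma nl_abs : LSeries.abscissaOfAbsConv (fun n => (nl n : ℂ)) ≤ 1 :=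
  LSeries.abscissaOfAbsConv_le_of_le_const ⟨2, fun n _ => by
    rw [Complex.norm_real, Real.norm_of_nonneg (nl_nonneg n)]; exact nl_le n⟩

lemma p1_abs : LSeries.abscissaOfAbsConv (fun n => (p1 n : ℂ)) ≤ 1 :=
  LSeries.abscissaOfAbsConv_le_of_le_const ⟨1, fun n _ => by
    rw [Complex.norm_real, Real.norm_of_nonneg (p1_nonneg n)]; exact p1_le n⟩

lemma nl_deriv {s : ℂ} (hs : 1 < s.re) :
    HasDerivAt (LSeries (fun n => (nl n : ℂ))) (-(riemannZeta s - 1)) s := by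
  have hs' : (1:EReal) < s.re := by exact_mod_cast hs
  have h := LSeries_hasDerivAt (lt_of_le_of_lt nl_abs hs')
  convert h using 2
  have h1 : LSeriesSummable (1 : ℕ → ℂ) s := LSeriesSummable_one_iff.2 hs
  have h2 : LSeriesSummable LSeries.delta s := by
    apply LSeriesSummable_of_abscissaOfAbsConv_lt_re
    refine lt_of_le_of_lt (LSeries.abscissaOfAbsConv_le_of_le_const ⟨1, fun n _ => ?_⟩) hs'
    rw [LSeries.delta]; split_ifs <;> simp
  have h3 := LSeries_sub h1 h2
  rw [LSeries_one_eq_riemannZeta hs, LSeries_delta, Pi.one_apply] at h3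
  rw [← h3]
  apply LSeries_congr
  intro n hn
  simp only [Pi.sub_apply, Pi.one_apply, LSeries.delta, LSeries.logMul, nl]
  by_cases h : n = 1
  · subst h; simp
  · have : (2:ℝ) ≤ n := by exact_mod_cast (by omega : 2 ≤ n)
    have hl : Real.log n ≠ 0 := (Real.log_pos (by linarith)).ne'
    have hl' : ((Real.log n : ℝ) : ℂ) ≠ 0 := by exact_mod_cast hl
    rw [if_neg h, ← Complex.natCast_log]; push_cast
    rw [Complex.natCast_log] at *
    field_simp
    simp

lemma exists_Q : ∃ Q : ℂ → ℂ, Differentiable ℂ Q ∧ ∀ s : ℂ, 1 < s.re →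
    (s - 1) * Complex.exp (LSeries (fun n => (nl n : ℂ)) s) = Complex.exp (-Q s) := by
  have hW : Differentiable ℂ (fun s => dslope Zf 1 s - 1) := by
    have : Differentiable ℂ (dslope Zf 1) := by
      rw [← differentiableOn_univ, Complex.differentiableOn_dslope univ_mem, differentiableOn_univ]
      exact Zf_diff
    fun_prop
  obtain ⟨Q, hQ⟩ := hW.isExactOn_univ
  have hQ' : ∀ s, HasDerivAt Q (dslope Zf 1 s - 1) s := fun s => hQ s trivial
  have hQd : Differentiable ℂ Q := fun s => (hQ' s).differentiableAt
  set F : ℂ → ℂ := fun s => (s - 1) * Complex.exp (LSeries (fun n => (nl n : ℂ)) s + Q s) with hF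
  have hd : ∀ s : ℂ, 1 < s.re → HasDerivAt F 0 s := by
    intro s hs
    have hs1 : s ≠ 1 := by rintro rfl; simp at hs
    have := ((hasDerivAt_id s).sub_const 1).mul (((nl_deriv hs).add (hQ' s)).cexp)
    refine this.congr_deriv ?_
    have hd : dslope Zf 1 s = riemannZeta s - 1 / (s - 1) := by
      rw [dslope_of_ne _ hs1, slope_def_field, Zf_ne hs1, Zf_one]
      have := sub_ne_zero.2 hs1
      field_simp
    have := sub_ne_zero.2 hs1
    simp only [id, Pi.add_apply, hd]
    field_simp
    ring
  have hconst : ∀ s : ℂ, 1 < s.re → F s = F 2 := by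
    intro s hs
    exact (hp_open 1).is_const_of_deriv_eq_zero (hp_preconn 1) (fun z hz => (hd z hz).differentiableAt.differentiableWithinAt)
      (fun z hz => (hd z hz).deriv) hs (by simp)
  have hK : F 2 ≠ 0 := by simp only [hF]; exact mul_ne_zero (by norm_num) (Complex.exp_ne_zero _)
  refine ⟨fun s => Q s - Complex.log (F 2), by fun_prop, fun s hs => ?_⟩
  rw [neg_sub, Complex.exp_sub, Complex.exp_log hK, ← hconst s hs, hF]
  simp only
  rw [Complex.exp_add]
  field_simp [Complex.exp_ne_zero]

lemma prime_norm {s : ℂ} (p : Nat.Primes) : ‖(p:ℂ) ^ (-s)‖ = ((p:ℕ):ℝ) ^ (-s.re) := by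
  rw [Complex.norm_natCast_cpow_of_pos p.2.pos]; simp

lemma prime_lt {s : ℂ} (hs : 1/2 < s.re) (p : Nat.Primes) : ‖(p:ℂ) ^ (-s)‖ ≤ 3/4 := by
  rw [prime_norm]
  have hp : (2:ℝ) ≤ ((p:ℕ):ℝ) := by exact_mod_cast p.2.two_le
  have h1 : ((p:ℕ):ℝ) ^ (-s.re) ≤ (2:ℝ) ^ (-s.re) := Real.rpow_le_rpow_of_nonpos (by norm_num) hp (by linarith)
  have h2 : (2:ℝ) ^ (-s.re) ≤ 2 ^ (-(1/2:ℝ)) := Real.rpow_le_rpow_of_exponent_le (by norm_num) (by linarith)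
  have h3 : (2:ℝ) ^ (-(1/2:ℝ)) ≤ 3/4 := by
    rw [Real.rpow_neg (by norm_num), ← Real.sqrt_eq_rpow]
    rw [inv_le_comm₀ (by positivity) (by norm_num)]
    apply Real.le_sqrt_of_sq_le; norm_num
  linarith

/-- Prime power correction. -/
noncomputable def hp2 (s : ℂ) : ℂ := ∑' p : Nat.Primes, (-Complex.log (1 - (p:ℂ) ^ (-s)) - (p:ℂ) ^ (-s))

lemma hp2_term {s : ℂ} (hs : 1/2 < s.re) (p : Nat.Primes) :
    ‖-Complex.log (1 - (p:ℂ) ^ (-s)) - (p:ℂ) ^ (-s)‖ ≤ 2 * ((p:ℕ):ℝ) ^ (-(2 * s.re)) := by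
  have h1 := prime_lt hs p
  have h2 := Complex.norm_log_one_add_sub_self_le (z := -(p:ℂ) ^ (-s)) (by rw [norm_neg]; linarith)
  rw [norm_neg] at h2
  have e : -Complex.log (1 - (p:ℂ) ^ (-s)) - (p:ℂ) ^ (-s) = -(Complex.log (1 + -(p:ℂ) ^ (-s)) - -(p:ℂ) ^ (-s)) := by ring_nf
  rw [e, norm_neg]
  refine h2.trans ?_
  have h3 : (1 - ‖(p:ℂ) ^ (-s)‖)⁻¹ ≤ 4 := by
    rw [inv_le_comm₀ (by linarith) (by norm_num)]; linarith
  have h4 : ‖(p:ℂ) ^ (-s)‖ ^ 2 = ((p:ℕ):ℝ) ^ (-(2 * s.re)) := by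
    rw [prime_norm, ← Real.rpow_natCast, ← Real.rpow_mul (by positivity)]; congr 1; push_cast; ring
  rw [← h4]
  have := mul_le_mul_of_nonneg_left h3 (sq_nonneg ‖(p:ℂ) ^ (-s)‖)
  linarith

lemma prime_summable {a : ℝ} (ha : 1 < a) : Summable fun p : Nat.Primes => ((p:ℕ):ℝ) ^ (-a) :=
  Nat.Primes.summable_rpow.2 (by linarith)

lemma hp2_diff : DifferentiableOn ℂ hp2 {s | 1/2 < s.re} := by
  intro s hs
  have hs' : 1/2 < s.re := hs
  obtain ⟨a, ha1, ha2⟩ := exists_between hs'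
  have := Complex.differentiableOn_tsum_of_summable_norm (U := {s : ℂ | a < s.re}) (u := fun p : Nat.Primes => 2 * ((p:ℕ):ℝ) ^ (-(2 * a)))
    (F := fun (p : Nat.Primes) s => -Complex.log (1 - (p:ℂ) ^ (-s)) - (p:ℂ) ^ (-s))
    ((prime_summable (by linarith)).mul_left 2) (fun p w hw => ?_) (hp_open a) (fun p w hw => ?_)
  · exact ((this s ha2).differentiableAt ((hp_open a).mem_nhds ha2)).differentiableWithinAt
  · have hw' : a < w.re := hw
    have hpn : (p:ℂ) ≠ 0 := by exact_mod_cast p.2.ne_zero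
    have h1 : DifferentiableAt ℂ (fun s : ℂ => (p:ℂ) ^ (-s)) w := by
      apply DifferentiableAt.const_cpow (by fun_prop) (Or.inl hpn)
    have h2 : 1 - (p:ℂ) ^ (-w) ∈ Complex.slitPlane := by
      left
      have := prime_lt (s := w) (by linarith) p
      have h3 := Complex.re_le_norm ((p:ℂ) ^ (-w))
      simp only [Complex.sub_re, Complex.one_re]; linarith
    exact ((((h1.const_sub 1).clog h2).neg).sub h1).differentiableWithinAt
  · have hw' : a < w.re := hw
    refine (hp2_term (by linarith) p).trans ?_
    have hp : (1:ℝ) ≤ ((p:ℕ):ℝ) := by exact_mod_cast p.2.one_lt.le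
    have := Real.rpow_le_rpow_of_exponent_le hp (show -(2 * w.re) ≤ -(2 * a) by linarith)
    linarith

lemma p1_L {s : ℂ} (hs : 1 < s.re) : LSeries (fun n => (p1 n : ℂ)) s = ∑' p : Nat.Primes, (p:ℂ) ^ (-s) := by
  rw [LSeries]
  have : ∑' p : Nat.Primes, ((p:ℕ):ℂ) ^ (-s) = ∑' n : ℕ, Set.indicator {n : ℕ | n.Prime} (fun n : ℕ => (n:ℂ) ^ (-s)) n :=
    tsum_subtype {n : ℕ | n.Prime} (fun n : ℕ => (n:ℂ) ^ (-s))
  rw [this]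
  apply tsum_congr
  intro n
  by_cases h : n.Prime
  · rw [Set.indicator_of_mem (by exact h), LSeries.term_of_ne_zero h.ne_zero, p1, if_pos h, Complex.cpow_neg]; simp
  · rw [Set.indicator_of_notMem (by exact h), LSeries.term, p1, if_neg h]; simp

lemma zeta_exp {s : ℂ} (hs : 1 < s.re) :
    riemannZeta s = Complex.exp (LSeries (fun n => (p1 n : ℂ)) s + hp2 s) := by
  rw [← riemannZeta_eulerProduct_exp_log hs, p1_L hs, hp2]
  have h1 : Summable fun p : Nat.Primes => (p:ℂ) ^ (-s) := by
    apply Summable.of_norm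
    simp_rw [prime_norm]; exact prime_summable hs
  have h2 : Summable fun p : Nat.Primes => (-Complex.log (1 - (p:ℂ) ^ (-s)) - (p:ℂ) ^ (-s)) := by
    apply Summable.of_norm_bounded ((prime_summable (a := 2 * s.re) (by linarith)).mul_left 2)
    intro p; exact hp2_term (by linarith) p
  rw [← h1.tsum_add h2]
  congr 2; ext p; ring

lemma main_ident : ∃ R : ℂ → ℂ, DifferentiableOn ℂ R {s | 1/2 < s.re} ∧ ∀ s : ℂ, 1 < s.re →
    Zf s = Complex.exp (LSeries (fun n => ((p1 n - nl n : ℝ) : ℂ)) s + R s) := by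
  obtain ⟨Q, hQ, hQe⟩ := exists_Q
  refine ⟨fun s => hp2 s - Q s, hp2_diff.sub hQ.differentiableOn, fun s hs => ?_⟩
  have hs' : (1:EReal) < s.re := by exact_mod_cast hs
  have hs1 : s ≠ 1 := by rintro rfl; simp at hs
  have h1 := LSeries_sub (LSeriesSummable_of_abscissaOfAbsConv_lt_re (lt_of_le_of_lt p1_abs hs'))
    (LSeriesSummable_of_abscissaOfAbsConv_lt_re (lt_of_le_of_lt nl_abs hs'))
  have h2 : (fun n => ((p1 n - nl n : ℝ) : ℂ)) = (fun n => (p1 n : ℂ)) - (fun n => (nl n : ℂ)) := by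
    ext n; simp
  rw [h2, h1, Zf_ne hs1, zeta_exp hs]
  have h3 := hQe s hs
  rw [show LSeries (fun n => (p1 n : ℂ)) s - LSeries (fun n => (nl n : ℂ)) s + (hp2 s - Q s) =
    (LSeries (fun n => (p1 n : ℂ)) s + hp2 s) - LSeries (fun n => (nl n : ℂ)) s + -Q s by ring, Complex.exp_add _ (-Q s), ← h3, Complex.exp_sub]
  field_simp [Complex.exp_ne_zero]

end LW

namespace LW
open MeasureTheory ProbabilityTheory

/-- Partial sums of `1_P(n) - 1/log n`. -/
noncomputable def As (t : ℝ) : ℝ := ∑ k ∈ Icc 1 ⌊t⌋₊, (p1 k - nl k)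

lemma As_meas : Measurable As := by
  have : Measurable fun n : ℕ => ∑ k ∈ Icc 1 n, (p1 k - nl k) := measurable_from_top
  exact this.comp Nat.measurable_floor

lemma a_abs (k : ℕ) : |p1 k - nl k| ≤ 2 := by
  rw [abs_le]; constructor <;> linarith [p1_nonneg k, p1_le k, nl_nonneg k, nl_le k]

lemma As_abs {t : ℝ} (ht : 0 ≤ t) : |As t| ≤ 2 * t := by
  rw [As]
  refine (Finset.abs_sum_le_sum_abs _ _).trans ((Finset.sum_le_sum fun k _ => a_abs k).trans ?_)
  simp only [sum_const, Nat.card_Icc, add_tsub_cancel_right, nsmul_eq_mul]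
  linarith [Nat.floor_le ht]

lemma As_L {s : ℂ} (hs : 1 < s.re) : LSeries (fun n => ((p1 n - nl n : ℝ) : ℂ)) s
    = s * ∫ t in Set.Ioi (1:ℝ), (As t : ℂ) * (t:ℂ) ^ (-(s+1)) := by
  rw [LSeries_eq_mul_integral' (fun n => ((p1 n - nl n : ℝ) : ℂ)) zero_le_one hs]
  · congr 2; ext t; rw [As]; push_cast; rfl
  · refine Asymptotics.IsBigO.of_bound 2 (Eventually.of_forall fun n => ?_)
    rw [Real.norm_of_nonneg (Finset.sum_nonneg fun _ _ => norm_nonneg _), Real.rpow_one, Real.norm_of_nonneg (by positivity)]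
    refine (Finset.sum_le_sum (g := fun _ => (2:ℝ)) fun k _ => ?_).trans ?_
    · rw [Complex.norm_real]; exact a_abs k
    · simp [mul_comm]

lemma landau_mgf {α B ε : ℝ} (hα1 : α < 1) (hε : ε * ε = 1)
    {s : ℂ} (hs : 1 < s.re) (hB : ∀ t, 1 < t → ε * As t ≤ B * t ^ α) :
    LSeries (fun n => ((p1 n - nl n : ℝ) : ℂ)) s =
      ε * s * (B / (s - α) - complexMGF Real.log (mug fun t => B * t ^ α - ε * As t) (-s)) := by
  have hmeas : Measurable (fun t : ℝ => B * t ^ α - ε * As t) := by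
    have := As_meas
    fun_prop
  rw [As_L hs, mgf_int hmeas (fun t ht => by linarith [hB t ht])]
  have hi1 : IntegrableOn (fun t : ℝ => (t:ℂ) ^ ((α:ℂ) - s - 1)) (Set.Ioi 1) :=
    integrableOn_Ioi_cpow_of_lt (by simp; linarith) one_pos
  have hi2 : IntegrableOn (fun t : ℝ => (As t : ℂ) * (t:ℂ) ^ (-(s+1))) (Set.Ioi 1) := by
    have : IntegrableOn (fun t : ℝ => 2 * t ^ (-s.re)) (Set.Ioi 1) := (integrableOn_Ioi_rpow_of_lt (by linarith) one_pos).const_mul 2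
    have hm := As_meas
    refine Integrable.mono' this (by fun_prop) ?_
    filter_upwards [self_mem_ae_restrict measurableSet_Ioi] with t ht
    have ht' : (1:ℝ) < t := ht
    have ht0 : 0 < t := by linarith
    rw [norm_mul, Complex.norm_real, Complex.norm_cpow_eq_rpow_re_of_pos ht0]
    have h1 : t ^ (-s.re) = t * t ^ (-(s+1)).re := by
      nth_rw 2 [← Real.rpow_one t]
      rw [← Real.rpow_add ht0]; simp
    rw [h1, ← mul_assoc]
    exact mul_le_mul_of_nonneg_right (As_abs ht0.le) (Real.rpow_nonneg ht0.le _)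
  have e : ∫ t in Set.Ioi (1:ℝ), ((B * t ^ α - ε * As t : ℝ) : ℂ) * (t:ℂ) ^ (-(s+1)) =
      B * (∫ t in Set.Ioi (1:ℝ), (t:ℂ) ^ ((α:ℂ) - s - 1)) - ε * ∫ t in Set.Ioi (1:ℝ), (As t : ℂ) * (t:ℂ) ^ (-(s+1)) := by
    rw [← integral_const_mul, ← integral_const_mul, ← integral_sub (hi1.const_mul _) (hi2.const_mul _)]
    apply setIntegral_congr_fun measurableSet_Ioi
    intro t ht
    have ht' : (1:ℝ) < t := ht
    have ht0 : 0 < t := by linarith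
    have hne : (t:ℂ) ≠ 0 := by exact_mod_cast ht0.ne'
    simp only
    rw [show (α:ℂ) - s - 1 = α + (-(s+1)) by ring, Complex.cpow_add _ _ hne]
    push_cast [Complex.ofReal_cpow ht0.le]
    ring
  rw [e, integral_Ioi_cpow_of_lt (by simp; linarith) one_pos]
  simp only [Complex.ofReal_one, Complex.one_cpow]
  have h1 : s - α ≠ 0 := by
    intro h; have := congrArg Complex.re h; simp at this; linarith
  have h2 : (α:ℂ) - s - 1 + 1 = -(s - α) := by ring
  rw [h2]
  have hε' : (ε:ℂ) * ε = 1 := by exact_mod_cast hε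
  generalize (∫ t in Set.Ioi (1:ℝ), (As t : ℂ) * (t:ℂ) ^ (-(s+1))) = I
  rw [neg_div_neg_eq]
  linear_combination (-s * I) * hε'

lemma landau_case {ρ : ℂ} (hρ : Zf ρ = 0) {α B ε : ℝ} (hα : 1/2 < α) (hα1 : α < 1) (hαρ : α < ρ.re)
    (hε : ε * ε = 1) (hB : ∀ t, 1 < t → ε * As t ≤ B * t ^ α) : False := by
  obtain ⟨R, hR, hRe⟩ := main_ident
  have hmeas : Measurable (fun t : ℝ => B * t ^ α - ε * As t) := by
    have := As_meas
    fun_prop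
  set g : ℝ → ℝ := fun t => B * t ^ α - ε * As t with hg
  have hg0 : ∀ t, 1 < t → 0 ≤ g t := fun t ht => by simp only [hg]; linarith [hB t ht]
  have hεa : |ε| = 1 := by
    have : |ε| * |ε| = 1 := by rw [← abs_mul, hε, abs_one]
    nlinarith [abs_nonneg ε]
  have hgb : ∀ t, 1 < t → g t ≤ (|B| + 2) * t ^ (1:ℝ) := by
    intro t ht
    rw [Real.rpow_one]
    have h1 : t ^ α ≤ t := by
      have := Real.rpow_le_rpow_of_exponent_le ht.le hα1.le
      rwa [Real.rpow_one] at this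
    have h2 : B * t ^ α ≤ |B| * t :=
      (mul_le_mul_of_nonneg_right (le_abs_self B) (by positivity)).trans (mul_le_mul_of_nonneg_left h1 (abs_nonneg _))
    have h3 : |ε * As t| ≤ 2 * t := by rw [abs_mul, hεa, one_mul]; exact As_abs (by linarith)
    simp only [hg]
    linarith [neg_abs_le (ε * As t)]
  set S := integrableExpSet Real.log (mug g) with hS
  set M : ℂ → ℂ := fun s => complexMGF Real.log (mug g) (-s) with hM
  have hS1 : ∀ σ, 1 < σ → -σ ∈ S := fun σ hσ => mgf_mem hmeas hg0 hgb hσ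
  have hSle : ∀ t t', t' ∈ S → t ≤ t' → t ∈ S := by
    intro t t' ht' h
    have h2 : -(max 2 (-t)) ∈ S := hS1 _ (lt_of_lt_of_le (by norm_num) (le_max_left _ _))
    exact integrable_exp_mul_of_le_of_le h2 ht' (by linarith [le_max_right 2 (-t)]) h
  set Ψ : ℂ → ℂ := fun s => ε * s * (B / (s - α) - M s) + R s with hΨ
  have hΨd : ∀ β, α ≤ β → (∀ σ, β < σ → -σ ∈ S) → DifferentiableOn ℂ Ψ {s | β < s.re} := by
    intro β hβ h
    have h1 := mgf_diffOn h
    have h2 : DifferentiableOn ℂ R {s | β < s.re} := hR.mono fun s hs => by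
      have : β < s.re := hs
      show 1/2 < s.re
      linarith
    have h3 : DifferentiableOn ℂ (fun s : ℂ => (B:ℂ) / (s - α)) {s | β < s.re} := by
      intro s hs
      have hs' : β < s.re := hs
      have : s - α ≠ 0 := by
        intro h; have := congrArg Complex.re h; simp at this; linarith
      have hd : DifferentiableAt ℂ (fun s : ℂ => s - (α:ℂ)) s := by fun_prop
      exact ((differentiableAt_const (B:ℂ)).div hd this).differentiableWithinAt
    exact ((differentiableOn_const _).mul differentiableOn_id |>.mul (h3.sub h1)).add h2
  have hid : ∀ β, α ≤ β → (∀ σ, β < σ → -σ ∈ S) → ∀ s : ℂ, β < s.re → Zf s = Complex.exp (Ψ s) := by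
    intro β hβ h
    refine hp_ident Zf_diff.differentiableOn (hΨd β hβ h).cexp ?_
    intro s hs _
    rw [hRe s hs, landau_mgf hα1 hε hs hB]
  suffices hall : ∀ σ, α < σ → -σ ∈ S by
    have := hid α le_rfl hall ρ hαρ
    rw [hρ] at this
    exact Complex.exp_ne_zero _ this.symm
  by_contra! hcon
  obtain ⟨σ0, hσ0, hn⟩ := hcon
  have hub : ∀ t ∈ S, t ≤ -σ0 := by
    intro t ht; by_contra! h; exact hn (hSle _ t ht h.le)
  have hne : S.Nonempty := ⟨-2, hS1 2 (by norm_num)⟩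
  have hbdd : BddAbove S := ⟨-σ0, hub⟩
  set b := sSup S with hb
  have hbσ : b ≤ -σ0 := csSup_le hne hub
  have hlt : ∀ t < b, t ∈ S := by
    intro t ht
    obtain ⟨t', ht', h⟩ := exists_lt_of_lt_csSup hne ht
    exact hSle t t' ht' h.le
  set β := -b with hβ
  have hβα : α < β := by rw [hβ]; linarith
  have hβS : ∀ σ, β < σ → -σ ∈ S := fun σ hσ => hlt _ (by rw [hβ] at hσ; linarith)
  have hZ := hid β hβα.le hβS
  have hZd := hΨd β hβα.le hβS
  have hZβ : Zf (β:ℂ) ≠ 0 := Zf_real (by linarith)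
  have hopen : IsOpen ({s : ℂ | Zf s ≠ 0} ∩ {s | α < s.re}) :=
    (isOpen_ne_fun Zf_diff.continuous continuous_const).inter (hp_open α)
  obtain ⟨r, hr, hball⟩ := Metric.isOpen_iff.1 hopen (β:ℂ) ⟨hZβ, by simpa using hβα⟩
  have hld : DifferentiableOn ℂ (fun s => deriv Zf s / Zf s) (Metric.ball (β:ℂ) r) := by
    intro s hs
    have hd : DifferentiableAt ℂ (deriv Zf) s := (Zf_diff.analyticAt s).deriv.differentiableAt
    exact (hd.div (Zf_diff s) (hball hs).1).differentiableWithinAt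
  obtain ⟨ℓ, hℓ⟩ := hld.isExactOn_ball
  have hU : IsOpen (Metric.ball (β:ℂ) r ∩ {s | β < s.re}) := Metric.isOpen_ball.inter (hp_open β)
  have hUc : IsPreconnected (Metric.ball (β:ℂ) r ∩ {s | β < s.re}) :=
    ((convex_ball _ _).inter (convex_halfSpace_re_gt β)).isPreconnected
  have hder : ∀ s ∈ Metric.ball (β:ℂ) r ∩ {s | β < s.re}, HasDerivAt (fun s => Ψ s - ℓ s) 0 s := by
    intro s hs
    have h1 := ((hZd s hs.2).differentiableAt ((hp_open β).mem_nhds hs.2)).hasDerivAt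
    have h2 := h1.cexp
    have h3 : HasDerivAt Zf (Complex.exp (Ψ s) * deriv Ψ s) s := by
      refine h2.congr_of_eventuallyEq ?_
      filter_upwards [(hp_open β).mem_nhds hs.2] with z hz using hZ z hz
    have h4 := h3.deriv
    rw [← hZ s hs.2] at h4
    refine (h1.sub (hℓ s hs.1)).congr_deriv ?_
    have := (hball hs.1).1
    show deriv Ψ s - deriv Zf s / Zf s = 0
    rw [h4, mul_div_cancel_left₀ _ this, sub_self]
  obtain ⟨k, hk⟩ := hU.exists_is_const_of_deriv_eq_zero hUc (fun s hs => (hder s hs).differentiableAt.differentiableWithinAt)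
    (fun s hs => (hder s hs).deriv)
  have hε' : (ε:ℂ) * ε = 1 := by exact_mod_cast hε
  have hnegb : ∀ z ∈ Metric.ball (b:ℂ) r, -z ∈ Metric.ball (β:ℂ) r := by
    intro z hz
    rw [Metric.mem_ball, hβ, Complex.ofReal_neg, dist_neg_neg]; exact hz
  obtain ⟨b', hb', hb'S⟩ := landau (mug_nonneg g) hr hlt
    (fun z => B / (-z - α) - ε * (ℓ (-z) + k - R (-z)) / (-z)) (by
      intro z hz
      have h1 := hball (hnegb z hz)
      have h2 : α < (-z).re := h1.2
      have h3 : -z ≠ 0 := by intro h; rw [h] at h2; simp at h2; linarith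
      have h4 : -z - α ≠ 0 := by
        intro h; have := congrArg Complex.re h; simp at this h2; linarith
      have h5 : DifferentiableAt ℂ ℓ (-z) := (hℓ (-z) (hnegb z hz)).differentiableAt
      have h6 : DifferentiableAt ℂ R (-z) := by
        have : 1/2 < (-z).re := by linarith
        exact (hR (-z) this).differentiableAt ((hp_open (1/2)).mem_nhds this)
      have h7 : DifferentiableAt ℂ (fun z => ℓ (-z)) z := h5.comp z (by fun_prop)
      have h8 : DifferentiableAt ℂ (fun z => R (-z)) z := h6.comp z (by fun_prop)
      refine DifferentiableAt.differentiableWithinAt ?_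
      have hd : DifferentiableAt ℂ (fun z : ℂ => -z - (α:ℂ)) z := by fun_prop
      have hd2 : DifferentiableAt ℂ (fun z : ℂ => -z) z := by fun_prop
      exact ((differentiableAt_const (B:ℂ)).div hd h4).sub ((((h7.add_const k).sub h8).const_mul (ε:ℂ)).div hd2 h3)) (by
      intro z hz hzb
      have h0 := hnegb z hz
      have h2 : α < (-z).re := (hball h0).2
      have h3 : -z ≠ 0 := by intro h; rw [h] at h2; simp at h2; linarith
      have h1 := hk (-z) ⟨h0, by show β < (-z).re; rw [Complex.neg_re, hβ]; linarith⟩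
      simp only [hΨ, hM, neg_neg] at h1
      have h9 : ℓ (-z) + k - R (-z) = ε * -z * (B / (-z - α) - complexMGF Real.log (mug g) z) := by
        rw [← h1]; ring
      simp only [h9]
      rw [show (ε:ℂ) * (ε * -z * (B / (-z - α) - complexMGF Real.log (mug g) z)) = (ε * ε) * (-z) * (B / (-z - α) - complexMGF Real.log (mug g) z) by ring, hε', one_mul, mul_div_cancel_left₀ _ h3]
      ring)
  exact absurd (le_csSup hbdd hb'S) (not_le.2 hb')

end LW

namespace LW

lemma pi_sum (t : ℝ) : primePi t = ∑ k ∈ Icc 1 ⌊t⌋₊, p1 k := by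
  rw [primePi, Finset.card_filter]
  push_cast
  have : Icc 1 ⌊t⌋₊ ⊆ Finset.Iic ⌊t⌋₊ := fun k hk => by
    simp only [Finset.mem_Icc, Finset.mem_Iic] at *; exact hk.2
  symm
  apply Finset.sum_subset this
  intro k hk hk'
  simp only [Finset.mem_Icc, Finset.mem_Iic] at *
  have : k = 0 := by omega
  subst this
  simp [p1, Nat.not_prime_zero]

lemma invlog_anti {a b : ℝ} (ha : 2 ≤ a) : AntitoneOn (fun t : ℝ => 1 / Real.log t) (Set.Icc a b) := by
  intro x hx y hy hxy
  have h2 : 0 < Real.log x := Real.log_pos (by linarith [hx.1])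
  exact one_div_le_one_div_of_le h2 (Real.log_le_log (by linarith [hx.1]) hxy)

lemma invlog_int {a b : ℝ} (ha : 2 ≤ a) (hab : a ≤ b) :
    IntervalIntegrable (fun t : ℝ => 1 / Real.log t) MeasureTheory.volume a b := by
  apply AntitoneOn.intervalIntegrable
  rw [Set.uIcc_of_le hab]; exact invlog_anti ha

lemma li_mono {a b : ℝ} (ha : 2 ≤ a) (hab : a ≤ b) : li a ≤ li b := by
  have h := intervalIntegral.integral_add_adjacent_intervals (invlog_int le_rfl ha) (invlog_int ha hab)
  have h2 : 0 ≤ ∫ t in a..b, 1 / Real.log t := by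
    apply intervalIntegral.integral_nonneg hab
    intro t ht
    exact div_nonneg zero_le_one (Real.log_nonneg (by linarith [ht.1]))
  rw [li, li, ← h]; linarith

lemma As_pi {t : ℝ} (ht : 2 ≤ t) : |As t - (primePi t - li t)| ≤ 2 := by
  set n := ⌊t⌋₊ with hn
  have hn2 : 2 ≤ n := Nat.le_floor (by exact_mod_cast ht)
  have hnt : (n:ℝ) ≤ t := Nat.floor_le (by linarith)
  have htn : t ≤ ((n+1:ℕ):ℝ) := by push_cast; exact (Nat.lt_floor_add_one t).le
  have e : As t - (primePi t - li t) = li t - ∑ k ∈ Icc 1 n, nl k := by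
    rw [pi_sum, As, Finset.sum_sub_distrib]; ring
  have hn2' : (2:ℝ) ≤ n := by exact_mod_cast hn2
  have h1 := AntitoneOn.integral_le_sum_Ico (f := fun t : ℝ => 1 / Real.log t) (a := 2) (b := n+1) (by omega) (invlog_anti (by norm_num))
  have h2 := AntitoneOn.sum_le_integral_Ico (f := fun t : ℝ => 1 / Real.log t) (a := 2) (b := n) hn2 (invlog_anti (by norm_num))
  have h3 : li n ≤ li t := li_mono hn2' hnt
  have h4 : li t ≤ li ((n+1:ℕ):ℝ) := li_mono ht htn
  have e1 : ∑ k ∈ Icc 1 n, nl k = ∑ k ∈ Finset.Ico 2 (n+1), nl k := by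
    have : Icc 1 n = Finset.Ico 1 (n+1) := by ext; simp [Nat.lt_succ_iff]
    rw [this, Finset.sum_eq_sum_Ico_succ_bot (by omega)]
    simp [nl]
  have e2 : ∑ k ∈ Finset.Ico 2 (n+1), nl k = nl 2 + ∑ k ∈ Finset.Ico 2 n, nl (k+1) := by
    rw [Finset.sum_eq_sum_Ico_succ_bot (by omega), Finset.sum_Ico_add' nl 2 n 1]
  simp only [li] at h3 h4 e ⊢
  simp only [nl] at e1 e2 e
  push_cast at *
  have h5 := nl_le 2
  simp only [nl] at h5
  push_cast at h5
  rw [e, abs_le]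
  constructor <;> linarith

lemma xi_to_Zf {ρ : ℂ} (h : xi ρ = 0) (hr : ρ.re ≠ 1/2) : ∃ ρ' : ℂ, Zf ρ' = 0 ∧ 1/2 < ρ'.re ∧ ρ'.re < 1 := by
  have key : ∀ ρ : ℂ, xi ρ = 0 → 1/2 < ρ.re → Zf ρ = 0 ∧ ρ.re < 1 := by
    intro ρ h hr
    have h0 : ρ ≠ 0 := by rintro rfl; simp at hr; linarith
    have h1 : ρ ≠ 1 := by
      rintro rfl
      have := xi_one_sub 1
      rw [sub_self, xi_zero] at this
      rw [h] at this; exact one_ne_zero this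
    rw [xi_eq h0 h1] at h
    have h2 : completedRiemannZeta ρ = 0 := by
      rcases mul_eq_zero.1 h with h | h
      · rcases mul_eq_zero.1 h with h | h
        · exact absurd h h0
        · exact absurd (sub_eq_zero.1 h) h1
      · exact h
    have h3 : riemannZeta ρ = 0 := by rw [riemannZeta_def_of_ne_zero h0, h2, zero_div]
    refine ⟨by rw [Zf_ne h1, h3, mul_zero], ?_⟩
    by_contra! h4
    exact riemannZeta_ne_zero_of_one_le_re h4 h3
  rcases lt_or_gt_of_ne hr with h1 | h1
  · have := key (1 - ρ) (by rw [xi_one_sub, h]) (by simp; linarith)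
    exact ⟨1 - ρ, this.1, by simp; linarith, this.2⟩
  · exact ⟨ρ, (key ρ h h1).1, h1, (key ρ h h1).2⟩

lemma lll_le {x : ℝ} (hx : Real.exp (Real.exp 1) ≤ x) :
    1 * x ^ ((1:ℝ)/2) * Real.log (Real.log (Real.log x)) / Real.log x ≤ x ^ ((1:ℝ)/2) := by
  have hx0 : 0 < x := lt_of_lt_of_le (Real.exp_pos _) hx
  have h1 : Real.exp 1 ≤ Real.log x := (Real.le_log_iff_exp_le hx0).2 hx
  have hl : 0 < Real.log x := lt_of_lt_of_le (Real.exp_pos _) h1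
  have h2 : 1 ≤ Real.log (Real.log x) := (Real.le_log_iff_exp_le hl).2 h1
  have h3 : Real.log (Real.log (Real.log x)) ≤ Real.log x :=
    (Real.log_le_self (by linarith)).trans (Real.log_le_self hl.le)
  rw [one_mul, div_le_iff₀ hl]
  exact mul_le_mul_of_nonneg_left h3 (Real.rpow_nonneg hx0.le _)

lemma nonRH_case {ρ : ℂ} (hρ : Zf ρ = 0) (h1 : 1/2 < ρ.re) (h2 : ρ.re < 1) {ε : ℝ} (hε : ε = 1 ∨ ε = -1) (X : ℝ) :
    ∃ x, X ≤ x ∧ 1 * x ^ ((1:ℝ)/2) * Real.log (Real.log (Real.log x)) / Real.log x < ε * (primePi x - li x) := by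
  by_contra! hcon
  obtain ⟨α, ha1, ha2⟩ := exists_between h1
  set X1 := max X (max (Real.exp (Real.exp 1)) 2) with hX1
  have hX1a : X ≤ X1 := le_max_left _ _
  have hX1b : Real.exp (Real.exp 1) ≤ X1 := (le_max_left _ _).trans (le_max_right _ _)
  have hX1c : 2 ≤ X1 := (le_max_right _ _).trans (le_max_right _ _)
  have hεε : ε * ε = 1 := by rcases hε with rfl | rfl <;> norm_num
  have hεa : |ε| = 1 := by rcases hε with rfl | rfl <;> norm_num
  refine landau_case hρ ha1 (by linarith) ha2 hεε (B := 2 * X1 + 3) ?_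
  intro t ht
  have htα : 1 ≤ t ^ α := Real.one_le_rpow ht.le (by linarith)
  rcases le_total X1 t with h | h
  · have h3 := hcon t (hX1a.trans h)
    have h4 := lll_le (hX1b.trans h)
    -- compare exponents
    have h5 : t ^ ((1:ℝ)/2) ≤ t ^ α := Real.rpow_le_rpow_of_exponent_le ht.le ha1.le
    have h6 : |ε * (As t - (primePi t - li t))| ≤ 2 := by
      rw [abs_mul, hεa, one_mul]; exact As_pi (hX1c.trans h)
    have h7 := le_abs_self (ε * (As t - (primePi t - li t)))
    have h8 : 0 ≤ X1 * t ^ α := by positivity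
    linarith
  · have h6 : |ε * As t| ≤ 2 * t := by
      rw [abs_mul, hεa, one_mul]; exact As_abs (by linarith)
    have h7 := le_abs_self (ε * As t)
    have h8 : X1 * 1 ≤ X1 * t ^ α := mul_le_mul_of_nonneg_left htα (by linarith)
    linarith

end LW

/-- Littlewood's oscillation theorem:
`π(x) − li(x) = Ω±(x^{1/2} log log log x / log x)` as `x → ∞`. -/
theorem littlewood_oscillation :
    ∃ c : ℝ, 0 < c ∧
      (∀ X : ℝ, ∃ x : ℝ, X ≤ x ∧
        primePi x - li x >
          c * x ^ ((1:ℝ)/2) * Real.log (Real.log (Real.log x)) / Real.log x) ∧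
      (∀ X : ℝ, ∃ x : ℝ, X ≤ x ∧
        primePi x - li x <
          -(c * x ^ ((1:ℝ)/2) * Real.log (Real.log (Real.log x)) / Real.log x)) := by
  by_cases hRH : ∀ ρ : ℂ, LW.xi ρ = 0 → ρ.re = 1/2
  · obtain ⟨c, hc, h⟩ := LW.rh_case hRH
    exact ⟨c, hc, fun X => (h X).1, fun X => (h X).2⟩
  · push Not at hRH
    obtain ⟨ρ, h0, hr⟩ := hRH
    obtain ⟨ρ', hz, h1, h2⟩ := LW.xi_to_Zf h0 hr
    refine ⟨1, one_pos, fun X => ?_, fun X => ?_⟩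
    · obtain ⟨x, hx, h⟩ := LW.nonRH_case hz h1 h2 (ε := 1) (Or.inl rfl) X
      exact ⟨x, hx, by linarith⟩
    · obtain ⟨x, hx, h⟩ := LW.nonRH_case hz h1 h2 (ε := -1) (Or.inr rfl) X
      exact ⟨x, hx, by linarith⟩
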